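/- Fix an integer k ≥ 2 and ε > 0. There is a constant C depending only on k and ε such that for all real R, S ≥ 1, Σ_{q ≤ R} Σ_{χ mod q, χ ≠ χ₀} ∫_0^S |L(1/2 + it, χ)|^{2k} dt ≤ C · (R² S + (R S)^{k/2}) (R S)^ε, where the inner sum runs over non-principal Dirichlet characters χ modulo q and L(s,χ) is the Dirichlet L-function of χ. -/

import Mathlib

open MeasureTheory Complex
open scoped Classical

/-- `∑_{χ mod q, χ ≠ χ₀} ∫₀^S |L(1/2+it,χ)|^{2k} dt`. -/
noncomputable def charMoment (k q : ℕ) (S : ℝ) : ℝ :=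
  if h : q ≠ 0 then
    haveI : NeZero q := ⟨h⟩
    ∑' χ : DirichletCharacter ℂ q,
      (if χ ≠ 1 then
        ∫ t in (0 : ℝ)..S, ‖DirichletCharacter.LFunction χ (1/2 + t * Complex.I)‖^(2*k)
      else 0)
  else 0

lemma ofReal_norm_sq_sum {ι : Type*} (s : Finset ι) (f : ι → ℂ) :
    ((‖∑ i ∈ s, f i‖ ^ 2 : ℝ) : ℂ) =
      ∑ i ∈ s, ∑ j ∈ s, f i * (starRingEnd ℂ) (f j) := by
  rw [ofReal_pow, ← Complex.mul_conj', map_sum, Finset.sum_mul_sum]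

lemma integral_norm_sq_sum_exp (s : Finset ℕ) (c : ℕ → ℂ) (a : ℝ) :
    ∫ y in (0 : ℝ)..2, ‖∑ n ∈ s, c n * cexp (2 * Real.pi * I * ((n : ℂ) - a) * y)‖ ^ 2 =
      2 * ∑ n ∈ s, ‖c n‖ ^ 2 := by
  apply Complex.ofReal_injective
  rw [← intervalIntegral.integral_ofReal]
  simp_rw [ofReal_norm_sq_sum]
  have key : ∀ n m : ℕ, ∫ y in (0 : ℝ)..2,
      c n * cexp (2 * Real.pi * I * ((n : ℂ) - a) * y) *
        (starRingEnd ℂ) (c m * cexp (2 * Real.pi * I * ((m : ℂ) - a) * y)) =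
      if n = m then 2 * ((‖c n‖ ^ 2 : ℝ) : ℂ) else 0 := by
    intro n m
    have h1 : ∀ y : ℝ, c n * cexp (2 * Real.pi * I * ((n : ℂ) - a) * y) *
        (starRingEnd ℂ) (c m * cexp (2 * Real.pi * I * ((m : ℂ) - a) * y)) =
        c n * (starRingEnd ℂ) (c m) * cexp ((2 * Real.pi * I * ((n : ℂ) - m)) * y) := by
      intro y
      rw [map_mul, ← exp_conj, mul_mul_mul_comm, ← exp_add]
      have h2 : (starRingEnd ℂ) 2 = 2 := map_ofNat _ 2
      congr 2
      simp only [map_mul, map_sub, h2, conj_ofReal, conj_I, map_natCast]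
      ring
    simp_rw [h1]
    rw [intervalIntegral.integral_const_mul]
    split_ifs with h
    · subst h
      rw [Complex.mul_conj']
      simp
      ring
    · have h2 : (2 * Real.pi * I * ((n : ℂ) - m)) ≠ 0 := by
        have : (n : ℂ) - m ≠ 0 := sub_ne_zero.mpr (by exact_mod_cast h)
        simp [Real.pi_ne_zero, this]
      rw [integral_exp_mul_complex h2]
      have h3 : cexp ((2 * Real.pi * I * ((n : ℂ) - m)) * (2 : ℝ)) = 1 := by
        rw [Complex.exp_eq_one_iff]
        exact ⟨2 * ((n : ℤ) - m), by push_cast; ring⟩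
      rw [h3]
      simp
  rw [intervalIntegral.integral_finsetSum]
  · have : ∀ n ∈ s, (∫ y in (0 : ℝ)..2, ∑ m ∈ s,
      c n * cexp (2 * Real.pi * I * ((n : ℂ) - a) * y) *
        (starRingEnd ℂ) (c m * cexp (2 * Real.pi * I * ((m : ℂ) - a) * y))) =
        2 * ((‖c n‖ ^ 2 : ℝ) : ℂ) := by
      intro n hn
      rw [intervalIntegral.integral_finsetSum]
      · simp_rw [key]
        simp [hn]
      · intro m _
        apply Continuous.intervalIntegrable
        fun_prop
    rw [Finset.sum_congr rfl this]
    push_cast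
    rw [Finset.mul_sum]
  · intro n _
    apply Continuous.intervalIntegrable
    fun_prop

/-- A Sobolev-type inequality bounding a point value by an integral over a short interval. -/
lemma norm_sq_le_integral_Ioc {f f' : ℝ → ℂ} (hf : ∀ x, HasDerivAt f (f' x) x)
    (hf' : Continuous f') {d l : ℝ} (hd : 0 < d) (hl : 0 < l) (x : ℝ) :
    ‖f x‖ ^ 2 ≤ ∫ y in Set.Ioc x (x + d), ((d⁻¹ + l) * ‖f y‖ ^ 2 + l⁻¹ * ‖f' y‖ ^ 2) := by
  have hfc : Continuous f := continuous_iff_continuousAt.mpr fun y => (hf y).continuousAt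
  set h : ℝ → ℝ := fun y => l * ‖f y‖ ^ 2 + l⁻¹ * ‖f' y‖ ^ 2 with hh
  have hhc : Continuous h := by fun_prop
  have hh0 : ∀ y, 0 ≤ h y := fun y => by positivity
  set g' : ℝ → ℝ := fun y => 2 * inner ℝ (f y) (f' y) with hg'
  have hg'c : Continuous g' := by fun_prop
  have hg'h : ∀ y, |g' y| ≤ h y := by
    intro y
    have h1 := abs_real_inner_le_norm (f y) (f' y)
    have h2 : |g' y| ≤ 2 * (‖f y‖ * ‖f' y‖) := by
      rw [hg']; simp only [abs_mul, abs_two]; linarith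
    refine h2.trans ?_
    have h3 : 0 ≤ l * (‖f y‖ - l⁻¹ * ‖f' y‖) ^ 2 := by positivity
    have h4 : l * (‖f y‖ - l⁻¹ * ‖f' y‖) ^ 2 =
        l * ‖f y‖ ^ 2 + l⁻¹ * ‖f' y‖ ^ 2 - 2 * (‖f y‖ * ‖f' y‖) := by
      field_simp; ring
    rw [hh]; simp only; linarith
  have hxd : x ≤ x + d := by linarith
  have hpt : ∀ y ∈ Set.Icc x (x + d), ‖f x‖ ^ 2 ≤ ‖f y‖ ^ 2 + ∫ z in x..(x + d), h z := by
    intro y hy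
    have h1 : ∫ z in x..y, g' z = ‖f y‖ ^ 2 - ‖f x‖ ^ 2 := by
      apply intervalIntegral.integral_eq_sub_of_hasDerivAt
      · intro z _
        exact (hf z).norm_sq
      · exact hg'c.intervalIntegrable _ _
    have h2 : |∫ z in x..y, g' z| ≤ ∫ z in x..y, h z := by
      refine (intervalIntegral.abs_integral_le_integral_abs hy.1).trans ?_
      exact intervalIntegral.integral_mono_on hy.1 (hg'c.abs.intervalIntegrable _ _)
        (hhc.intervalIntegrable _ _) (fun z _ => hg'h z)
    have h3 : ∫ z in x..y, h z ≤ ∫ z in x..(x + d), h z := by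
      apply intervalIntegral.integral_mono_interval le_rfl hy.1 hy.2
      · exact Filter.Eventually.of_forall hh0
      · exact hhc.intervalIntegrable _ _
    have := (abs_le.mp h2).1
    linarith
  have h_int : d * ‖f x‖ ^ 2 ≤ (∫ y in x..(x + d), ‖f y‖ ^ 2) + d * ∫ z in x..(x + d), h z := by
    have := intervalIntegral.integral_mono_on (μ := volume) hxd
      (f := fun _ => ‖f x‖ ^ 2) (g := fun y => ‖f y‖ ^ 2 + ∫ z in x..(x + d), h z)
      intervalIntegrable_const ((by fun_prop : Continuous _).intervalIntegrable _ _) hpt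
    rw [intervalIntegral.integral_add ((by fun_prop : Continuous _).intervalIntegrable _ _)
      intervalIntegrable_const] at this
    simpa using this
  rw [← intervalIntegral.integral_of_le hxd]
  have hsplit : ∫ y in x..(x + d), ((d⁻¹ + l) * ‖f y‖ ^ 2 + l⁻¹ * ‖f' y‖ ^ 2) =
      d⁻¹ * (∫ y in x..(x + d), ‖f y‖ ^ 2) + ∫ z in x..(x + d), h z := by
    rw [← intervalIntegral.integral_const_mul, ← intervalIntegral.integral_add
      ((by fun_prop : Continuous _).intervalIntegrable _ _) (hhc.intervalIntegrable _ _)]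
    congr 1
    ext y
    rw [hh]; ring
  rw [hsplit]
  have : ‖f x‖ ^ 2 = d⁻¹ * (d * ‖f x‖ ^ 2) := by field_simp
  rw [this]
  calc _ ≤ d⁻¹ * ((∫ y in x..(x + d), ‖f y‖ ^ 2) + d * ∫ z in x..(x + d), h z) := by gcongr
    _ = _ := by field_simp

/-- The additive large sieve for well-spaced points, with weights centred at `a`. -/
lemma additive_large_sieve {ι : Type*} (P : Finset ι) (x : ι → ℝ) {d : ℝ} (hd : 0 < d)
    (hd1 : d ≤ 1) (hx : ∀ i ∈ P, 0 ≤ x i ∧ x i ≤ 1)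
    (hsep : ∀ i ∈ P, ∀ j ∈ P, i ≠ j → d ≤ |x i - x j|)
    (s : Finset ℕ) (b : ℕ → ℂ) (a : ℝ) {l : ℝ} (hl : 0 < l) :
    ∑ i ∈ P, ‖∑ n ∈ s, b n * cexp (2 * Real.pi * I * n * x i)‖ ^ 2 ≤
      2 * ((d⁻¹ + l) * ∑ n ∈ s, ‖b n‖ ^ 2 +
        l⁻¹ * ∑ n ∈ s, (2 * Real.pi) ^ 2 * ((n : ℝ) - a) ^ 2 * ‖b n‖ ^ 2) := by
  set f : ℝ → ℂ := fun y => ∑ n ∈ s, b n * cexp (2 * Real.pi * I * ((n : ℂ) - a) * y) with hf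
  set f' : ℝ → ℂ := fun y => ∑ n ∈ s, (b n * (2 * Real.pi * I * ((n : ℂ) - a))) *
    cexp (2 * Real.pi * I * ((n : ℂ) - a) * y) with hf'
  have hder : ∀ y, HasDerivAt f (f' y) y := by
    intro y
    rw [hf, hf']
    apply HasDerivAt.fun_sum
    intro n _
    have h1 : HasDerivAt (fun y : ℝ => (2 * Real.pi * I * ((n : ℂ) - a)) * (y : ℂ))
        (2 * Real.pi * I * ((n : ℂ) - a)) y := by
      simpa using (hasDerivAt_id (y : ℂ)).comp_ofReal.const_mul (2 * Real.pi * I * ((n : ℂ) - a))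
    exact (h1.cexp.const_mul (b n)).congr_deriv (by ring)
  have hfc : Continuous f := by rw [hf]; fun_prop
  have hf'c : Continuous f' := by rw [hf']; fun_prop
  have hnorm : ∀ y : ℝ, ‖∑ n ∈ s, b n * cexp (2 * Real.pi * I * n * y)‖ = ‖f y‖ := by
    intro y
    have : f y = cexp ((-(2 * Real.pi * a * y) : ℝ) * I) *
        ∑ n ∈ s, b n * cexp (2 * Real.pi * I * n * y) := by
      rw [hf, Finset.mul_sum]
      refine Finset.sum_congr rfl fun n _ => ?_
      rw [mul_left_comm, ← exp_add]
      congr 2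
      push_cast
      ring
    rw [this, norm_mul, norm_exp_ofReal_mul_I, one_mul]
  set h : ℝ → ℝ := fun y => (d⁻¹ + l) * ‖f y‖ ^ 2 + l⁻¹ * ‖f' y‖ ^ 2 with hh
  have hhc : Continuous h := by rw [hh]; fun_prop
  have hh0 : ∀ y, 0 ≤ h y := fun y => by rw [hh]; positivity
  have hdisj : (P : Set ι).Pairwise (Function.onFun Disjoint fun i => Set.Ioc (x i) (x i + d)) := by
    intro i hi j hj hij
    have := hsep i hi j hj hij
    rw [Function.onFun, Set.disjoint_left]
    intro y hy hy'
    simp only [Set.mem_Ioc] at hy hy'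
    rcases le_abs.mp this with h1 | h1 <;> linarith
  have hbound : ∀ (c : ℕ → ℂ), ∫ y in (0 : ℝ)..2,
      ‖∑ n ∈ s, c n * cexp (2 * Real.pi * I * ((n : ℂ) - a) * y)‖ ^ 2 = 2 * ∑ n ∈ s, ‖c n‖ ^ 2 :=
    fun c => integral_norm_sq_sum_exp s c a
  calc ∑ i ∈ P, ‖∑ n ∈ s, b n * cexp (2 * Real.pi * I * n * x i)‖ ^ 2
      ≤ ∑ i ∈ P, ∫ y in Set.Ioc (x i) (x i + d), h y := by
        refine Finset.sum_le_sum fun i _ => ?_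
        rw [hnorm]
        exact norm_sq_le_integral_Ioc hder hf'c hd hl (x i)
    _ = ∫ y in ⋃ i ∈ P, Set.Ioc (x i) (x i + d), h y := by
        rw [integral_biUnion_finset P (fun i _ => measurableSet_Ioc) hdisj]
        exact fun i _ => (hhc.integrableOn_Icc).mono_set Set.Ioc_subset_Icc_self
    _ ≤ ∫ y in Set.Ioc (0 : ℝ) 2, h y := by
        apply setIntegral_mono_set
        · exact (hhc.integrableOn_Icc).mono_set Set.Ioc_subset_Icc_self
        · exact Filter.Eventually.of_forall hh0
        · apply LE.le.eventuallyLE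
          intro y hy
          simp only [Set.mem_iUnion, Set.mem_Ioc] at hy ⊢
          obtain ⟨i, hi, h1, h2⟩ := hy
          have := hx i hi
          constructor <;> linarith
    _ = (d⁻¹ + l) * (∫ y in (0 : ℝ)..2, ‖f y‖ ^ 2) + l⁻¹ * ∫ y in (0 : ℝ)..2, ‖f' y‖ ^ 2 := by
        rw [← intervalIntegral.integral_of_le (by norm_num),
          ← intervalIntegral.integral_const_mul, ← intervalIntegral.integral_const_mul,
          ← intervalIntegral.integral_add ((by fun_prop : Continuous _).intervalIntegrable _ _)
          ((by fun_prop : Continuous _).intervalIntegrable _ _)]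
    _ = _ := by
        rw [hf, hf', hbound, hbound]
        have : ∀ n : ℕ, ‖b n * (2 * Real.pi * I * ((n : ℂ) - a))‖ ^ 2 =
            (2 * Real.pi) ^ 2 * ((n : ℝ) - a) ^ 2 * ‖b n‖ ^ 2 := by
          intro n
          have h1 : ((n : ℂ) - a) = (((n : ℝ) - a : ℝ) : ℂ) := by push_cast; rfl
          rw [h1, norm_mul, norm_mul, norm_mul, norm_mul, norm_I, norm_real, norm_real,
            mul_pow, mul_pow, mul_pow, mul_pow, Real.norm_eq_abs, Real.norm_eq_abs, sq_abs, sq_abs]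
          simp
          ring
        simp_rw [this]
        ring

lemma farey_separated {q q' a a' Q : ℕ} (hq : 0 < q) (hq' : 0 < q') (hqQ : q ≤ Q) (hqQ' : q' ≤ Q)
    (h : a * q' ≠ a' * q) :
    ((Q : ℝ) ^ 2)⁻¹ ≤ |(a : ℝ) / q - (a' : ℝ) / q'| := by
  have hq0 : (0 : ℝ) < q := by exact_mod_cast hq
  have hq0' : (0 : ℝ) < q' := by exact_mod_cast hq'
  rw [div_sub_div _ _ hq0.ne' hq0'.ne', abs_div, abs_of_pos (mul_pos hq0 hq0')]
  have h1 : (1 : ℝ) ≤ |(a : ℝ) * q' - q * a'| := by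
    have : (1 : ℤ) ≤ |(a : ℤ) * q' - q * a'| := by
      apply Int.one_le_abs
      intro h2
      apply h
      zify
      linarith
    exact_mod_cast this
  have h2 : (q : ℝ) * q' ≤ (Q : ℝ) ^ 2 := by
    rw [sq]; gcongr
  rw [inv_eq_one_div]
  gcongr

lemma farey_large_sieve {Q : ℕ} (hQ : 1 ≤ Q) (s : Finset ℕ) (b : ℕ → ℂ) (a : ℝ) {l : ℝ}
    (hl : 0 < l) :
    ∑ i ∈ Finset.range Q, ∑ u : (ZMod (i + 1))ˣ,
      ‖∑ n ∈ s, b n * ZMod.stdAddChar ((u : ZMod (i + 1)) * (n : ZMod (i + 1)))‖ ^ 2 ≤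
      2 * (((Q : ℝ) ^ 2 + l) * ∑ n ∈ s, ‖b n‖ ^ 2 +
        l⁻¹ * ∑ n ∈ s, (2 * Real.pi) ^ 2 * ((n : ℝ) - a) ^ 2 * ‖b n‖ ^ 2) := by
  have hQ' : (1 : ℝ) ≤ Q := by exact_mod_cast hQ
  have hd : (0 : ℝ) < ((Q : ℝ) ^ 2)⁻¹ := by positivity
  have hd1 : ((Q : ℝ) ^ 2)⁻¹ ≤ 1 := inv_le_one_of_one_le₀ (one_le_pow₀ hQ')
  have key := additive_large_sieve
    ((Finset.range Q).sigma (fun i => (Finset.univ : Finset (ZMod (i + 1))ˣ)))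
    (fun p => ((p.2 : ZMod (p.1 + 1)).val : ℝ) / ((p.1 + 1 : ℕ) : ℝ)) hd hd1 ?_ ?_ s b a hl
  · rw [inv_inv, Finset.sum_sigma] at key
    refine le_trans (le_of_eq ?_) key
    refine Finset.sum_congr rfl fun i _ => Finset.sum_congr rfl fun u _ => ?_
    congr 3
    ext n
    congr 1
    have h1 : (u : ZMod (i + 1)) * (n : ZMod (i + 1)) =
        (((u : ZMod (i + 1)).val * n : ℤ) : ZMod (i + 1)) := by
      push_cast
      rw [ZMod.natCast_zmod_val]
    rw [h1, ZMod.stdAddChar_coe]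
    congr 1
    push_cast
    ring
  · rintro ⟨i, u⟩ _
    simp only
    refine ⟨by positivity, div_le_one_of_le₀ ?_ (by positivity)⟩
    exact_mod_cast (ZMod.val_lt (u : ZMod (i + 1))).le
  · rintro ⟨i, u⟩ hi ⟨j, v⟩ hj hij
    simp only [Finset.mem_sigma, Finset.mem_range, Finset.mem_univ, and_true] at hi hj
    apply farey_separated (by omega) (by omega) (by dsimp only; omega) (by dsimp only; omega)
    intro h
    apply hij
    have cu := ZMod.val_coe_unit_coprime u
    have cv := ZMod.val_coe_unit_coprime v
    have h1 : i + 1 ∣ j + 1 := by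
      apply cu.symm.dvd_of_dvd_mul_left
      rw [h]; exact dvd_mul_left _ _
    have h2 : j + 1 ∣ i + 1 := by
      apply cv.symm.dvd_of_dvd_mul_left
      rw [← h]; exact dvd_mul_left _ _
    have h3 : i = j := by have := Nat.dvd_antisymm h1 h2; omega
    subst h3
    congr
    have h4 := Nat.eq_of_mul_eq_mul_right (by omega) h
    exact Units.ext (ZMod.val_injective _ h4)

lemma sum_zmod_eq_sum_units {N : ℕ} [NeZero N] {f : ZMod N → ℂ}
    (hf : ∀ x, ¬ IsUnit x → f x = 0) : ∑ x, f x = ∑ u : (ZMod N)ˣ, f u := by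
  symm
  refine Finset.sum_bij_ne_zero (fun u _ _ => (u : ZMod N)) (fun _ _ _ => Finset.mem_univ _)
    (fun u _ _ v _ _ h => Units.ext h) (fun x _ hx => ?_) (fun _ _ _ => rfl)
  by_cases h : IsUnit x
  · exact ⟨h.unit, Finset.mem_univ _, hx, rfl⟩
  · exact absurd (hf x h) hx

lemma sum_norm_sq_dirichletCharacter {N : ℕ} [NeZero N] (χ : DirichletCharacter ℂ N) :
    ∑ x, ‖χ x‖ ^ 2 = (N.totient : ℝ) := by
  apply Complex.ofReal_injective
  rw [Complex.ofReal_sum, sum_zmod_eq_sum_units]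
  · simp [ZMod.card_units_eq_totient]
  · intro x hx
    simp [MulChar.map_nonunit _ hx]

lemma zmod_parseval {N : ℕ} [NeZero N] (c : ZMod N → ℂ) :
    ∑ a : ZMod N, ‖∑ x, c x * ZMod.stdAddChar (a * x)‖ ^ 2 = N * ∑ x, ‖c x‖ ^ 2 := by
  apply Complex.ofReal_injective
  rw [Complex.ofReal_sum]
  simp_rw [ofReal_norm_sq_sum]
  rw [Finset.sum_comm]
  have key : ∀ x y : ZMod N, ∑ a : ZMod N, c x * ZMod.stdAddChar (a * x) *
      (starRingEnd ℂ) (c y * ZMod.stdAddChar (a * y)) =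
      if x = y then (N : ℂ) * ((‖c x‖ ^ 2 : ℝ) : ℂ) else 0 := by
    intro x y
    have : ∀ a : ZMod N, c x * ZMod.stdAddChar (a * x) *
      (starRingEnd ℂ) (c y * ZMod.stdAddChar (a * y)) =
      c x * (starRingEnd ℂ) (c y) * ZMod.stdAddChar (a * (x - y)) := by
      intro a
      rw [map_mul (starRingEnd ℂ), ← AddChar.map_neg_eq_conj, mul_mul_mul_comm, ← AddChar.map_add_eq_mul]
      congr 2
      ring
    simp_rw [this]
    rw [← Finset.mul_sum, AddChar.sum_mulShift _ (ZMod.isPrimitive_stdAddChar N)]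
    simp_rw [sub_eq_zero]
    split_ifs with h
    · subst h
      rw [Complex.mul_conj', ZMod.card]
      push_cast
      ring
    · simp
  rw [Finset.sum_congr rfl fun x _ => by rw [Finset.sum_comm, Finset.sum_congr rfl fun y _ => key x y]]
  simp [Finset.mul_sum]

lemma norm_gaussSum_sq {N : ℕ} [NeZero N] {χ : DirichletCharacter ℂ N} (hχ : χ.IsPrimitive) :
    ‖gaussSum χ ZMod.stdAddChar‖ ^ 2 = (N : ℝ) := by
  have h1 := zmod_parseval (N := N) χ
  have h2 : ∀ a : ZMod N, ∑ x, χ x * ZMod.stdAddChar (a * x) =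
      χ⁻¹ a * gaussSum χ ZMod.stdAddChar := by
    intro a
    rw [← gaussSum_mulShift_of_isPrimitive _ hχ, gaussSum]
    simp [AddChar.mulShift_apply]
  simp_rw [h2, norm_mul, mul_pow] at h1
  rw [← Finset.sum_mul, sum_norm_sq_dirichletCharacter, sum_norm_sq_dirichletCharacter,
    mul_comm (N : ℝ)] at h1
  have h3 : (N.totient : ℝ) ≠ 0 := by
    exact_mod_cast (Nat.totient_pos.mpr (NeZero.pos N)).ne'
  exact mul_left_cancel₀ h3 h1

lemma sum_norm_sq_character_sum {N : ℕ} [NeZero N] (S : ZMod N → ℂ) :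
    ∑ χ : DirichletCharacter ℂ N, ‖∑ x, χ⁻¹ x * S x‖ ^ 2 =
      N.totient * ∑ u : (ZMod N)ˣ, ‖S u‖ ^ 2 := by
  apply Complex.ofReal_injective
  rw [Complex.ofReal_sum]
  have h0 : ∀ χ : DirichletCharacter ℂ N, ∑ x, χ⁻¹ x * S x =
      ∑ u : (ZMod N)ˣ, χ⁻¹ (u : ZMod N) * S u := by
    intro χ
    exact sum_zmod_eq_sum_units fun x hx => by simp [MulChar.map_nonunit _ hx]
  simp_rw [h0, ofReal_norm_sq_sum]
  rw [Finset.sum_comm]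
  have key : ∀ u v : (ZMod N)ˣ, ∑ χ : DirichletCharacter ℂ N, χ⁻¹ (u : ZMod N) * S u *
      (starRingEnd ℂ) (χ⁻¹ (v : ZMod N) * S v) =
      if u = v then (N.totient : ℂ) * ((‖S u‖ ^ 2 : ℝ) : ℂ) else 0 := by
    intro u v
    have : ∀ χ : DirichletCharacter ℂ N, χ⁻¹ (u : ZMod N) * S u *
      (starRingEnd ℂ) (χ⁻¹ (v : ZMod N) * S v) =
      S u * (starRingEnd ℂ) (S v) * (χ (u : ZMod N)⁻¹ * χ (v : ZMod N)) := by
      intro χ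
      have h1 : χ⁻¹ (u : ZMod N) = χ (u : ZMod N)⁻¹ := by
        rw [MulChar.inv_apply, Ring.inverse_unit, ZMod.inv_coe_unit]
      have h2 : (starRingEnd ℂ) (χ⁻¹ (v : ZMod N)) = χ (v : ZMod N) := by
        have := MulChar.star_apply' χ⁻¹ (v : ZMod N)
        rwa [inv_inv] at this
      rw [map_mul, h1, h2]
      ring
    simp_rw [this]
    rw [← Finset.mul_sum, DirichletCharacter.sum_char_inv_mul_char_eq ℂ u.isUnit]
    by_cases h : u = v
    · subst h
      rw [if_pos rfl, if_pos rfl, Complex.mul_conj']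
      push_cast
      ring
    · rw [if_neg h, if_neg fun h' => h (Units.ext h'), mul_zero]
  rw [Finset.sum_congr rfl fun u _ => by
    rw [Finset.sum_comm, Finset.sum_congr rfl fun v _ => key u v]]
  simp [Finset.mul_sum]

lemma sum_primitive_norm_sq_le {N : ℕ} [NeZero N] (s : Finset ℕ) (b : ℕ → ℂ) :
    ∑ χ : DirichletCharacter ℂ N, (if χ.IsPrimitive then ‖∑ n ∈ s, b n * χ n‖ ^ 2 else 0) ≤
      ∑ u : (ZMod N)ˣ,
        ‖∑ n ∈ s, b n * ZMod.stdAddChar ((u : ZMod N) * (n : ZMod N))‖ ^ 2 := by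
  set S : ZMod N → ℂ := fun x => ∑ n ∈ s, b n * ZMod.stdAddChar (x * (n : ZMod N)) with hS
  have hN : (0 : ℝ) < N := by exact_mod_cast NeZero.pos N
  have h1 : ∀ χ : DirichletCharacter ℂ N, χ.IsPrimitive →
      N * ‖∑ n ∈ s, b n * χ n‖ ^ 2 = ‖∑ x, χ⁻¹ x * S x‖ ^ 2 := by
    intro χ hχ
    have hχ' : χ⁻¹.IsPrimitive := by
      rw [DirichletCharacter.isPrimitive_def, DirichletCharacter.conductor_inv]; exact hχ
    have h2 : ∑ x, χ⁻¹ x * S x = gaussSum χ⁻¹ ZMod.stdAddChar * ∑ n ∈ s, b n * χ n := by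
      rw [hS]
      simp_rw [Finset.mul_sum]
      rw [Finset.sum_comm]
      refine Finset.sum_congr rfl fun n _ => ?_
      have := gaussSum_mulShift_of_isPrimitive
        (ZMod.stdAddChar (N := N)) hχ' (n : ZMod N)
      rw [inv_inv, gaussSum] at this
      rw [mul_left_comm, mul_comm (gaussSum _ _), ← this, Finset.mul_sum]
      refine Finset.sum_congr rfl fun x _ => ?_
      rw [AddChar.mulShift_apply, mul_comm x]
      ring
    rw [h2, norm_mul, mul_pow, norm_gaussSum_sq hχ']
  have h3 : N * ∑ χ : DirichletCharacter ℂ N,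
      (if χ.IsPrimitive then ‖∑ n ∈ s, b n * χ n‖ ^ 2 else 0) ≤
      N * ∑ u : (ZMod N)ˣ, ‖S u‖ ^ 2 := by
    calc _ = ∑ χ : DirichletCharacter ℂ N,
          (if χ.IsPrimitive then ‖∑ x, χ⁻¹ x * S x‖ ^ 2 else 0) := by
          rw [Finset.mul_sum]
          refine Finset.sum_congr rfl fun χ _ => ?_
          split_ifs with h
          · exact h1 χ h
          · simp
      _ ≤ ∑ χ : DirichletCharacter ℂ N, ‖∑ x, χ⁻¹ x * S x‖ ^ 2 := by
          refine Finset.sum_le_sum fun χ _ => ?_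
          split_ifs
          · exact le_rfl
          · positivity
      _ = N.totient * ∑ u : (ZMod N)ˣ, ‖S u‖ ^ 2 := sum_norm_sq_character_sum S
      _ ≤ _ := by
          gcongr
          exact Nat.totient_le N
  exact le_of_mul_le_mul_left h3 hN

/-- The multiplicative large sieve, with weights centred at `a`. -/
lemma multiplicative_large_sieve {Q : ℕ} (hQ : 1 ≤ Q) (s : Finset ℕ) (b : ℕ → ℂ) (a : ℝ) {l : ℝ}
    (hl : 0 < l) :
    ∑ i ∈ Finset.range Q, ∑ χ : DirichletCharacter ℂ (i + 1),
      (if χ.IsPrimitive then ‖∑ n ∈ s, b n * χ n‖ ^ 2 else 0) ≤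
      2 * (((Q : ℝ) ^ 2 + l) * ∑ n ∈ s, ‖b n‖ ^ 2 +
        l⁻¹ * ∑ n ∈ s, (2 * Real.pi) ^ 2 * ((n : ℝ) - a) ^ 2 * ‖b n‖ ^ 2) :=
  (Finset.sum_le_sum fun _ _ => sum_primitive_norm_sq_le s b).trans
    (farey_large_sieve hQ s b a hl)

lemma integrable_cexp_neg_real_mul_sq {a : ℝ} (ha : 0 < a) (c d : ℂ) :
    Integrable fun x : ℝ => cexp (-(a : ℂ) * x ^ 2 + c * x + d) :=
  integrable_cexp_quadratic (by simpa using ha) c d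

lemma integral_cexp_neg_real_mul_sq {a : ℝ} (ha : 0 < a) (c d : ℂ) :
    ∫ x : ℝ, cexp (-(a : ℂ) * x ^ 2 + c * x + d) =
      ((√(Real.pi / a) : ℝ) : ℂ) * cexp (d + c ^ 2 / (4 * a)) := by
  rw [integral_cexp_quadratic (by simpa using ha)]
  congr 1
  · rw [neg_neg, Real.sqrt_eq_rpow, Complex.ofReal_cpow (by positivity)]
    push_cast
    rfl
  · congr 1
    rw [mul_neg, div_neg, sub_neg_eq_add]

lemma integrable_exp_neg_mul_sq_add {a : ℝ} (ha : 0 < a) (c d : ℝ) :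
    Integrable fun x : ℝ => Real.exp (-a * x ^ 2 + c * x + d) := by
  have := (integrable_cexp_neg_real_mul_sq ha c d).norm
  refine this.congr (Filter.Eventually.of_forall fun x => ?_)
  simp only [Complex.norm_exp]
  congr 1
  rw [← Complex.ofReal_re (-a * x ^ 2 + c * x + d)]
  push_cast
  rfl

lemma integral_exp_neg_mul_sq_add {a : ℝ} (ha : 0 < a) (c d : ℝ) :
    ∫ x : ℝ, Real.exp (-a * x ^ 2 + c * x + d) =
      √(Real.pi / a) * Real.exp (d + c ^ 2 / (4 * a)) := by
  apply Complex.ofReal_injective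
  rw [← integral_complex_ofReal]
  have := integral_cexp_neg_real_mul_sq ha c d
  push_cast
  exact this

/-- Plancherel for exponential sums with Gaussian weight. -/
lemma integral_gaussian_norm_sq_sum (s : Finset ℕ) (b : ℕ → ℂ) (f : ℕ → ℝ) {T : ℝ} (hT : 0 < T) :
    ∫ t : ℝ, Real.exp (-(T ^ 2)⁻¹ * t ^ 2) * ‖∑ n ∈ s, b n * cexp (-(f n * t * I))‖ ^ 2 =
      T ^ 2 * ∫ y : ℝ, ‖∑ n ∈ s, b n * (Real.exp (-(T ^ 2 / 2) * (y - f n) ^ 2) : ℝ)‖ ^ 2 := by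
  have hT2 : 0 < T ^ 2 := by positivity
  have hTi : 0 < (T ^ 2)⁻¹ := by positivity
  apply Complex.ofReal_injective
  rw [Complex.ofReal_mul, ← integral_complex_ofReal, ← integral_complex_ofReal]
  simp_rw [Complex.ofReal_mul, ofReal_norm_sq_sum, Finset.mul_sum]
  have e1 : ∀ (n m : ℕ) (t : ℝ), (Real.exp (-(T ^ 2)⁻¹ * t ^ 2) : ℂ) *
      (b n * cexp (-(f n * t * I)) * (starRingEnd ℂ) (b m * cexp (-(f m * t * I)))) =
      b n * (starRingEnd ℂ) (b m) *
        cexp (-(((T ^ 2)⁻¹ : ℝ) : ℂ) * t ^ 2 + ((f m - f n) * I) * t + 0) := by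
    intro n m t
    have h1 : -(((T ^ 2)⁻¹ : ℝ) : ℂ) * t ^ 2 + ((f m - f n) * I) * t + 0 =
        ((-(T ^ 2)⁻¹ * t ^ 2 : ℝ) : ℂ) + (-(f n * t * I)) + f m * t * I := by
      push_cast; ring
    rw [h1, exp_add, exp_add, ofReal_exp, map_mul, ← exp_conj]
    simp only [map_neg, map_mul, conj_ofReal, conj_I, mul_neg, neg_neg]
    ring
  have e2 : ∀ (n m : ℕ) (y : ℝ), b n * (Real.exp (-(T ^ 2 / 2) * (y - f n) ^ 2) : ℂ) *
      (starRingEnd ℂ) (b m * (Real.exp (-(T ^ 2 / 2) * (y - f m) ^ 2) : ℂ)) =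
      b n * (starRingEnd ℂ) (b m) *
        cexp (-((T ^ 2 : ℝ) : ℂ) * y ^ 2 + (T ^ 2 * (f n + f m)) * y +
          (-(T ^ 2 / 2) * (f n ^ 2 + f m ^ 2))) := by
    intro n m y
    have h1 : -((T ^ 2 : ℝ) : ℂ) * y ^ 2 + (T ^ 2 * (f n + f m)) * y +
          (-(T ^ 2 / 2) * (f n ^ 2 + f m ^ 2)) =
        ((-(T ^ 2 / 2) * (y - f n) ^ 2 : ℝ) : ℂ) + ((-(T ^ 2 / 2) * (y - f m) ^ 2 : ℝ) : ℂ) := by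
      push_cast; ring
    rw [h1, exp_add, map_mul, conj_ofReal, ofReal_exp, ofReal_exp]
    ring
  simp_rw [e1, e2]
  rw [integral_finsetSum, integral_finsetSum, Finset.mul_sum]
  · refine Finset.sum_congr rfl fun n _ => ?_
    rw [integral_finsetSum, integral_finsetSum, Finset.mul_sum]
    · refine Finset.sum_congr rfl fun m _ => ?_
      rw [integral_const_mul, integral_const_mul, integral_cexp_neg_real_mul_sq hTi,
        integral_cexp_neg_real_mul_sq hT2]
      have h1 : √(Real.pi / (T ^ 2)⁻¹) = T ^ 2 * √(Real.pi / T ^ 2) := by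
        rw [div_inv_eq_mul, Real.sqrt_mul Real.pi_pos.le, Real.sqrt_div Real.pi_pos.le,
          Real.sqrt_sq hT.le]
        field_simp
      have hTc : (T : ℂ) ≠ 0 := by exact_mod_cast hT.ne'
      have h2 : (0 : ℂ) + ((f m - f n) * I) ^ 2 / (4 * (((T ^ 2)⁻¹ : ℝ) : ℂ)) =
          (-(T ^ 2 / 2) * (f n ^ 2 + f m ^ 2)) +
            (T ^ 2 * (f n + f m)) ^ 2 / (4 * ((T ^ 2 : ℝ) : ℂ)) := by
        rw [mul_pow, I_sq]
        push_cast
        field_simp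
        ring
      rw [h1, h2]
      push_cast
      ring
    all_goals
      intro m _
      apply Integrable.const_mul
      apply integrable_cexp_neg_real_mul_sq
      assumption
  all_goals
    intro n _
    apply integrable_finsetSum
    intro m _
    apply Integrable.const_mul
    apply integrable_cexp_neg_real_mul_sq
    assumption

lemma integrable_norm_sq_sum_gaussian (s : Finset ℕ) (b : ℕ → ℂ) (f : ℕ → ℝ) {T : ℝ}
    (hT : 0 < T) :
    Integrable fun y : ℝ =>
      ‖∑ n ∈ s, b n * (Real.exp (-(T ^ 2 / 2) * (y - f n) ^ 2) : ℝ)‖ ^ 2 := by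
  have hT2 : 0 < T ^ 2 := by positivity
  refine Integrable.mono' (g := fun y => (s.card : ℝ) * ∑ n ∈ s, ‖b n‖ ^ 2 *
    Real.exp (-(T ^ 2) * y ^ 2 + 2 * T ^ 2 * f n * y + -(T ^ 2) * f n ^ 2)) ?_ ?_ ?_
  · apply Integrable.const_mul
    apply integrable_finsetSum
    intro n _
    apply Integrable.const_mul
    exact integrable_exp_neg_mul_sq_add hT2 _ _
  · apply Continuous.aestronglyMeasurable
    fun_prop
  · refine Filter.Eventually.of_forall fun y => ?_
    rw [Real.norm_of_nonneg (by positivity)]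
    calc _ ≤ (∑ n ∈ s, ‖b n * (Real.exp (-(T ^ 2 / 2) * (y - f n) ^ 2) : ℝ)‖) ^ 2 := by
          gcongr
          exact norm_sum_le _ _
      _ ≤ (s.card : ℝ) * ∑ n ∈ s, ‖b n * (Real.exp (-(T ^ 2 / 2) * (y - f n) ^ 2) : ℝ)‖ ^ 2 :=
          sq_sum_le_card_mul_sum_sq
      _ = _ := by
          congr 1
          refine Finset.sum_congr rfl fun n _ => ?_
          rw [norm_mul, Complex.norm_of_nonneg (Real.exp_pos _).le, mul_pow, ← Real.exp_nat_mul]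
          congr 2
          push_cast
          ring

/-- The total Gaussian weight occurring in the hybrid large sieve. -/
lemma integral_hybrid_weight_le {Q : ℝ} {n N : ℕ} (hn : 1 ≤ n) (hnN : n ≤ N)
    {T : ℝ} (hT : 1 ≤ T) :
    ∃ w : ℝ → ℝ, Integrable w ∧
      (∀ y, w y = Real.exp (-(T ^ 2) * (y - Real.log n) ^ 2) *
        (2 * ((Q ^ 2 + Real.exp y / T) + (Real.exp y / T)⁻¹ *
          ((2 * Real.pi) ^ 2 * ((n : ℝ) - Real.exp y) ^ 2)))) ∧
      T ^ 2 * ∫ y, w y ≤ 200 * (Q ^ 2 * T + N) := by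
  have hT0 : 0 < T := by linarith
  have hT2 : 0 < T ^ 2 := by positivity
  have hn0 : (0 : ℝ) < n := by exact_mod_cast hn
  set lam := Real.log n with hlam
  have hexp : Real.exp lam = n := Real.exp_log hn0
  let G : ℝ → ℝ → ℝ := fun c y => Real.exp (-(T ^ 2) * y ^ 2 + (2 * T ^ 2 * lam + c) * y +
    -(T ^ 2) * lam ^ 2)
  have hGi : ∀ c, Integrable (G c) := fun c => integrable_exp_neg_mul_sq_add hT2 _ _
  have hG : ∀ c, ∫ y, G c y = (√Real.pi / T) * Real.exp (c * lam + c ^ 2 / (4 * T ^ 2)) := by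
    intro c
    rw [integral_exp_neg_mul_sq_add hT2, Real.sqrt_div Real.pi_pos.le, Real.sqrt_sq hT0.le]
    congr 2
    field_simp
    ring
  have hG' : ∀ c y, G c y = Real.exp (-(T ^ 2) * (y - lam) ^ 2) * Real.exp (c * y) := by
    intro c y
    rw [← Real.exp_add]
    simp only [G]
    congr 1
    ring
  set P := (2 * Real.pi) ^ 2 with hP
  refine ⟨fun y => 2 * (Q ^ 2 - 2 * P * T * n) * G 0 y + (2 * (T⁻¹ + P * T)) * G 1 y +
    (2 * P * T * n ^ 2) * G (-1) y, ?_, ?_, ?_⟩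
  · exact (((hGi 0).const_mul _).add ((hGi 1).const_mul _)).add ((hGi (-1)).const_mul _)
  · intro y
    simp only [hG']
    have h1 : Real.exp (-1 * y) = (Real.exp y)⁻¹ := by rw [neg_one_mul, Real.exp_neg]
    rw [h1, zero_mul, Real.exp_zero, one_mul]
    have h2 := Real.exp_pos y
    field_simp
    ring
  · have hsum : ∀ A B C : ℝ, ∫ y, (A * G 0 y + B * G 1 y + C * G (-1) y) =
        A * (∫ y, G 0 y) + B * (∫ y, G 1 y) + C * ∫ y, G (-1) y := by
      intro A B C
      have h0 := (hGi 0).const_mul A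
      have h1 := (hGi 1).const_mul B
      rw [integral_add (f := fun y => A * G 0 y + B * G 1 y) (h0.add h1) ((hGi (-1)).const_mul C),
        integral_add h0 h1, integral_const_mul, integral_const_mul, integral_const_mul]
    simp only [hsum, hG]
    set E := Real.exp (1 / (4 * T ^ 2)) with hE
    have hx : 1 / (4 * T ^ 2) ≤ 1 / 4 := by
      have : 1 ≤ T ^ 2 := by nlinarith
      apply one_div_le_one_div_of_le <;> linarith
    have hx0 : 0 < 1 / (4 * T ^ 2) := by positivity
    have hE1 : E - 1 ≤ 2 * (1 / (4 * T ^ 2)) := by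
      have := Real.abs_exp_sub_one_le (x := 1 / (4 * T ^ 2)) (by rw [abs_of_pos hx0]; linarith)
      rw [abs_of_pos hx0] at this
      exact (le_abs_self _).trans this
    have e1 : Real.exp (1 * lam + 1 ^ 2 / (4 * T ^ 2)) = n * E := by
      rw [Real.exp_add, one_mul, hexp, one_pow]
    have e2 : Real.exp (-1 * lam + (-1) ^ 2 / (4 * T ^ 2)) = (n : ℝ)⁻¹ * E := by
      rw [Real.exp_add, neg_one_mul, Real.exp_neg, hexp, neg_one_sq]
    have e3 : Real.exp (0 * lam + 0 ^ 2 / (4 * T ^ 2)) = 1 := by simp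
    rw [e1, e2, e3]
    have e4 : T ^ 2 * (2 * (Q ^ 2 - 2 * P * T * ↑n) * (√Real.pi / T * 1) +
        2 * (T⁻¹ + P * T) * (√Real.pi / T * (↑n * E)) +
        2 * P * T * ↑n ^ 2 * (√Real.pi / T * ((↑n)⁻¹ * E))) =
        √Real.pi * (2 * (Q ^ 2 * T) + 2 * n * E + 4 * P * n * (T ^ 2 * (E - 1))) := by
      field_simp
      ring
    rw [e4]
    have h1 : T ^ 2 * (E - 1) ≤ 1 / 2 := by
      calc T ^ 2 * (E - 1) ≤ T ^ 2 * (2 * (1 / (4 * T ^ 2))) := by gcongr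
        _ = 1 / 2 := by field_simp; norm_num
    have h2 : E ≤ 2 := by linarith
    have h3 : √Real.pi ≤ 2 := by
      rw [Real.sqrt_le_left (by norm_num)]
      linarith [Real.pi_le_four]
    have h4 : P ≤ 45 := by
      have : Real.pi ^ 2 ≤ 3.15 ^ 2 := by
        have := Real.pi_lt_d2
        have := Real.pi_pos
        gcongr
      rw [hP]; nlinarith
    have h5 : (n : ℝ) ≤ N := by exact_mod_cast hnN
    have h6 : 0 ≤ P := by positivity
    have h7 : 0 ≤ T ^ 2 * (E - 1) :=
      mul_nonneg hT2.le (sub_nonneg.mpr (Real.one_le_exp hx0.le))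
    have h8 : 0 ≤ 2 * (Q ^ 2 * T) + 2 * n * E + 4 * P * n * (T ^ 2 * (E - 1)) := by positivity
    calc _ ≤ 2 * (2 * (Q ^ 2 * T) + 2 * n * 2 + 4 * 45 * n * (1 / 2)) := by gcongr
      _ ≤ 200 * (Q ^ 2 * T + n) := by nlinarith [mul_nonneg (sq_nonneg Q) hT0.le]
      _ ≤ _ := by gcongr

/-- The hybrid large sieve. -/
lemma hybrid_large_sieve {Q : ℕ} (hQ : 1 ≤ Q) (N : ℕ) (b : ℕ → ℂ) {T : ℝ} (hT : 1 ≤ T) :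
    ∑ i ∈ Finset.range Q, ∑ χ : DirichletCharacter ℂ (i + 1),
      (if χ.IsPrimitive then ∫ t : ℝ, Real.exp (-(T ^ 2)⁻¹ * t ^ 2) *
        ‖∑ n ∈ Finset.Icc 1 N, b n * χ n * cexp (-(Real.log n * t * I))‖ ^ 2 else 0) ≤
      200 * ((Q : ℝ) ^ 2 * T + N) * ∑ n ∈ Finset.Icc 1 N, ‖b n‖ ^ 2 := by
  have hT0 : 0 < T := by linarith
  have hw : ∀ n ∈ Finset.Icc 1 N, ∃ w : ℝ → ℝ, Integrable w ∧
      (∀ y, w y = Real.exp (-(T ^ 2) * (y - Real.log n) ^ 2) *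
        (2 * (((Q : ℝ) ^ 2 + Real.exp y / T) + (Real.exp y / T)⁻¹ *
          ((2 * Real.pi) ^ 2 * ((n : ℝ) - Real.exp y) ^ 2)))) ∧
      T ^ 2 * ∫ y, w y ≤ 200 * ((Q : ℝ) ^ 2 * T + N) := fun n hn =>
    integral_hybrid_weight_le (Finset.mem_Icc.mp hn).1 (Finset.mem_Icc.mp hn).2 hT
  choose! w hwi hwy hwT using hw
  let F : (i : ℕ) → DirichletCharacter ℂ (i + 1) → ℝ → ℝ := fun i χ y =>
    if χ.IsPrimitive then ‖∑ n ∈ Finset.Icc 1 N, b n * χ n *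
      (Real.exp (-(T ^ 2 / 2) * (y - Real.log n) ^ 2) : ℝ)‖ ^ 2 else 0
  have hF : ∀ (i : ℕ) (χ : DirichletCharacter ℂ (i + 1)), Integrable (F i χ) := by
    intro i χ
    by_cases h : χ.IsPrimitive
    · simp only [F, if_pos h]
      exact integrable_norm_sq_sum_gaussian _ _ _ hT0
    · simp [F, if_neg h]
  have h1 : ∀ (i : ℕ) (χ : DirichletCharacter ℂ (i + 1)),
      (if χ.IsPrimitive then ∫ t : ℝ, Real.exp (-(T ^ 2)⁻¹ * t ^ 2) *
        ‖∑ n ∈ Finset.Icc 1 N, b n * χ n * cexp (-(Real.log n * t * I))‖ ^ 2 else 0) =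
      T ^ 2 * ∫ y, F i χ y := by
    intro i χ
    by_cases h : χ.IsPrimitive
    · simp only [F, if_pos h]
      exact integral_gaussian_norm_sq_sum (Finset.Icc 1 N) (fun n => b n * χ n)
        (fun n => Real.log n) hT0
    · simp [F, if_neg h]
  simp_rw [h1, ← Finset.mul_sum]
  rw [Finset.sum_congr rfl fun i _ => (integral_finsetSum _ fun χ _ => hF i χ).symm,
    ← integral_finsetSum _ fun i _ => integrable_finsetSum _ fun χ _ => hF i χ]
  have h2 : ∀ y, ∑ i ∈ Finset.range Q, ∑ χ : DirichletCharacter ℂ (i + 1), F i χ y ≤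
      ∑ n ∈ Finset.Icc 1 N, ‖b n‖ ^ 2 * w n y := by
    intro y
    have := multiplicative_large_sieve hQ (Finset.Icc 1 N)
      (fun n => b n * (Real.exp (-(T ^ 2 / 2) * (y - Real.log n) ^ 2) : ℝ)) (Real.exp y)
      (l := Real.exp y / T) (by positivity)
    calc _ = ∑ i ∈ Finset.range Q, ∑ χ : DirichletCharacter ℂ (i + 1),
          (if χ.IsPrimitive then ‖∑ n ∈ Finset.Icc 1 N, (b n *
            (Real.exp (-(T ^ 2 / 2) * (y - Real.log n) ^ 2) : ℝ)) * χ n‖ ^ 2 else 0) := by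
          simp only [F, mul_right_comm]
      _ ≤ _ := this
      _ = _ := by
          rw [Finset.mul_sum, Finset.mul_sum, ← Finset.sum_add_distrib, Finset.mul_sum]
          refine Finset.sum_congr rfl fun n hn => ?_
          have h3 : ‖b n * (Real.exp (-(T ^ 2 / 2) * (y - Real.log n) ^ 2) : ℝ)‖ ^ 2 =
              ‖b n‖ ^ 2 * Real.exp (-(T ^ 2) * (y - Real.log n) ^ 2) := by
            rw [norm_mul, Complex.norm_of_nonneg (Real.exp_pos _).le, mul_pow, ← Real.exp_nat_mul]
            congr 2
            push_cast
            ring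
          rw [hwy n hn, h3]
          ring
  have h3 : ∫ y, ∑ i ∈ Finset.range Q, ∑ χ : DirichletCharacter ℂ (i + 1), F i χ y ≤
      ∑ n ∈ Finset.Icc 1 N, ‖b n‖ ^ 2 * ∫ y, w n y := by
    refine (integral_mono (integrable_finsetSum _ fun i _ =>
      integrable_finsetSum _ fun χ _ => hF i χ) (integrable_finsetSum _ fun n hn =>
        (hwi n hn).const_mul _) h2).trans_eq ?_
    rw [integral_finsetSum _ fun n hn => (hwi n hn).const_mul _]
    simp_rw [integral_const_mul]
  calc _ ≤ T ^ 2 * ∑ n ∈ Finset.Icc 1 N, ‖b n‖ ^ 2 * ∫ y, w n y := by gcongr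
    _ = ∑ n ∈ Finset.Icc 1 N, ‖b n‖ ^ 2 * (T ^ 2 * ∫ y, w n y) := by
        rw [Finset.mul_sum]
        exact Finset.sum_congr rfl fun n _ => by ring
    _ ≤ ∑ n ∈ Finset.Icc 1 N, ‖b n‖ ^ 2 * (200 * ((Q : ℝ) ^ 2 * T + N)) := by
        exact Finset.sum_le_sum fun n hn => mul_le_mul_of_nonneg_left (hwT n hn) (by positivity)
    _ = _ := by rw [← Finset.sum_mul, mul_comm]

/-- The divisor bound. -/
lemma exists_card_divisors_le {ε : ℝ} (hε : 0 < ε) :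
    ∃ C : ℝ, 1 ≤ C ∧ ∀ n : ℕ, n ≠ 0 → (n.divisors.card : ℝ) ≤ C * (n : ℝ) ^ ε := by
  have hl : 0 < Real.log 2 := Real.log_pos one_lt_two
  set K : ℝ := 1 + (ε * Real.log 2)⁻¹ with hK
  have hK1 : 1 ≤ K := by rw [hK]; linarith [inv_pos.mpr (mul_pos hε hl)]
  set P : ℕ := ⌈(2 : ℝ) ^ ε⁻¹⌉₊ with hP
  refine ⟨K ^ P, one_le_pow₀ hK1, fun n hn => ?_⟩
  have hfac : ∀ p ∈ n.primeFactors, ((n.factorization p + 1 : ℕ) : ℝ) ≤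
      (if p < P then K else 1) * ((p : ℝ) ^ n.factorization p) ^ ε := by
    intro p hp
    have hp2 : (2 : ℝ) ≤ p := by exact_mod_cast (Nat.prime_of_mem_primeFactors hp).two_le
    set a := n.factorization p
    have e1 : ((p : ℝ) ^ a) ^ ε = ((p : ℝ) ^ ε) ^ a := by
      rw [← Real.rpow_natCast, ← Real.rpow_natCast, ← Real.rpow_mul (by positivity),
        ← Real.rpow_mul (by positivity), mul_comm]
    split_ifs with h
    · have h1 : 1 + (a : ℝ) * (ε * Real.log 2) ≤ ((p : ℝ) ^ a) ^ ε := by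
        rw [e1]
        calc 1 + (a : ℝ) * (ε * Real.log 2) ≤ Real.exp (a * (ε * Real.log 2)) := by
              linarith [Real.add_one_le_exp (a * (ε * Real.log 2))]
          _ = ((2 : ℝ) ^ ε) ^ a := by
              rw [Real.exp_nat_mul, Real.rpow_def_of_pos two_pos, mul_comm ε]
          _ ≤ _ := by gcongr
      have h2 : (a : ℝ) + 1 ≤ K * (1 + (a : ℝ) * (ε * Real.log 2)) := by
        have h3 : (ε * Real.log 2)⁻¹ * (ε * Real.log 2) = 1 :=
          inv_mul_cancel₀ (mul_pos hε hl).ne'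
        have h4 : 0 < (ε * Real.log 2)⁻¹ := inv_pos.mpr (mul_pos hε hl)
        have h5 : 0 ≤ (a : ℝ) * (ε * Real.log 2) := by positivity
        have h6 : K * (1 + (a : ℝ) * (ε * Real.log 2)) = 1 + (ε * Real.log 2)⁻¹ +
          (a : ℝ) * (ε * Real.log 2) + a * ((ε * Real.log 2)⁻¹ * (ε * Real.log 2)) := by
          rw [hK]; ring
        rw [h6, h3]
        linarith
      push_cast
      exact h2.trans (by gcongr)
    · rw [one_mul, e1]
      have h1 : (2 : ℝ) ≤ (p : ℝ) ^ ε := by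
        have h2 : (2 : ℝ) ^ ε⁻¹ ≤ p := by
          have := Nat.le_of_ceil_le (not_lt.mp h)
          exact this
        calc (2 : ℝ) = ((2 : ℝ) ^ ε⁻¹) ^ ε := by
              rw [← Real.rpow_mul two_pos.le, inv_mul_cancel₀ hε.ne', Real.rpow_one]
          _ ≤ _ := by gcongr
      calc ((a + 1 : ℕ) : ℝ) ≤ ((2 ^ a : ℕ) : ℝ) := by exact_mod_cast Nat.lt_two_pow_self
        _ = (2 : ℝ) ^ a := by push_cast; rfl
        _ ≤ _ := by gcongr
  rw [Nat.card_divisors hn]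
  push_cast
  calc ∏ p ∈ n.primeFactors, ((n.factorization p : ℝ) + 1) ≤
      ∏ p ∈ n.primeFactors, ((if p < P then K else 1) * ((p : ℝ) ^ n.factorization p) ^ ε) := by
        refine Finset.prod_le_prod (fun p _ => by positivity) fun p hp => ?_
        exact_mod_cast hfac p hp
    _ = (∏ p ∈ n.primeFactors, (if p < P then K else 1)) *
        (∏ p ∈ n.primeFactors, (p : ℝ) ^ n.factorization p) ^ ε := by
        rw [Finset.prod_mul_distrib, Real.finsetProd_rpow _ _ fun p _ => by positivity]
    _ = (∏ p ∈ n.primeFactors, (if p < P then K else 1)) * (n : ℝ) ^ ε := by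
        congr 2
        have := Nat.prod_factorization_pow_eq_self hn
        conv_rhs => rw [← this]
        rw [Finsupp.prod, Nat.support_factorization]
        push_cast
        rfl
    _ ≤ K ^ P * (n : ℝ) ^ ε := by
        gcongr
        rw [Finset.prod_ite, Finset.prod_const_one, mul_one, Finset.prod_const]
        apply pow_le_pow_right₀ hK1
        calc _ ≤ (Finset.range P).card := by
              apply Finset.card_le_card
              intro p hp
              simpa using (Finset.mem_filter.mp hp).2
          _ = P := Finset.card_range P

lemma exists_coeff_sum_pow (k Y : ℕ) : ∃ c : ℕ → ℝ,
    (∀ n, 0 ≤ c n ∧ c n ≤ (n.divisors.card : ℝ) ^ k) ∧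
    ∀ f : ℕ → ℂ, f 1 = 1 → (∀ m n, m ≠ 0 → n ≠ 0 → f (m * n) = f m * f n) →
      (∑ n ∈ Finset.Icc 1 Y, f n) ^ k = ∑ n ∈ Finset.Icc 1 (Y ^ k), c n * f n := by
  set P : Finset (Fin k → ℕ) := Fintype.piFinset fun _ => Finset.Icc 1 Y with hP
  have hmem : ∀ p ∈ P, ∀ i, 1 ≤ p i ∧ p i ≤ Y := fun p hp i =>
    Finset.mem_Icc.mp (Fintype.mem_piFinset.mp hp i)
  refine ⟨fun n => ((P.filter fun p => ∏ i, p i = n).card : ℝ), fun n => ⟨by positivity, ?_⟩, ?_⟩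
  · have : (P.filter fun p => ∏ i, p i = n) ⊆ Fintype.piFinset fun _ : Fin k => n.divisors := by
      intro p hp
      obtain ⟨h1, rfl⟩ := Finset.mem_filter.mp hp
      rw [Fintype.mem_piFinset]
      intro i
      rw [Nat.mem_divisors]
      exact ⟨Finset.dvd_prod_of_mem p (Finset.mem_univ i),
        Finset.prod_ne_zero_iff.mpr fun j _ => by have := (hmem p h1 j).1; omega⟩
    have h2 := Finset.card_le_card this
    rw [Fintype.card_piFinset] at h2
    simp only [Finset.prod_const, Finset.card_univ, Fintype.card_fin] at h2
    simp only
    exact_mod_cast h2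
  · intro f hf1 hfm
    have hprod : ∀ (s : Finset (Fin k)) (p : Fin k → ℕ), (∀ i, p i ≠ 0) →
        ∏ i ∈ s, f (p i) = f (∏ i ∈ s, p i) := by
      intro s p hp
      induction s using Finset.induction_on with
      | empty => simp [hf1]
      | insert a s ha ih =>
        rw [Finset.prod_insert ha, Finset.prod_insert ha, ih, hfm _ _ (hp a)
          (Finset.prod_ne_zero_iff.mpr fun j _ => hp j)]
    rw [Finset.sum_pow', ← Finset.sum_fiberwise_of_maps_to (g := fun p : Fin k → ℕ => ∏ i, p i)
      (t := Finset.Icc 1 (Y ^ k))]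
    · refine Finset.sum_congr rfl fun n _ => ?_
      rw [Finset.sum_congr rfl (g := fun _ => f n)]
      · simp [hP]
      · intro p hp
        obtain ⟨h1, rfl⟩ := Finset.mem_filter.mp hp
        exact hprod _ _ fun i => by have := (hmem p h1 i).1; omega
    · intro p hp
      rw [Finset.mem_Icc]
      constructor
      · exact Nat.one_le_iff_ne_zero.mpr
          (Finset.prod_ne_zero_iff.mpr fun j _ => by have := (hmem p hp j).1; omega)
      · calc ∏ i, p i ≤ ∏ _i : Fin k, Y := Finset.prod_le_prod' fun i _ => (hmem p hp i).2
          _ = Y ^ k := by simp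

/-- The Dirichlet polynomial `∑_{n ≤ Y} χ(n) n^{-s}`. -/
noncomputable def dirichletPoly {N : ℕ} (χ : DirichletCharacter ℂ N) (Y : ℕ) (s : ℂ) : ℂ :=
  ∑ n ∈ Finset.Icc 1 Y, χ n * (n : ℂ) ^ (-s)

lemma differentiable_dirichletPoly {N : ℕ} (χ : DirichletCharacter ℂ N) (Y : ℕ) :
    Differentiable ℂ (dirichletPoly χ Y) := by
  unfold dirichletPoly
  refine Differentiable.fun_sum fun n hn => ?_
  have hn0 : (n : ℂ) ≠ 0 := by
    have := (Finset.mem_Icc.mp hn).1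
    exact_mod_cast (by omega : n ≠ 0)
  exact (Differentiable.const_cpow (by fun_prop) (Or.inl hn0)).const_mul _

lemma norm_dirichletPoly_le {N : ℕ} (χ : DirichletCharacter ℂ N) (Y : ℕ) (s : ℂ) :
    ‖dirichletPoly χ Y s‖ ≤ ∑ n ∈ Finset.Icc 1 Y, (n : ℝ) ^ (-s.re) := by
  refine (norm_sum_le _ _).trans (Finset.sum_le_sum fun n hn => ?_)
  have hn0 := (Finset.mem_Icc.mp hn).1
  rw [norm_mul, Complex.norm_natCast_cpow_of_pos hn0, neg_re]
  exact mul_le_of_le_one_left (by positivity) (χ.norm_le_one _)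

lemma natCast_cpow_neg_add_mul_I {n : ℕ} (hn : n ≠ 0) (σ t : ℝ) :
    (n : ℂ) ^ (-(σ + t * I)) = ((n : ℝ) ^ (-σ) : ℝ) * cexp (-(Real.log n * t * I)) := by
  have hn0 : (n : ℂ) ≠ 0 := by exact_mod_cast hn
  rw [Complex.ofReal_cpow (by positivity), neg_add, Complex.cpow_add _ _ hn0]
  push_cast
  congr 1
  rw [Complex.cpow_def_of_ne_zero hn0, ← Complex.natCast_log]
  congr 1
  ring

lemma sum_moment_dirichletPoly_le {Q : ℕ} (hQ : 1 ≤ Q) (k Y : ℕ) (σ : ℝ) {T : ℝ} (hT : 1 ≤ T) :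
    ∑ i ∈ Finset.range Q, ∑ χ : DirichletCharacter ℂ (i + 1),
      (if χ.IsPrimitive then ∫ t : ℝ, Real.exp (-(T ^ 2)⁻¹ * t ^ 2) *
        ‖dirichletPoly χ Y (σ + t * I)‖ ^ (2 * k) else 0) ≤
      200 * ((Q : ℝ) ^ 2 * T + (Y : ℝ) ^ k) * ∑ n ∈ Finset.Icc 1 (Y ^ k),
        (n.divisors.card : ℝ) ^ (2 * k) * (n : ℝ) ^ (-2 * σ) := by
  obtain ⟨c, hc, hcf⟩ := exists_coeff_sum_pow k Y
  have h := hybrid_large_sieve hQ (Y ^ k) (fun n => c n * ((n : ℝ) ^ (-σ) : ℝ)) hT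
  have e : ∀ (i : ℕ) (χ : DirichletCharacter ℂ (i + 1)) (t : ℝ),
      ‖dirichletPoly χ Y (σ + t * I)‖ ^ (2 * k) = ‖∑ n ∈ Finset.Icc 1 (Y ^ k),
        (c n * ((n : ℝ) ^ (-σ) : ℝ) : ℂ) * χ n * cexp (-(Real.log n * t * I))‖ ^ 2 := by
    intro i χ t
    rw [mul_comm 2 k, pow_mul, ← norm_pow, dirichletPoly,
      hcf (fun n => χ n * (n : ℂ) ^ (-(σ + t * I)))]
    · congr 2
      refine Finset.sum_congr rfl fun n hn => ?_
      have hn0 := (Finset.mem_Icc.mp hn).1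
      rw [natCast_cpow_neg_add_mul_I (by omega)]
      ring
    · simp
    · intro m n hm hn
      push_cast
      rw [map_mul, Complex.natCast_mul_natCast_cpow]
      ring
  simp_rw [e]
  refine h.trans ?_
  push_cast
  gcongr with n hn
  have hn0 : 0 < n := (Finset.mem_Icc.mp hn).1
  have hn1 : (0 : ℝ) < n := by exact_mod_cast hn0
  have h1 : (n : ℝ) ^ (-2 * σ) = ((n : ℝ) ^ (-σ)) ^ 2 := by
    rw [← Real.rpow_natCast, ← Real.rpow_mul hn1.le]
    congr 1
    push_cast
    ring
  rw [norm_mul, Complex.norm_of_nonneg (hc n).1, Complex.norm_of_nonneg (by positivity), mul_pow,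
    h1, mul_comm 2 k, pow_mul]
  gcongr
  · exact (hc n).1
  · exact (hc n).2

lemma exists_moment_dirichletPoly_le (k : ℕ) {δ : ℝ} (hδ : 0 < δ) :
    ∃ C : ℝ, 0 ≤ C ∧ ∀ (Q Y : ℕ) (σ T : ℝ), 1 ≤ Q → 1 ≤ Y → 1 ≤ T → 1 / 2 - δ ≤ σ →
    ∑ i ∈ Finset.range Q, ∑ χ : DirichletCharacter ℂ (i + 1),
      (if χ.IsPrimitive then ∫ t : ℝ, Real.exp (-(T ^ 2)⁻¹ * t ^ 2) *
        ‖dirichletPoly χ Y (σ + t * I)‖ ^ (2 * k) else 0) ≤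
      C * ((Q : ℝ) ^ 2 * T + (Y : ℝ) ^ k) * ((Y : ℝ) ^ k) ^ (3 * δ) := by
  set e := δ / (4 * (k + 1)) with he
  have he0 : 0 < e := by positivity
  obtain ⟨D, hD1, hD⟩ := exists_card_divisors_le he0
  refine ⟨200 * (D ^ (2 * k) * (1 + 2 / δ)), by positivity, fun Q Y σ T hQ hY hT hσ => ?_⟩
  refine (sum_moment_dirichletPoly_le hQ k Y σ hT).trans ?_
  have hT0 : 0 < T := by linarith
  set N := Y ^ k with hN
  have hN1 : 1 ≤ N := Nat.one_le_pow _ _ hY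
  have hN1' : (1 : ℝ) ≤ N := by exact_mod_cast hN1
  have hNY : (Y : ℝ) ^ k = N := by rw [hN]; push_cast; rfl
  rw [hNY]
  have hterm : ∀ n ∈ Finset.Icc 1 N, (n.divisors.card : ℝ) ^ (2 * k) * (n : ℝ) ^ (-2 * σ) ≤
      D ^ (2 * k) * (N : ℝ) ^ (5 / 2 * δ) * (n : ℝ)⁻¹ := by
    intro n hn
    obtain ⟨hn1, hn2⟩ := Finset.mem_Icc.mp hn
    have hn1' : (1 : ℝ) ≤ n := by exact_mod_cast hn1
    have hn2' : (n : ℝ) ≤ N := by exact_mod_cast hn2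
    have hn0 : (0 : ℝ) < n := by linarith
    calc (n.divisors.card : ℝ) ^ (2 * k) * (n : ℝ) ^ (-2 * σ) ≤
        (D * (n : ℝ) ^ e) ^ (2 * k) * (n : ℝ) ^ (-2 * σ) := by
          gcongr
          exact hD n (by omega)
      _ = D ^ (2 * k) * (n : ℝ) ^ (e * (2 * k : ℕ) + -2 * σ) := by
          rw [mul_pow, Real.rpow_add hn0, Real.rpow_mul hn0.le e, Real.rpow_natCast]
          ring
      _ ≤ D ^ (2 * k) * (n : ℝ) ^ (5 / 2 * δ + (-1)) := by
          refine mul_le_mul_of_nonneg_left (Real.rpow_le_rpow_of_exponent_le hn1' ?_) (by positivity)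
          · have : e * (2 * k : ℕ) ≤ δ / 2 := by
              rw [he, div_mul_eq_mul_div, div_le_iff₀ (by positivity)]
              push_cast
              nlinarith
            linarith
      _ = D ^ (2 * k) * (n : ℝ) ^ (5 / 2 * δ) * (n : ℝ)⁻¹ := by
          rw [Real.rpow_add hn0, Real.rpow_neg_one]
          ring
      _ ≤ _ := by gcongr
  have hharm : ∑ n ∈ Finset.Icc 1 N, (n : ℝ)⁻¹ ≤ (1 + 2 / δ) * (N : ℝ) ^ (δ / 2) := by
    have h1 := harmonic_le_one_add_log N
    rw [harmonic_eq_sum_Icc] at h1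
    push_cast at h1
    have h2 := Real.log_le_rpow_div (x := N) (by positivity) (half_pos hδ)
    have h3 : 1 ≤ (N : ℝ) ^ (δ / 2) := Real.one_le_rpow hN1' (by positivity)
    calc _ ≤ 1 + Real.log N := h1
      _ ≤ (N : ℝ) ^ (δ / 2) + (N : ℝ) ^ (δ / 2) / (δ / 2) := by linarith
      _ = _ := by field_simp
  calc _ ≤ 200 * ((Q : ℝ) ^ 2 * T + N) *
        ∑ n ∈ Finset.Icc 1 N, D ^ (2 * k) * (N : ℝ) ^ (5 / 2 * δ) * (n : ℝ)⁻¹ := by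
        exact mul_le_mul_of_nonneg_left (Finset.sum_le_sum hterm) (by positivity)
    _ ≤ 200 * ((Q : ℝ) ^ 2 * T + N) * (D ^ (2 * k) * (N : ℝ) ^ (5 / 2 * δ) *
        ((1 + 2 / δ) * (N : ℝ) ^ (δ / 2))) := by
        rw [← Finset.mul_sum]
        gcongr
    _ = 200 * (D ^ (2 * k) * (1 + 2 / δ)) * ((Q : ℝ) ^ 2 * T + N) *
        ((N : ℝ) ^ (5 / 2 * δ) * (N : ℝ) ^ (δ / 2)) := by ring
    _ = _ := by
        rw [← Real.rpow_add (by linarith)]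
        congr 2
        ring

/-- `f` grows at most exponentially in `|Im s|` on the vertical strip `a ≤ Re s ≤ b`. -/
def HasStripGrowth (f : ℂ → ℂ) (a b : ℝ) : Prop :=
  ∃ M : ℝ, 0 ≤ M ∧ ∀ s : ℂ, a ≤ s.re → s.re ≤ b → ‖f s‖ ≤ M * Real.exp (M * |s.im|)

namespace HasStripGrowth

variable {f g : ℂ → ℂ} {a b : ℝ}

lemma of_bounded {M : ℝ} (h : ∀ s : ℂ, a ≤ s.re → s.re ≤ b → ‖f s‖ ≤ M) :
    HasStripGrowth f a b := by
  refine ⟨|M|, abs_nonneg _, fun s h1 h2 => ((h s h1 h2).trans (le_abs_self M)).trans ?_⟩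
  exact le_mul_of_one_le_right (abs_nonneg _) (Real.one_le_exp (by positivity))

lemma mul (hf : HasStripGrowth f a b) (hg : HasStripGrowth g a b) :
    HasStripGrowth (fun s => f s * g s) a b := by
  obtain ⟨M, hM, h1⟩ := hf
  obtain ⟨M', hM', h2⟩ := hg
  refine ⟨M * M' + M + M', by positivity, fun s hs1 hs2 => ?_⟩
  rw [norm_mul]
  calc ‖f s‖ * ‖g s‖ ≤ (M * Real.exp (M * |s.im|)) * (M' * Real.exp (M' * |s.im|)) := by
        gcongr
        · exact h1 s hs1 hs2
        · exact h2 s hs1 hs2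
    _ = (M * M') * Real.exp ((M + M') * |s.im|) := by
        rw [add_mul, Real.exp_add]; ring
    _ ≤ _ := by
        gcongr
        · linarith
        · nlinarith

lemma add (hf : HasStripGrowth f a b) (hg : HasStripGrowth g a b) :
    HasStripGrowth (fun s => f s + g s) a b := by
  obtain ⟨M, hM, h1⟩ := hf
  obtain ⟨M', hM', h2⟩ := hg
  refine ⟨M + M', by positivity, fun s hs1 hs2 => ?_⟩
  calc ‖f s + g s‖ ≤ M * Real.exp (M * |s.im|) + M' * Real.exp (M' * |s.im|) :=
        (norm_add_le _ _).trans (add_le_add (h1 s hs1 hs2) (h2 s hs1 hs2))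
    _ ≤ M * Real.exp ((M + M') * |s.im|) + M' * Real.exp ((M + M') * |s.im|) := by
        gcongr <;> linarith
    _ = _ := by ring

lemma const (c : ℂ) : HasStripGrowth (fun _ => c) a b :=
  of_bounded fun _ _ _ => le_rfl

lemma sum {ι : Type*} (s : Finset ι) {F : ι → ℂ → ℂ} (h : ∀ i ∈ s, HasStripGrowth (F i) a b) :
    HasStripGrowth (fun z => ∑ i ∈ s, F i z) a b := by
  induction s using Finset.induction_on with
  | empty => simpa using const 0
  | insert i s hi ih =>
    simp_rw [Finset.sum_insert hi]
    exact (h i (Finset.mem_insert_self _ _)).add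
      (ih fun j hj => h j (Finset.mem_insert_of_mem hj))

lemma congr (hf : HasStripGrowth f a b) (h : ∀ s : ℂ, a ≤ s.re → s.re ≤ b → g s = f s) :
    HasStripGrowth g a b := by
  obtain ⟨M, hM, h1⟩ := hf
  exact ⟨M, hM, fun s hs1 hs2 => (h s hs1 hs2).symm ▸ h1 s hs1 hs2⟩

lemma mono {a' b' : ℝ} (hf : HasStripGrowth f a b) (ha : a ≤ a') (hb : b' ≤ b) :
    HasStripGrowth f a' b' := by
  obtain ⟨M, hM, h1⟩ := hf
  exact ⟨M, hM, fun s hs1 hs2 => h1 s (ha.trans hs1) (hs2.trans hb)⟩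

/-- Precomposition with a real-linear change of variables `s ↦ r s + w`. -/
lemma comp_affine (r : ℝ) (w : ℂ) {a' b' : ℝ} (hf : HasStripGrowth f a b)
    (h : ∀ x : ℝ, a' ≤ x → x ≤ b' → a ≤ r * x + w.re ∧ r * x + w.re ≤ b) :
    HasStripGrowth (fun s => f (r * s + w)) a' b' := by
  obtain ⟨M, hM, h1⟩ := hf
  refine ⟨M * Real.exp (M * |w.im|) + M * |r|, by positivity, fun s hs1 hs2 => ?_⟩
  obtain ⟨h2, h3⟩ := h s.re hs1 hs2
  have hre : (r * s + w).re = r * s.re + w.re := by simp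
  have him : (r * s + w).im = r * s.im + w.im := by simp
  have h4 := h1 (r * s + w) (by rwa [hre]) (by rwa [hre])
  rw [him] at h4
  have h5 : |r * s.im + w.im| ≤ |r| * |s.im| + |w.im| := by
    rw [← abs_mul]; exact abs_add_le _ _
  calc _ ≤ M * Real.exp (M * |r * s.im + w.im|) := h4
    _ ≤ M * Real.exp (M * (|r| * |s.im| + |w.im|)) := by gcongr
    _ = M * Real.exp (M * |w.im|) * Real.exp (M * |r| * |s.im|) := by
        rw [mul_assoc, ← Real.exp_add]; congr 2; ring
    _ ≤ _ := by
        gcongr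
        · exact le_add_of_nonneg_right (by positivity)
        · exact le_add_of_nonneg_left (by positivity)

lemma const_cpow {c : ℝ} (hc : 0 < c) (a b : ℝ) : HasStripGrowth (fun s => (c : ℂ) ^ s) a b := by
  refine of_bounded (M := c ^ a + c ^ b) fun s h1 h2 => ?_
  rw [Complex.norm_cpow_eq_rpow_re_of_pos hc]
  rcases le_total 1 c with h | h
  · exact (Real.rpow_le_rpow_of_exponent_le h h2).trans
      (le_add_of_nonneg_left (by positivity))
  · exact (Real.rpow_le_rpow_of_exponent_ge hc h h1).trans
      (le_add_of_nonneg_right (by positivity))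

end HasStripGrowth

lemma norm_Gamma_le_Gamma_re {z : ℂ} (hz : 0 < z.re) : ‖Complex.Gamma z‖ ≤ Real.Gamma z.re := by
  rw [Complex.Gamma_eq_integral hz, Complex.GammaIntegral, Real.Gamma_eq_integral hz]
  refine (norm_integral_le_integral_norm _).trans_eq ?_
  refine setIntegral_congr_fun measurableSet_Ioi fun x hx => ?_
  have hx0 : (0 : ℝ) < x := hx
  simp only [norm_mul, Complex.norm_cpow_eq_rpow_re_of_pos hx0, sub_re, one_re]
  rw [Complex.norm_of_nonneg (Real.exp_pos _).le]

lemma hasStripGrowth_Gamma {a : ℝ} (ha : 0 < a) (b : ℝ) :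
    HasStripGrowth Complex.Gamma a b := by
  have hc : ContinuousOn Real.Gamma (Set.Icc a b) := fun x hx =>
    (Real.differentiableAt_Gamma fun m => by
      have : (0 : ℝ) < x := ha.trans_le hx.1
      have : (0 : ℝ) ≤ m := m.cast_nonneg
      linarith).continuousAt.continuousWithinAt
  obtain ⟨M, hM⟩ := isCompact_Icc.exists_bound_of_continuousOn hc
  refine .of_bounded (M := M) fun s h1 h2 => ?_
  exact (norm_Gamma_le_Gamma_re (ha.trans_le h1)).trans
    ((le_abs_self _).trans (hM s.re ⟨h1, h2⟩))

lemma hasStripGrowth_sin_pi (a b : ℝ) :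
    HasStripGrowth (fun s => Complex.sin (Real.pi * s)) a b := by
  refine ⟨Real.pi, Real.pi_pos.le, fun s _ _ => ?_⟩
  have h : ∀ z : ℂ, ‖Complex.sin z‖ ≤ Real.exp |z.im| := by
    intro z
    rw [Complex.sin]
    have h1 : ‖cexp (-z * I)‖ ≤ Real.exp |z.im| := by
      rw [Complex.norm_exp]; simp; exact le_abs_self _
    have h2 : ‖cexp (z * I)‖ ≤ Real.exp |z.im| := by
      rw [Complex.norm_exp]; simp; exact neg_le_abs _
    rw [norm_div, norm_mul, norm_I, mul_one, Complex.norm_ofNat, div_le_iff₀ two_pos]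
    linarith [norm_sub_le (cexp (-z * I)) (cexp (z * I))]
  have h1 := h (Real.pi * s)
  have h2 : ((Real.pi : ℂ) * s).im = Real.pi * s.im := by simp
  rw [h2, abs_mul, abs_of_pos Real.pi_pos] at h1
  refine h1.trans (le_mul_of_one_le_left (Real.exp_pos _).le ?_)
  linarith [Real.pi_gt_three]

lemma hasStripGrowth_inv_Gamma_left {a b : ℝ} (hb : b < 1) :
    HasStripGrowth (fun s => (Complex.Gamma s)⁻¹) a b := by
  have h1 : HasStripGrowth (fun s => Complex.Gamma (((-1 : ℝ) : ℂ) * s + 1)) a b :=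
    (hasStripGrowth_Gamma (a := 1 - b) (by linarith) (1 - a)).comp_affine (-1) 1 (by
      intro x h1 h2; constructor <;> simp <;> linarith)
  refine ((h1.mul (hasStripGrowth_sin_pi a b)).mul (.const (Real.pi : ℂ)⁻¹)).congr ?_
  intro s _ h2
  have h3 := Complex.Gamma_mul_Gamma_one_sub s
  have hpi : (Real.pi : ℂ) ≠ 0 := by exact_mod_cast Real.pi_pos.ne'
  have e : ((-1 : ℝ) : ℂ) * s + 1 = 1 - s := by push_cast; ring
  rw [e]
  by_cases hG : Complex.Gamma s = 0
  · rw [hG, zero_mul] at h3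
    have h4 : Complex.sin (Real.pi * s) = 0 := by
      rcases div_eq_zero_iff.mp h3.symm with h | h
      · exact absurd h hpi
      · exact h
    simp [hG, h4]
  · have h5 : Complex.Gamma (1 - s) ≠ 0 := by
      apply Complex.Gamma_ne_zero_of_re_pos
      simp
      linarith
    have h4 : Complex.sin (Real.pi * s) ≠ 0 := by
      intro h
      rw [h, div_zero] at h3
      exact (mul_ne_zero hG h5) h3
    rw [eq_div_iff h4] at h3
    apply inv_eq_of_mul_eq_one_right
    rw [← mul_assoc, ← mul_assoc, h3, mul_inv_cancel₀ hpi]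

lemma hasStripGrowth_inv_Gamma (a b : ℝ) : HasStripGrowth (fun s => (Complex.Gamma s)⁻¹) a b := by
  have key : ∀ n : ℕ, ∀ a : ℝ,
      HasStripGrowth (fun s => (Complex.Gamma s)⁻¹) a ((n : ℝ) + 1 / 2) := by
    intro n
    induction n with
    | zero => exact fun a => hasStripGrowth_inv_Gamma_left (by norm_num)
    | succ n ih =>
      intro a
      obtain ⟨M, hM, h1⟩ := ih (a - 1)
      obtain ⟨M', hM'⟩ := ((isCompact_Icc (a := a) (b := (n + 1 : ℕ) + 1 / 2)).reProdIm
        (isCompact_Icc (a := (-1 : ℝ)) (b := 1))).exists_bound_of_continuousOn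
        Complex.differentiable_one_div_Gamma.continuous.continuousOn
      refine ⟨M + |M'|, by positivity, fun s hs1 hs2 => ?_⟩
      by_cases him : |s.im| ≤ 1
      · have := hM' s (Complex.mem_reProdIm.mpr ⟨⟨hs1, hs2⟩, abs_le.mp him⟩)
        refine (this.trans (le_abs_self _)).trans ?_
        calc |M'| ≤ M + |M'| := by linarith
          _ ≤ _ := le_mul_of_one_le_right (by positivity) (Real.one_le_exp (by positivity))
      · have h2 : 1 ≤ ‖s - 1‖ := by
          have := Complex.abs_im_le_norm (s - 1)
          simp at this
          linarith
        have h3 : s - 1 ≠ 0 := by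
          intro h; rw [h] at h2; simp at h2; linarith
        have h4 : Complex.Gamma s = (s - 1) * Complex.Gamma (s - 1) := by
          have := Complex.Gamma_add_one (s - 1) h3
          rwa [sub_add_cancel] at this
        have h5 := h1 (s - 1) (by simp; linarith) (by simp at hs2 ⊢; linarith)
        simp only [sub_im, one_im, sub_zero] at h5
        beta_reduce
        rw [h4, mul_inv, norm_mul, norm_inv]
        calc ‖s - 1‖⁻¹ * ‖(Complex.Gamma (s - 1))⁻¹‖ ≤ 1 * (M * Real.exp (M * |s.im|)) := by
              gcongr
              exact inv_le_one_of_one_le₀ h2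
          _ ≤ _ := by
              rw [one_mul]
              gcongr <;> linarith [abs_nonneg M']
  obtain ⟨n, hn⟩ := exists_nat_ge b
  exact (key n a).mono le_rfl (by linarith)

lemma hasStripGrowth_inv_Gammaℝ (a b : ℝ) :
    HasStripGrowth (fun s => (Complex.Gammaℝ s)⁻¹) a b := by
  have h1 := (hasStripGrowth_inv_Gamma (a / 2) (b / 2)).comp_affine (a' := a) (b' := b) (1 / 2) 0
    (by intro x h1 h2; constructor <;> simp <;> linarith)
  have h2 := (HasStripGrowth.const_cpow Real.pi_pos (a / 2) (b / 2)).comp_affine (a' := a)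
    (b' := b) (1 / 2) 0 (by intro x h1 h2; constructor <;> simp <;> linarith)
  refine (h2.mul h1).congr fun s _ _ => ?_
  rw [Complex.Gammaℝ_def, mul_inv, ← Complex.cpow_neg]
  congr 2
  · push_cast; ring
  · push_cast; ring_nf

lemma hasStripGrowth_Gammaℝ {a : ℝ} (ha : 0 < a) (b : ℝ) :
    HasStripGrowth Complex.Gammaℝ a b := by
  have h1 := (hasStripGrowth_Gamma (half_pos ha) (b / 2)).comp_affine (a' := a) (b' := b) (1 / 2) 0
    (by intro x h1 h2; constructor <;> simp <;> linarith)
  have h2 := (HasStripGrowth.const_cpow Real.pi_pos (-(b / 2)) (-(a / 2))).comp_affine (a' := a)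
    (b' := b) (-(1 / 2)) 0 (by intro x h1 h2; constructor <;> simp <;> linarith)
  refine (h2.mul h1).congr fun s _ _ => ?_
  rw [Complex.Gammaℝ_def]
  congr 2
  · push_cast; ring
  · push_cast; ring_nf

lemma WeakFEPair.hasStripGrowth_Λ₀ (P : WeakFEPair ℂ) (a b : ℝ) :
    HasStripGrowth P.Λ₀ a b := by
  have hconv : ∀ s : ℂ, MellinConvergent P.f_modif s := fun s =>
    (P.isStrongFEPair_toStrongFEPair.hasMellin s).1
  have hI : ∀ c : ℝ, IntegrableOn (fun x : ℝ => x ^ (c - 1) * ‖P.f_modif x‖) (Set.Ioi 0) := by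
    intro c
    refine IntegrableOn.congr_fun (hconv c).norm (fun x hx => ?_) measurableSet_Ioi
    have hx0 : (0 : ℝ) < x := hx
    simp [Complex.norm_cpow_eq_rpow_re_of_pos hx0]
  refine .of_bounded (M := ∫ x in Set.Ioi (0 : ℝ), (x ^ (a - 1) * ‖P.f_modif x‖ +
    x ^ (b - 1) * ‖P.f_modif x‖)) fun s h1 h2 => ?_
  rw [WeakFEPair.Λ₀, mellin]
  refine norm_integral_le_of_norm_le ((hI a).add (hI b)) ?_
  filter_upwards [ae_restrict_mem measurableSet_Ioi] with x hx
  have hx0 : (0 : ℝ) < x := hx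
  rw [norm_smul, Complex.norm_cpow_eq_rpow_re_of_pos hx0, sub_re, one_re, ← add_mul]
  gcongr
  rcases le_total 1 x with h | h
  · exact (Real.rpow_le_rpow_of_exponent_le h (by linarith)).trans
      (le_add_of_nonneg_left (by positivity))
  · exact (Real.rpow_le_rpow_of_exponent_ge hx0 h (by linarith)).trans
      (le_add_of_nonneg_right (by positivity))

open HurwitzZeta in
lemma ZMod.hasStripGrowth_completedLFunction₀ {N : ℕ} [NeZero N] (Φ : ZMod N → ℂ) (a b : ℝ) :
    HasStripGrowth (ZMod.completedLFunction₀ Φ) a b := by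
  have hN : (0 : ℝ) < N := by exact_mod_cast NeZero.pos N
  have hcp : HasStripGrowth (fun s => (N : ℂ) ^ (-s)) a b := by
    refine ((HasStripGrowth.const_cpow hN (-b) (-a)).comp_affine (a' := a) (b' := b) (-1) 0
      (by intro x h1 h2; constructor <;> simp <;> linarith)).congr fun s _ _ => ?_
    simp
  have hev : ∀ x : UnitAddCircle, HasStripGrowth (completedHurwitzZetaEven₀ x) a b := by
    intro x
    refine ((((hurwitzEvenFEPair x).hasStripGrowth_Λ₀ (a / 2) (b / 2)).comp_affine
      (a' := a) (b' := b) (1 / 2) 0 (by intro x h1 h2; constructor <;> simp <;> linarith)).mul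
      (.const (1 / 2))).congr fun s _ _ => ?_
    rw [completedHurwitzZetaEven₀, div_eq_mul_one_div]
    congr 2
    push_cast
    ring
  have hodd : ∀ x : UnitAddCircle, HasStripGrowth (completedHurwitzZetaOdd x) a b := by
    intro x
    refine ((((hurwitzOddFEPair x).hasStripGrowth_Λ₀ ((a + 1) / 2) ((b + 1) / 2)).comp_affine
      (a' := a) (b' := b) (1 / 2) (1 / 2)
      (by intro x h1 h2; constructor <;> simp <;> linarith)).mul
      (.const (1 / 2))).congr fun s _ _ => ?_
    have hs := isStrong_hurwitzOddFEPair x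
    rw [completedHurwitzZetaOdd, div_eq_mul_one_div, WeakFEPair.Λ, hs.hf₀, hs.hg₀, smul_zero,
      smul_zero, sub_zero, sub_zero]
    congr 2
    push_cast
    ring
  exact (hcp.mul (.sum _ fun j _ => (HasStripGrowth.const _).mul (hev _))).add
    (hcp.mul (.sum _ fun j _ => (HasStripGrowth.const _).mul (hodd _)))

lemma DirichletCharacter.hasStripGrowth_LFunction {N : ℕ} [NeZero N] {χ : DirichletCharacter ℂ N}
    (hχ : χ ≠ 1) (a b : ℝ) : HasStripGrowth χ.LFunction a b := by
  have hN : N ≠ 1 := hχ ∘ level_one' _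
  have hL : HasStripGrowth χ.completedLFunction a b := by
    refine (ZMod.hasStripGrowth_completedLFunction₀ χ a b).congr fun s _ _ => ?_
    rw [DirichletCharacter.completedLFunction, ZMod.completedLFunction_eq, χ.map_zero' hN,
      χ.sum_eq_zero_of_ne_one hχ]
    simp
  have hg : HasStripGrowth (fun s => (χ.gammaFactor s)⁻¹) a b := by
    rcases χ.even_or_odd with h | h
    · simp_rw [h.gammaFactor_def]
      exact hasStripGrowth_inv_Gammaℝ a b
    · simp_rw [h.gammaFactor_def]
      refine ((hasStripGrowth_inv_Gammaℝ (a + 1) (b + 1)).comp_affine (a' := a) (b' := b) 1 1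
        (by intro x h1 h2; constructor <;> simp <;> linarith)).congr fun s _ _ => ?_
      simp
  refine (hL.mul hg).congr fun s _ _ => ?_
  rw [χ.LFunction_eq_completed_div_gammaFactor s (Or.inr hN), div_eq_mul_inv]

lemma norm_Gamma_conj (z : ℂ) : ‖Complex.Gamma ((starRingEnd ℂ) z)‖ = ‖Complex.Gamma z‖ := by
  rw [Complex.Gamma_conj, Complex.norm_conj]

lemma norm_Gamma_add_natCast_le {z : ℂ} (m : ℕ) (hz : ∀ j < m, z + j ≠ 0) :
    ‖Complex.Gamma (z + m)‖ ≤ (‖z‖ + m) ^ m * ‖Complex.Gamma z‖ := by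
  have key : ∀ n ≤ m, ‖Complex.Gamma (z + n)‖ ≤ (‖z‖ + m) ^ n * ‖Complex.Gamma z‖ := by
    intro n
    induction n with
    | zero => simp
    | succ n ih =>
      intro hn
      have h1 := ih (by omega)
      rw [Nat.cast_succ, ← add_assoc, Complex.Gamma_add_one _ (hz n (by omega)), norm_mul, pow_succ']
      have h2 : ‖z + n‖ ≤ ‖z‖ + m := by
        refine (norm_add_le _ _).trans ?_
        rw [Complex.norm_natCast]
        have : (n : ℝ) ≤ m := by exact_mod_cast (by omega)
        linarith
      calc _ ≤ (‖z‖ + m) * ((‖z‖ + m) ^ n * ‖Complex.Gamma z‖) := by gcongr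
        _ = _ := by ring
  exact key m le_rfl

/-- A uniform bound for `Γ` at two points with the same imaginary part. -/
lemma exists_norm_Gamma_le_norm_Gamma_add {x δ : ℝ} (hx : 0 < x) (hδ : 0 < δ) :
    ∃ C, 0 ≤ C ∧ ∀ z : ℂ, z.re = x → ‖Complex.Gamma z‖ ≤ C * ‖Complex.Gamma (z + δ)‖ := by
  set J : ℝ := ∫ y in (0 : ℝ)..1, y ^ (x - 1) * (1 - y) ^ (δ - 1)
  have hconv := Complex.betaIntegral_convergent (u := x) (v := δ) (by simpa) (by simpa)
  have hGδ : 0 < Real.Gamma δ := Real.Gamma_pos_of_pos hδ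
  refine ⟨|J| / Real.Gamma δ, by positivity, fun z hz => ?_⟩
  have h1 := Complex.Gamma_mul_Gamma_eq_betaIntegral (s := z) (t := δ) (by rw [hz]; exact hx)
    (by simpa)
  have h2 : ‖Complex.betaIntegral z δ‖ ≤ |J| := by
    rw [Complex.betaIntegral]
    refine (intervalIntegral.norm_integral_le_abs_of_norm_le (g := fun y : ℝ =>
      y ^ (x - 1) * (1 - y) ^ (δ - 1)) ?_ ?_)
    · refine (ae_restrict_mem measurableSet_uIoc).mono fun y hy => ?_
      rw [Set.uIoc_of_le zero_le_one] at hy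
      rcases hy.2.lt_or_eq with h | h
      · have e : (1 : ℂ) - y = ((1 - y : ℝ) : ℂ) := by push_cast; rfl
        rw [norm_mul, e, Complex.norm_cpow_eq_rpow_re_of_pos hy.1,
          Complex.norm_cpow_eq_rpow_re_of_pos (by linarith)]
        simp [hz]
      · subst h
        simp only [ofReal_one, one_cpow, sub_self, one_mul, Real.one_rpow]
        by_cases hd : δ = 1
        · simp [hd]
        · have : (δ : ℂ) - 1 ≠ 0 := by
            intro h; apply hd; exact_mod_cast sub_eq_zero.mp h
          rw [Complex.zero_cpow this, Real.zero_rpow (sub_ne_zero.mpr hd), norm_zero]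
    · refine (hconv.norm).congr_ae ?_
      refine (ae_restrict_mem measurableSet_uIoc).mp ?_
      have : ∀ᵐ y : ℝ ∂(volume.restrict (Set.uIoc 0 1)), y ≠ 1 :=
        ae_restrict_of_ae (by simp [ae_iff])
      filter_upwards [this] with y hy1 hy
      rw [Set.uIoc_of_le zero_le_one] at hy
      have h : y < 1 := lt_of_le_of_ne hy.2 hy1
      have e : (1 : ℂ) - y = ((1 - y : ℝ) : ℂ) := by push_cast; rfl
      rw [norm_mul, e, Complex.norm_cpow_eq_rpow_re_of_pos hy.1,
          Complex.norm_cpow_eq_rpow_re_of_pos (by linarith)]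
      simp
  have h3 := congrArg norm h1
  rw [norm_mul, norm_mul, Complex.Gamma_ofReal, Complex.norm_real, Real.norm_of_nonneg hGδ.le] at h3
  rw [div_mul_eq_mul_div, le_div_iff₀ hGδ, h3, mul_comm]
  gcongr

lemma norm_Gammaℝ (s : ℂ) :
    ‖Complex.Gammaℝ s‖ = Real.pi ^ (-(s.re / 2)) * ‖Complex.Gamma (s / 2)‖ := by
  rw [Complex.Gammaℝ_def, norm_mul, Complex.norm_cpow_eq_rpow_re_of_pos Real.pi_pos]
  congr 2
  have : -s / 2 = ((-(1 / 2) : ℝ) : ℂ) * s := by push_cast; ring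
  rw [this, re_ofReal_mul]; ring

/-- Bound for the archimedean factor of the functional equation to the left of the critical
line. -/
lemma exists_norm_Gammaℝ_div_left_le (m : ℕ) :
    ∃ C, 0 ≤ C ∧ ∀ (κ : ℝ) (s : ℂ), (κ = 0 ∨ κ = 1) → s.re = 1 / 2 - m →
      ‖Complex.Gammaℝ (1 - s + κ) * (Complex.Gammaℝ (s + κ))⁻¹‖ ≤ C * (1 + |s.im|) ^ m := by
  refine ⟨(2 * m + 1) ^ m, by positivity, fun κ s hκ hs => ?_⟩
  have hz : ∀ j : ℕ, (s + κ) / 2 + j ≠ 0 := by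
    intro j hj
    have h1 := congrArg re hj
    have e : (s + κ) / 2 = ((1 / 2 : ℝ) : ℂ) * (s + κ) := by push_cast; ring
    rw [e, add_re, re_ofReal_mul, add_re, hs, ofReal_re, natCast_re, zero_re] at h1
    rcases hκ with rfl | rfl
    · have h2 : (2 * m : ℝ) = 4 * j + 1 := by linarith
      have h3 : 2 * m = 4 * j + 1 := by exact_mod_cast h2
      omega
    · have h2 : (2 * m : ℝ) = 4 * j + 3 := by linarith
      have h3 : 2 * m = 4 * j + 3 := by exact_mod_cast h2
      omega
  have h1 := norm_Gamma_add_natCast_le m (fun j _ => hz j)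
  have hG : Complex.Gamma ((s + κ) / 2) ≠ 0 := Complex.Gamma_ne_zero fun j h => hz j (by rw [h]; ring)
  have hconj : (starRingEnd ℂ) ((1 - s + κ) / 2) = (s + κ) / 2 + m := by
    have h2 : ((1 - s + κ) / 2) = ((1 / 2 : ℝ) : ℂ) * (1 - s + κ) := by push_cast; ring
    have h3 : (s + κ) / 2 = ((1 / 2 : ℝ) : ℂ) * (s + κ) := by push_cast; ring
    rw [h2, h3]
    apply Complex.ext
    · rw [conj_re, re_ofReal_mul, add_re, add_re, re_ofReal_mul, add_re, sub_re, hs]; simp; ring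
    · rw [conj_im, im_ofReal_mul, add_im, add_im, im_ofReal_mul, add_im, sub_im]; simp
  rw [norm_mul, norm_inv, norm_Gammaℝ, norm_Gammaℝ, ← norm_Gamma_conj ((1 - s + κ) / 2), hconj,
    ← div_eq_mul_inv, mul_div_mul_comm, ← Real.rpow_sub Real.pi_pos]
  have hpi : Real.pi ^ (-((1 - s + (κ : ℂ)).re / 2) - -((s + (κ : ℂ)).re / 2)) ≤ 1 := by
    apply Real.rpow_le_one_of_one_le_of_nonpos (by linarith [Real.pi_gt_three])
    simp only [add_re, sub_re, one_re, hs, ofReal_re]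
    linarith [(m.cast_nonneg : (0 : ℝ) ≤ m)]
  have hnorm : ‖(s + κ) / 2‖ + m ≤ (2 * m + 1) * (1 + |s.im|) := by
    rw [norm_div, Complex.norm_ofNat]
    have h2 : ‖s + κ‖ ≤ |s.re| + |s.im| + |κ| := by
      refine (norm_add_le _ _).trans ?_
      rw [Complex.norm_real, Real.norm_eq_abs]
      linarith [Complex.norm_le_abs_re_add_abs_im s]
    have h3 : |s.re| ≤ 1 / 2 + m := by
      rw [hs]; apply abs_le.mpr; constructor <;> linarith [(m.cast_nonneg : (0 : ℝ) ≤ m)]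
    have h4 : |κ| ≤ 1 := by rcases hκ with rfl | rfl <;> simp
    have h5 : 0 ≤ |s.im| := abs_nonneg _
    have h6 : (0 : ℝ) ≤ m := m.cast_nonneg
    nlinarith
  calc _ ≤ 1 * (‖(s + κ) / 2‖ + m) ^ m := by
        gcongr
        rw [div_le_iff₀ (norm_pos_iff.mpr hG)]
        exact h1
    _ ≤ 1 * ((2 * m + 1) * (1 + |s.im|)) ^ m := by gcongr
    _ = _ := by rw [one_mul, mul_pow]

/-- Bound for the archimedean factor of the functional equation to the right of the critical
line. -/
lemma exists_norm_Gammaℝ_div_right_le {δ : ℝ} (hδ : 0 < δ) (hδ2 : δ < 1 / 2) :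
    ∃ C, 0 ≤ C ∧ ∀ (κ : ℝ) (s : ℂ), (κ = 0 ∨ κ = 1) → s.re = 1 / 2 + δ →
      ‖Complex.Gammaℝ (1 - s + κ) * (Complex.Gammaℝ (s + κ))⁻¹‖ ≤ C := by
  have key : ∀ κ : ℝ, (κ = 0 ∨ κ = 1) → ∃ C, 0 ≤ C ∧ ∀ s : ℂ, s.re = 1 / 2 + δ →
      ‖Complex.Gammaℝ (1 - s + κ) * (Complex.Gammaℝ (s + κ))⁻¹‖ ≤ C := by
    intro κ hκ
    have hκ0 : 0 ≤ κ := by rcases hκ with rfl | rfl <;> simp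
    obtain ⟨C, hC, h⟩ := exists_norm_Gamma_le_norm_Gamma_add
      (x := (1 / 2 - δ + κ) / 2) (by linarith) hδ
    refine ⟨Real.pi ^ δ * C, by positivity, fun s hs => ?_⟩
    have h2 : ((1 - s + κ) / 2) = ((1 / 2 : ℝ) : ℂ) * (1 - s + κ) := by push_cast; ring
    have h3 : (s + κ) / 2 = ((1 / 2 : ℝ) : ℂ) * (s + κ) := by push_cast; ring
    have hconj : (starRingEnd ℂ) ((1 - s + κ) / 2) + δ = (s + κ) / 2 := by
      rw [h2, h3]
      apply Complex.ext
      · rw [add_re, conj_re, re_ofReal_mul, add_re, re_ofReal_mul, add_re, sub_re, hs]; simp; ring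
      · rw [add_im, conj_im, im_ofReal_mul, add_im, im_ofReal_mul, add_im, sub_im]; simp
    have h4 := h ((starRingEnd ℂ) ((1 - s + κ) / 2)) (by
      rw [h2, conj_re, re_ofReal_mul, add_re, sub_re, hs]; simp; ring)
    rw [hconj] at h4
    have hG : Complex.Gamma ((s + κ) / 2) ≠ 0 := by
      apply Complex.Gamma_ne_zero_of_re_pos
      rw [h3, re_ofReal_mul, add_re, hs, ofReal_re]
      linarith
    rw [norm_mul, norm_inv, norm_Gammaℝ, norm_Gammaℝ, ← norm_Gamma_conj ((1 - s + κ) / 2),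
      ← div_eq_mul_inv, mul_div_mul_comm, ← Real.rpow_sub Real.pi_pos]
    gcongr
    · linarith [Real.pi_gt_three]
    · simp only [add_re, sub_re, one_re, hs, ofReal_re]; linarith
    · rw [div_le_iff₀ (norm_pos_iff.mpr hG)]; exact h4
  obtain ⟨C₀, h0, h⟩ := key 0 (Or.inl rfl)
  obtain ⟨C₁, h1, h'⟩ := key 1 (Or.inr rfl)
  refine ⟨C₀ + C₁, by positivity, fun κ s hκ hs => ?_⟩
  rcases hκ with rfl | rfl
  · linarith [h s hs]
  · linarith [h' s hs]

open Filter Topology in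
lemma tendsto_integral_inv_add_mul_I {c : ℝ} (hc : c ≠ 0) :
    Tendsto (fun V : ℝ => ∫ v in (-V)..V, ((c : ℂ) + v * I)⁻¹) atTop
      (𝓝 ((SignType.sign c : ℝ) * Real.pi : ℝ)) := by
  have hne : ∀ v : ℝ, (c : ℂ) + v * I ≠ 0 := by
    intro v h
    have := congrArg re h
    simp at this
    exact hc this
  have hcont : Continuous fun v : ℝ => ((c : ℂ) + v * I)⁻¹ :=
    Continuous.inv₀ (by fun_prop) hne
  have h1 : ∀ V : ℝ, (∫ v in (-V)..V, ((c : ℂ) + v * I)⁻¹) =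
      ((2 * Real.arctan (V / c) : ℝ) : ℂ) := by
    intro V
    have h2 : ∫ v in (-V)..V, ((c : ℂ) + v * I)⁻¹ = ∫ v in (-V)..V, ((c : ℂ) + (-v : ℝ) * I)⁻¹ := by
      rw [intervalIntegral.integral_comp_neg (f := fun v : ℝ => ((c : ℂ) + v * I)⁻¹)]
      simp
    have h3 : ∫ v in (-V)..V, (((c : ℂ) + v * I)⁻¹ + ((c : ℂ) + (-v : ℝ) * I)⁻¹) =
        ((2 * (2 * Real.arctan (V / c)) : ℝ) : ℂ) := by
      have h4 : ∀ v : ℝ, ((c : ℂ) + v * I)⁻¹ + ((c : ℂ) + (-v : ℝ) * I)⁻¹ =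
          ((2 * c⁻¹ * (1 + (v / c) ^ 2)⁻¹ : ℝ) : ℂ) := by
        intro v
        have h5 := hne v
        have h6 := hne (-v)
        have h8 : (c : ℂ) ≠ 0 := by exact_mod_cast hc
        push_cast at h6 ⊢
        rw [neg_mul, ← sub_eq_add_neg] at h6 ⊢
        have h7 : (1 : ℂ) + (v / c) ^ 2 = (c + v * I) * (c - v * I) / c ^ 2 := by
          field_simp
          linear_combination (v : ℂ) ^ 2 * I_sq
        rw [h7]
        field_simp
        ring
      simp_rw [h4]
      rw [intervalIntegral.integral_ofReal, intervalIntegral.integral_const_mul,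
        intervalIntegral.integral_comp_div (f := fun x : ℝ => (1 + x ^ 2)⁻¹) hc,
        integral_inv_one_add_sq, neg_div, Real.arctan_neg]
      congr 1
      simp only [smul_eq_mul]
      field_simp
      ring
    have hcont' : Continuous fun v : ℝ => ((c : ℂ) + (-v : ℝ) * I)⁻¹ := hcont.comp continuous_neg
    rw [intervalIntegral.integral_add (hcont.intervalIntegrable _ _)
      (hcont'.intervalIntegrable _ _), ← h2, ← two_mul] at h3
    have h4 : (2 : ℂ) ≠ 0 := two_ne_zero
    apply mul_left_cancel₀ h4
    rw [h3]
    push_cast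
    ring
  simp_rw [h1]
  apply Tendsto.comp (continuous_ofReal.tendsto _)
  rcases lt_or_gt_of_ne hc with h | h
  · have h2 : Tendsto (fun V : ℝ => V / c) atTop atBot := tendsto_id.atTop_div_const_of_neg h
    have h3 := ((Real.tendsto_arctan_atBot.mono_right nhdsWithin_le_nhds).comp h2).const_mul 2
    convert h3 using 2
    · rfl
    rw [sign_neg h, SignType.coe_neg_one]
    ring
  · have h2 : Tendsto (fun V : ℝ => V / c) atTop atTop := tendsto_id.atTop_div_const h
    have h3 := ((Real.tendsto_arctan_atTop.mono_right nhdsWithin_le_nhds).comp h2).const_mul 2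
    convert h3 using 2
    · rfl
    rw [sign_pos h, SignType.coe_one]
    ring

lemma integrable_of_norm_le_gaussian {g : ℝ → ℂ} (hg : Continuous g) {B : ℝ}
    (h : ∀ v, ‖g v‖ ≤ B * Real.exp (-(1 / 2) * v ^ 2)) : Integrable g := by
  have h1 : Integrable fun v : ℝ => B * Real.exp (-(1 / 2) * v ^ 2) :=
    (integrable_exp_neg_mul_sq (by norm_num : (0 : ℝ) < 1 / 2)).const_mul B
  exact h1.mono' hg.aestronglyMeasurable (.of_forall h)

open Filter Topology in
/-- Cauchy's integral formula for a strip, for a function of Gaussian decay. -/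
lemma strip_integral_formula {h : ℂ → ℂ} {a c B : ℝ} (ha : a < 0) (hc : 0 < c)
    (hd : DifferentiableOn ℂ h {w | a ≤ w.re ∧ w.re ≤ c})
    (hB : ∀ w : ℂ, a ≤ w.re → w.re ≤ c → ‖h w‖ ≤ B * Real.exp (-(1 / 2) * w.im ^ 2)) :
    2 * Real.pi * h 0 = (∫ v : ℝ, h (c + v * I) * (c + v * I)⁻¹) -
      ∫ v : ℝ, h (a + v * I) * (a + v * I)⁻¹ := by
  set Sr : Set ℂ := {w | a ≤ w.re ∧ w.re ≤ c}
  have hB0 : 0 ≤ B := by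
    have := (norm_nonneg _).trans (hB 0 (by simpa using ha.le) (by simpa using hc.le))
    simpa using this
  have hB' : ∀ w : ℂ, a ≤ w.re → w.re ≤ c → ‖h w‖ ≤ B := fun w h1 h2 =>
    (hB w h1 h2).trans (mul_le_of_le_one_right hB0 (Real.exp_le_one_iff.mpr (by nlinarith [sq_nonneg w.im])))
  have hnhds : Sr ∈ 𝓝 (0 : ℂ) := by
    have h1 : {w : ℂ | a < w.re} ∩ {w : ℂ | w.re < c} ∈ 𝓝 (0 : ℂ) :=
      ((isOpen_lt continuous_const continuous_re).inter
        (isOpen_lt continuous_re continuous_const)).mem_nhds ⟨by simpa using ha, by simpa using hc⟩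
    filter_upwards [h1] with w hw using ⟨hw.1.le, hw.2.le⟩
  set g := dslope h 0
  have hg : DifferentiableOn ℂ g Sr := (Complex.differentiableOn_dslope hnhds).mpr hd
  have hgw : ∀ w : ℂ, w ≠ 0 → g w = h w * w⁻¹ - h 0 * w⁻¹ := by
    intro w hw
    rw [show g w = slope h 0 w from dslope_of_ne h hw, slope_def_field, sub_zero]
    field_simp
  have line : ∀ r : ℝ, r ≠ 0 → a ≤ r → r ≤ c →
      Integrable (fun v : ℝ => h (r + v * I) * (r + v * I)⁻¹) ∧
      Tendsto (fun V : ℝ => ∫ v in (-V)..V, g (r + v * I)) atTop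
        (𝓝 ((∫ v : ℝ, h (r + v * I) * (r + v * I)⁻¹) -
          h 0 * ((SignType.sign r : ℝ) * Real.pi : ℝ))) := by
    intro r hr h1 h2
    have hne : ∀ v : ℝ, (r : ℂ) + v * I ≠ 0 := by
      intro v h
      have := congrArg re h
      simp at this
      exact hr this
    have hcont : Continuous fun v : ℝ => ((r : ℂ) + v * I)⁻¹ :=
      Continuous.inv₀ (by fun_prop) hne
    have hch : Continuous fun v : ℝ => h (r + v * I) :=
      hd.continuousOn.comp_continuous (by fun_prop) (fun v => by simp [Sr, h1, h2])
    have h_int : Integrable (fun v : ℝ => h (r + v * I) * (r + v * I)⁻¹) := by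
      refine integrable_of_norm_le_gaussian (B := B * |r|⁻¹) (hch.mul hcont) fun v => ?_
      have h3 := hB (r + v * I) (by simpa) (by simpa)
      have h4 : |r| ≤ ‖(r : ℂ) + v * I‖ := by
        simpa using Complex.abs_re_le_norm ((r : ℂ) + v * I)
      have h5 : 0 < |r| := abs_pos.mpr hr
      rw [norm_mul, norm_inv]
      calc _ ≤ (B * Real.exp (-(1 / 2) * v ^ 2)) * |r|⁻¹ := by
            gcongr
            simpa using h3
        _ = _ := by ring
    refine ⟨h_int, ?_⟩
    have h5 := (intervalIntegral_tendsto_integral h_int tendsto_neg_atTop_atBot tendsto_id).sub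
      ((tendsto_integral_inv_add_mul_I hr).const_mul (h 0))
    refine h5.congr fun V => ?_
    rw [id_eq]
    rw [← intervalIntegral.integral_const_mul, ← intervalIntegral.integral_sub]
    · refine intervalIntegral.integral_congr fun v _ => ?_
      exact (hgw _ (hne v)).symm
    · exact (hch.mul hcont).intervalIntegrable _ _
    · exact (hcont.const_mul _).intervalIntegrable _ _
  have horiz : ∀ σ : ℝ, (σ = 1 ∨ σ = -1) →
      Tendsto (fun V : ℝ => ∫ x in a..c, g (x + ((σ * V : ℝ) : ℂ) * I)) atTop (𝓝 0) := by
    intro σ hσ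
    have hz : Tendsto (fun V : ℝ => ((B + ‖h 0‖) * V⁻¹) * |c - a|) atTop (𝓝 0) := by
      have := (tendsto_inv_atTop_zero.const_mul (B + ‖h 0‖)).mul_const |c - a|
      simpa using this
    refine squeeze_zero_norm' ?_ hz
    filter_upwards [eventually_gt_atTop 0] with V hV
    refine intervalIntegral.norm_integral_le_of_norm_le_const fun x hx => ?_
    rw [Set.uIoc_of_le (ha.trans hc).le] at hx
    set w : ℂ := x + ((σ * V : ℝ) : ℂ) * I
    have hre : w.re = x := by simp [w]
    have him : w.im = σ * V := by simp [w]
    have hVw : V ≤ ‖w‖ := by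
      have := Complex.abs_im_le_norm w
      rw [him, abs_mul, abs_of_pos hV] at this
      rcases hσ with rfl | rfl <;> simpa using this
    have hw : w ≠ 0 := norm_pos_iff.mp (hV.trans_le hVw)
    rw [hgw w hw, ← sub_mul, norm_mul, norm_inv]
    gcongr
    exact (norm_sub_le _ _).trans (add_le_add_left (hB' w (hre ▸ hx.1.le) (hre ▸ hx.2)) _)
  have hrect : ∀ V : ℝ, 0 < V → (∫ x : ℝ in a..c, g (x + ((-1 * V : ℝ) : ℂ) * I)) -
      (∫ x : ℝ in a..c, g (x + ((1 * V : ℝ) : ℂ) * I)) +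
      I * (∫ y : ℝ in (-V)..V, g (c + y * I)) - I * (∫ y : ℝ in (-V)..V, g (a + y * I)) = 0 := by
    intro V hV
    have h1 := Complex.integral_boundary_rect_eq_zero_of_differentiableOn g ⟨a, -V⟩ ⟨c, V⟩
      (hg.mono fun w hw => by
        rw [Complex.mem_reProdIm, Set.uIcc_of_le (ha.trans hc).le] at hw
        exact hw.1)
    simpa using h1
  have hlim := (((horiz (-1) (Or.inr rfl)).sub (horiz 1 (Or.inl rfl))).add
    (((line c hc.ne' (ha.trans hc).le le_rfl).2).const_mul I)).sub
    (((line a ha.ne le_rfl (ha.trans hc).le).2).const_mul I)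
  have hzero := tendsto_nhds_unique (hlim.congr' (by
    filter_upwards [eventually_gt_atTop 0] with V hV using hrect V hV)) tendsto_const_nhds
  rw [sign_pos hc, sign_neg ha, sub_zero, zero_add, ← mul_sub] at hzero
  have h2 := (mul_eq_zero.mp hzero).resolve_left I_ne_zero
  rw [SignType.coe_one, SignType.coe_neg_one] at h2
  push_cast at h2
  linear_combination -h2

/-- The smoothing kernel `X ^ w * exp (w ^ 2) / w`. -/
noncomputable def smoothKernel (X : ℝ) (w : ℂ) : ℂ := (X : ℂ) ^ w * cexp (w ^ 2) * w⁻¹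

lemma norm_cpow_mul_cexp_sq {X : ℝ} (hX : 0 < X) (w : ℂ) :
    ‖(X : ℂ) ^ w * cexp (w ^ 2)‖ = X ^ w.re * Real.exp (w.re ^ 2) * Real.exp (-w.im ^ 2) := by
  rw [norm_mul, Complex.norm_cpow_eq_rpow_re_of_pos hX, Complex.norm_exp, mul_assoc, ← Real.exp_add]
  congr 2
  rw [sq, mul_re]
  ring

lemma norm_smoothKernel_le {X : ℝ} (hX : 0 < X) {r : ℝ} (hr : r ≠ 0) (v : ℝ) :
    ‖smoothKernel X (r + v * I)‖ ≤ X ^ r * Real.exp (r ^ 2) * |r|⁻¹ * Real.exp (-v ^ 2) := by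
  rw [smoothKernel, norm_mul, norm_cpow_mul_cexp_sq hX, norm_inv]
  have h4 : |r| ≤ ‖(r : ℂ) + v * I‖ := by
    simpa using Complex.abs_re_le_norm ((r : ℂ) + v * I)
  have h5 : 0 < |r| := abs_pos.mpr hr
  have h6 : ((r : ℂ) + v * I).re = r := by simp
  have h7 : ((r : ℂ) + v * I).im = v := by simp
  rw [h6, h7]
  calc _ ≤ X ^ r * Real.exp (r ^ 2) * Real.exp (-v ^ 2) * |r|⁻¹ := by gcongr
    _ = _ := by ring

lemma exp_mul_exp_neg_sq_le (M v : ℝ) :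
    Real.exp (M * |v|) * Real.exp (-v ^ 2) ≤
      Real.exp (M ^ 2 / 2) * Real.exp (-(1 / 2) * v ^ 2) := by
  rw [← Real.exp_add, ← Real.exp_add]
  apply Real.exp_le_exp.mpr
  have : |v| ^ 2 = v ^ 2 := sq_abs v
  nlinarith [sq_nonneg (M - |v|)]

lemma continuous_smoothKernel_line {X : ℝ} (hX : 0 < X) {r : ℝ} (hr : r ≠ 0) :
    Continuous fun v : ℝ => smoothKernel X (r + v * I) := by
  have hne : ∀ v : ℝ, (r : ℂ) + v * I ≠ 0 := by
    intro v h
    have := congrArg re h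
    simp at this
    exact hr this
  have hX' : (X : ℂ) ≠ 0 := by exact_mod_cast hX.ne'
  unfold smoothKernel
  refine Continuous.mul (Continuous.mul ?_ (by fun_prop)) (Continuous.inv₀ (by fun_prop) hne)
  exact Continuous.const_cpow (by fun_prop) (Or.inl hX')

lemma integrable_mul_smoothKernel {f : ℂ → ℂ} {a c r X : ℝ} (hX : 0 < X) (hr : r ≠ 0) (har : a ≤ r)
    (hrc : r ≤ c) (hf : ContinuousOn f {w | a ≤ w.re ∧ w.re ≤ c}) (hg : HasStripGrowth f a c) :
    Integrable fun v : ℝ => f (r + v * I) * smoothKernel X (r + v * I) := by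
  obtain ⟨M, hM, h⟩ := hg
  have hch : Continuous fun v : ℝ => f (r + v * I) :=
    hf.comp_continuous (by fun_prop) (fun v => by simp [har, hrc])
  refine integrable_of_norm_le_gaussian (hch.mul (continuous_smoothKernel_line hX hr))
    (B := M * (X ^ r * Real.exp (r ^ 2) * |r|⁻¹) * Real.exp (M ^ 2 / 2)) fun v => ?_
  have h1 := h (r + v * I) (by simpa) (by simpa)
  have h7 : ((r : ℂ) + v * I).im = v := by simp
  rw [h7] at h1
  rw [norm_mul]
  calc _ ≤ (M * Real.exp (M * |v|)) *
        (X ^ r * Real.exp (r ^ 2) * |r|⁻¹ * Real.exp (-v ^ 2)) := by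
        gcongr
        exact norm_smoothKernel_le hX hr v
    _ = M * (X ^ r * Real.exp (r ^ 2) * |r|⁻¹) * (Real.exp (M * |v|) * Real.exp (-v ^ 2)) := by ring
    _ ≤ M * (X ^ r * Real.exp (r ^ 2) * |r|⁻¹) *
        (Real.exp (M ^ 2 / 2) * Real.exp (-(1 / 2) * v ^ 2)) := by
        exact mul_le_mul_of_nonneg_left (exp_mul_exp_neg_sq_le M v) (by positivity)
    _ = _ := by ring

lemma two_pi_mul_eq_integral_smoothKernel {f : ℂ → ℂ} {a c X : ℝ} (hX : 0 < X) (ha : a < 0)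
    (hc : 0 < c) (hd : DifferentiableOn ℂ f {w | a ≤ w.re ∧ w.re ≤ c})
    (hg : HasStripGrowth f a c) :
    2 * Real.pi * f 0 = (∫ v : ℝ, f (c + v * I) * smoothKernel X (c + v * I)) -
      ∫ v : ℝ, f (a + v * I) * smoothKernel X (a + v * I) := by
  obtain ⟨M, hM, h⟩ := hg
  have hX' : (X : ℂ) ≠ 0 := by exact_mod_cast hX.ne'
  have key := strip_integral_formula (h := fun w => f w * ((X : ℂ) ^ w * cexp (w ^ 2)))
    (B := M * ((X ^ a + X ^ c) * Real.exp (a ^ 2 + c ^ 2)) * Real.exp (M ^ 2 / 2)) ha hc ?_ ?_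
  · simp only [smoothKernel]
    simpa [mul_assoc] using key
  · refine hd.mul (Differentiable.differentiableOn ?_)
    exact (Differentiable.const_cpow differentiable_id (Or.inl hX')).mul (by fun_prop)
  · intro w h1 h2
    rw [norm_mul, norm_cpow_mul_cexp_sq hX]
    have hXw : X ^ w.re ≤ X ^ a + X ^ c := by
      rcases le_total 1 X with h | h
      · exact (Real.rpow_le_rpow_of_exponent_le h h2).trans
          (le_add_of_nonneg_left (by positivity))
      · exact (Real.rpow_le_rpow_of_exponent_ge hX h h1).trans
          (le_add_of_nonneg_right (by positivity))
    have hsq : w.re ^ 2 ≤ a ^ 2 + c ^ 2 := by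
      rcases le_total 0 w.re with h | h
      · nlinarith [sq_nonneg a]
      · nlinarith [sq_nonneg c]
    calc _ ≤ (M * Real.exp (M * |w.im|)) *
          ((X ^ a + X ^ c) * Real.exp (a ^ 2 + c ^ 2) * Real.exp (-w.im ^ 2)) := by
          gcongr
          exact h w h1 h2
      _ = M * ((X ^ a + X ^ c) * Real.exp (a ^ 2 + c ^ 2)) *
          (Real.exp (M * |w.im|) * Real.exp (-w.im ^ 2)) := by ring
      _ ≤ M * ((X ^ a + X ^ c) * Real.exp (a ^ 2 + c ^ 2)) *
          (Real.exp (M ^ 2 / 2) * Real.exp (-(1 / 2) * w.im ^ 2)) := by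
          exact mul_le_mul_of_nonneg_left (exp_mul_exp_neg_sq_le M w.im) (by positivity)
      _ = _ := by ring

namespace DirichletCharacter

variable {N : ℕ}

lemma norm_dirichletPoly_inv (χ : DirichletCharacter ℂ N) (Y : ℕ) (s : ℂ) :
    ‖dirichletPoly χ⁻¹ Y s‖ = ‖dirichletPoly χ Y ((starRingEnd ℂ) s)‖ := by
  rw [← Complex.norm_conj (dirichletPoly χ Y _), dirichletPoly, dirichletPoly, map_sum]
  congr 1
  refine Finset.sum_congr rfl fun n hn => ?_
  have hn0 : (n : ℂ).arg ≠ Real.pi := by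
    rw [Complex.natCast_arg]; exact Real.pi_pos.ne
  rw [map_mul, ← MulChar.star_apply']
  congr 1
  rw [← map_neg, Complex.cpow_conj _ _ hn0]
  simp

lemma hasStripGrowth_dirichletPoly (χ : DirichletCharacter ℂ N) (Y : ℕ) (a b : ℝ) :
    HasStripGrowth (dirichletPoly χ Y) a b := by
  refine .of_bounded (M := ∑ n ∈ Finset.Icc 1 Y, (n : ℝ) ^ (-a)) fun s h1 _ => ?_
  refine (norm_dirichletPoly_le χ Y s).trans (Finset.sum_le_sum fun n hn => ?_)
  have hn1 : (1 : ℝ) ≤ n := by exact_mod_cast (Finset.mem_Icc.mp hn).1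
  exact Real.rpow_le_rpow_of_exponent_le hn1 (by linarith)

variable [NeZero N]

/-- The tail of the Dirichlet series far to the right of the line of absolute convergence. -/
lemma norm_LFunction_sub_dirichletPoly_le (χ : DirichletCharacter ℂ N) {Y m : ℕ} (hY : 1 ≤ Y)
    (hm : 1 ≤ m) {s : ℂ} (hs : s.re = 1 / 2 + m) :
    ‖χ.LFunction s - dirichletPoly χ Y s‖ ≤
      (∑' n : ℕ, (n : ℝ) ^ (-(3 / 2) : ℝ)) * ((Y : ℝ) ^ (m - 1))⁻¹ := by
  have hm1 : (1 : ℝ) ≤ m := by exact_mod_cast hm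
  have hY0 : (0 : ℝ) < Y := by exact_mod_cast hY
  have hs1 : 1 < s.re := by rw [hs]; linarith
  have hsum : Summable (LSeries.term (χ ·) s) := χ.LSeriesSummable_of_one_lt_re hs1
  have h32 : Summable fun n : ℕ => (n : ℝ) ^ (-(3 / 2) : ℝ) :=
    Real.summable_nat_rpow.mpr (by norm_num)
  have h1 : χ.LFunction s - dirichletPoly χ Y s =
      ∑' n : ℕ, LSeries.term (χ ·) s (n + (Y + 1)) := by
    rw [χ.LFunction_eq_LSeries hs1, LSeries, ← hsum.sum_add_tsum_nat_add (Y + 1), dirichletPoly,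
      Finset.sum_range_succ']
    have h2 : ∑ n ∈ Finset.Icc 1 Y, χ n * (n : ℂ) ^ (-s) =
        ∑ k ∈ Finset.range Y, LSeries.term (χ ·) s (k + 1) := by
      rw [Finset.range_eq_Ico, Finset.sum_Ico_add' (fun k => LSeries.term (χ ·) s k) 0 Y 1]
      refine Finset.sum_congr (by ext; simp) fun n hn => ?_
      have hn0 : n ≠ 0 := by
        have := (Finset.mem_Icc.mp hn).1; omega
      rw [LSeries.term_of_ne_zero hn0, Complex.cpow_neg, div_eq_mul_inv]
    rw [h2, LSeries.term_zero]
    ring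
  have hbd : ∀ n : ℕ, ‖LSeries.term (χ ·) s (n + (Y + 1))‖ ≤
      ((n + (Y + 1) : ℕ) : ℝ) ^ (-(3 / 2) : ℝ) * ((Y : ℝ) ^ (m - 1))⁻¹ := by
    intro n
    have hn0 : n + (Y + 1) ≠ 0 := by omega
    have hnp : (0 : ℝ) < (n + (Y + 1) : ℕ) := by exact_mod_cast Nat.pos_of_ne_zero hn0
    rw [LSeries.term_of_ne_zero hn0, norm_div, Complex.norm_natCast_cpow_of_pos (by omega), hs]
    have e : (1 / 2 + m : ℝ) = 3 / 2 + (m - 1 : ℕ) := by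
      rw [Nat.cast_sub hm]; push_cast; ring
    rw [e, Real.rpow_add hnp, Real.rpow_natCast, Real.rpow_neg hnp.le, ← mul_inv, ← one_div]
    gcongr
    · exact χ.norm_le_one _
    · omega
  have h3 : Summable fun n : ℕ => ((n + (Y + 1) : ℕ) : ℝ) ^ (-(3 / 2) : ℝ) :=
    h32.comp_injective (add_left_injective (Y + 1))
  rw [h1]
  refine (tsum_of_norm_bounded ((h3.mul_right _).hasSum) hbd).trans ?_
  rw [tsum_mul_right]
  refine mul_le_mul_of_nonneg_right ?_ (by positivity)
  rw [← h32.sum_add_tsum_nat_add (Y + 1)]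
  exact le_add_of_nonneg_left (Finset.sum_nonneg fun _ _ => by positivity)

lemma norm_rootNumber_le_one {χ : DirichletCharacter ℂ N} (hχ : χ.IsPrimitive) :
    ‖χ.rootNumber‖ ≤ 1 := by
  have hN : (0 : ℝ) < N := by exact_mod_cast NeZero.pos N
  have h1 := norm_gaussSum_sq hχ
  have h2 : ‖(N : ℂ) ^ (1 / 2 : ℂ)‖ = (N : ℝ) ^ (1 / 2 : ℝ) := by
    rw [Complex.norm_natCast_cpow_of_pos (NeZero.pos N)]
    norm_num
  have h3 : ‖gaussSum χ ZMod.stdAddChar‖ = (N : ℝ) ^ (1 / 2 : ℝ) := by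
    rw [← Real.sqrt_eq_rpow, ← h1, Real.sqrt_sq (norm_nonneg _)]
  rw [rootNumber, norm_div, norm_div, norm_pow, norm_I, one_pow, div_one, h2, h3,
    div_self (by positivity)]

/-- The asymmetric functional equation, with the archimedean factor made explicit. -/
lemma IsPrimitive.exists_LFunction_eq {χ : DirichletCharacter ℂ N} (hχ : χ.IsPrimitive)
    (hN : N ≠ 1) : ∃ κ : ℝ, (κ = 0 ∨ κ = 1) ∧ ∀ s : ℂ, s.re < 1 →
      χ.LFunction s = (N : ℂ) ^ (1 / 2 - s) * χ.rootNumber *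
        (Complex.Gammaℝ (1 - s + κ) * (Complex.Gammaℝ (s + κ))⁻¹) * χ⁻¹.LFunction (1 - s) := by
  have hinv : χ⁻¹ (-1) = χ (-1) := by
    rw [MulChar.inv_apply_eq_inv']
    rcases χ.even_or_odd with h | h
    · rw [show χ (-1) = 1 from h, inv_one]
    · rw [show χ (-1) = -1 from h, inv_neg_one]
  have key : ∀ κ : ℝ, 0 ≤ κ → (∀ s, χ.gammaFactor s = Complex.Gammaℝ (s + κ)) →
      (∀ s, χ⁻¹.gammaFactor s = Complex.Gammaℝ (s + κ)) → ∀ s : ℂ, s.re < 1 →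
      χ.LFunction s = (N : ℂ) ^ (1 / 2 - s) * χ.rootNumber *
        (Complex.Gammaℝ (1 - s + κ) * (Complex.Gammaℝ (s + κ))⁻¹) * χ⁻¹.LFunction (1 - s) := by
    intro κ hκ h1 h2 s hs
    have h3 := hχ.completedLFunction_one_sub (1 - s)
    rw [sub_sub_cancel] at h3
    have h4 : Complex.Gammaℝ (1 - s + κ) ≠ 0 :=
      Complex.Gammaℝ_ne_zero_of_re_pos (by simp; linarith)
    rw [χ.LFunction_eq_completed_div_gammaFactor s (Or.inr hN),
      χ⁻¹.LFunction_eq_completed_div_gammaFactor (1 - s) (Or.inr hN), h1, h2, h3]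
    rw [show (1 - s - 1 / 2 : ℂ) = 1 / 2 - s by ring]
    field_simp
  rcases χ.even_or_odd with h | h
  · have h' : χ⁻¹.Even := hinv.trans h
    exact ⟨0, Or.inl rfl, key 0 le_rfl (fun s => by rw [h.gammaFactor_def]; simp)
      (fun s => by rw [h'.gammaFactor_def]; simp)⟩
  · have h' : χ⁻¹.Odd := hinv.trans h
    exact ⟨1, Or.inr rfl, key 1 zero_le_one (fun s => by rw [h.gammaFactor_def]; simp)
      (fun s => by rw [h'.gammaFactor_def]; simp)⟩

end DirichletCharacter

namespace DirichletCharacter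

/-- The factor in the asymmetric functional equation of a Dirichlet `L`-function of parity `κ`. -/
noncomputable def feFactor {N : ℕ} [NeZero N] (χ : DirichletCharacter ℂ N) (κ : ℝ) (z : ℂ) : ℂ :=
  (N : ℂ) ^ (1 / 2 - z) * χ.rootNumber *
    (Complex.Gammaℝ (1 - z + κ) * (Complex.Gammaℝ (z + κ))⁻¹)

lemma norm_feFactor_le {N : ℕ} [NeZero N] {χ : DirichletCharacter ℂ N} (hχ : χ.IsPrimitive)
    (κ : ℝ) (z : ℂ) : ‖feFactor χ κ z‖ ≤ (N : ℝ) ^ (1 / 2 - z.re) *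
      ‖Complex.Gammaℝ (1 - z + κ) * (Complex.Gammaℝ (z + κ))⁻¹‖ := by
  have h : (1 / 2 - z).re = 1 / 2 - z.re := by simp
  rw [feFactor, norm_mul, norm_mul _ χ.rootNumber, Complex.norm_natCast_cpow_of_pos (NeZero.pos N),
    h]
  gcongr
  exact mul_le_of_le_one_right (by positivity) (norm_rootNumber_le_one hχ)

lemma exists_norm_feFactor_left_le (m : ℕ) :
    ∃ C, 0 ≤ C ∧ ∀ {N : ℕ} [NeZero N] {χ : DirichletCharacter ℂ N}, χ.IsPrimitive →
      ∀ (κ : ℝ) (z : ℂ), (κ = 0 ∨ κ = 1) → z.re = 1 / 2 - m →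
      ‖feFactor χ κ z‖ ≤ C * (N * (1 + |z.im|)) ^ m := by
  obtain ⟨C, hC, h⟩ := exists_norm_Gammaℝ_div_left_le m
  refine ⟨C, hC, fun {N} _ {χ} hχ κ z hκ hz => (norm_feFactor_le hχ κ z).trans ?_⟩
  rw [hz, sub_sub_cancel, Real.rpow_natCast, mul_pow]
  calc _ ≤ (N : ℝ) ^ m * (C * (1 + |z.im|) ^ m) := by
        gcongr
        exact h κ z hκ hz
    _ = _ := by ring

lemma exists_norm_feFactor_right_le {δ : ℝ} (hδ : 0 < δ) (hδ2 : δ < 1 / 2) :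
    ∃ C, 0 ≤ C ∧ ∀ {N : ℕ} [NeZero N] {χ : DirichletCharacter ℂ N}, χ.IsPrimitive →
      ∀ (κ : ℝ) (z : ℂ), (κ = 0 ∨ κ = 1) → z.re = 1 / 2 + δ → ‖feFactor χ κ z‖ ≤ C := by
  obtain ⟨C, hC, h⟩ := exists_norm_Gammaℝ_div_right_le hδ hδ2
  refine ⟨C, hC, fun {N} _ {χ} hχ κ z hκ hz => (norm_feFactor_le hχ κ z).trans ?_⟩
  have hN : (1 : ℝ) ≤ N := by exact_mod_cast NeZero.pos N
  calc _ ≤ 1 * C := by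
        gcongr
        · exact Real.rpow_le_one_of_one_le_of_nonpos hN (by rw [hz]; linarith)
        · exact h κ z hκ hz
    _ = _ := one_mul _

lemma differentiableOn_feFactor {N : ℕ} [NeZero N] (χ : DirichletCharacter ℂ N) {κ : ℝ}
    (hκ : 0 ≤ κ) : DifferentiableOn ℂ (feFactor χ κ) {z | z.re < 1} := by
  have hN : (N : ℂ) ≠ 0 := NeZero.ne _
  unfold feFactor
  refine DifferentiableOn.mul (DifferentiableOn.mul_const ?_ _) (DifferentiableOn.mul ?_ ?_)
  · exact (Differentiable.const_cpow (by fun_prop) (Or.inl hN)).differentiableOn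
  · intro z hz
    have hpos : 0 < (1 - z + κ).re := by
      have : z.re < 1 := hz
      simp
      linarith
    have h1 : DifferentiableAt ℂ (fun z => ((Complex.Gammaℝ (1 - z + κ))⁻¹)⁻¹) z := by
      refine DifferentiableAt.inv ?_ (inv_ne_zero (Complex.Gammaℝ_ne_zero_of_re_pos hpos))
      exact (Complex.differentiable_Gammaℝ_inv.comp
        (by fun_prop : Differentiable ℂ fun z : ℂ => 1 - z + κ)) z
    simp only [inv_inv] at h1
    exact h1.differentiableWithinAt
  · exact (Complex.differentiable_Gammaℝ_inv.comp
      (by fun_prop : Differentiable ℂ fun z : ℂ => z + κ)).differentiableOn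

lemma hasStripGrowth_feFactor {N : ℕ} [NeZero N] (χ : DirichletCharacter ℂ N) {κ a b : ℝ}
    (hκ : 0 ≤ κ) (hb : b < 1) : HasStripGrowth (feFactor χ κ) a b := by
  have hN : (0 : ℝ) < N := by exact_mod_cast NeZero.pos N
  have h1 : HasStripGrowth (fun z => (N : ℂ) ^ (1 / 2 - z)) a b := by
    refine ((HasStripGrowth.const_cpow hN (1 / 2 - b) (1 / 2 - a)).comp_affine (a' := a) (b' := b)
      (-1) (1 / 2 : ℝ) (by intro x h1 h2; constructor <;> simp <;> linarith)).congr fun z _ _ => ?_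
    congr 1
    push_cast
    ring
  have h2 : HasStripGrowth (fun z => Complex.Gammaℝ (1 - z + κ)) a b := by
    refine ((hasStripGrowth_Gammaℝ (a := 1 - b + κ) (by linarith) (1 - a + κ)).comp_affine
      (a' := a) (b' := b) (-1) (1 + κ : ℝ)
      (by intro x h1 h2; constructor <;> simp <;> linarith)).congr fun z _ _ => ?_
    congr 1
    push_cast
    ring
  have h3 : HasStripGrowth (fun z => (Complex.Gammaℝ (z + κ))⁻¹) a b := by
    refine ((hasStripGrowth_inv_Gammaℝ (a + κ) (b + κ)).comp_affine
      (a' := a) (b' := b) 1 κ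
      (by intro x h1 h2; constructor <;> simp <;> linarith)).congr fun z _ _ => ?_
    congr 2
    push_cast
    ring
  exact (h1.mul (.const _)).mul (h2.mul h3)

lemma integrable_gaussian_mul_norm_dirichletPoly {N : ℕ} (χ : DirichletCharacter ℂ N) (Y : ℕ)
    (σ t : ℝ) : Integrable fun v : ℝ =>
      Real.exp (-v ^ 2) * ‖dirichletPoly χ Y (σ + (t + v : ℝ) * I)‖ := by
  have hc : Continuous fun v : ℝ => dirichletPoly χ Y (σ + (t + v : ℝ) * I) :=
    (differentiable_dirichletPoly χ Y).continuous.comp (by fun_prop)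
  have h1 : Integrable fun v : ℝ => Real.exp (-v ^ 2) := by
    simpa using integrable_exp_neg_mul_sq one_pos
  refine h1.mul_bdd (c := ∑ n ∈ Finset.Icc 1 Y, (n : ℝ) ^ (-σ)) hc.norm.aestronglyMeasurable
    (.of_forall fun v => ?_)
  rw [norm_norm]
  simpa using norm_dirichletPoly_le χ Y (σ + (t + v : ℝ) * I)

end DirichletCharacter

lemma one_add_abs_pow_mul_exp_neg_sq_le (m : ℕ) (v : ℝ) :
    (1 + |v|) ^ m * Real.exp (-v ^ 2) ≤
      Real.exp ((m : ℝ) ^ 2 / 2) * Real.exp (-(1 / 2) * v ^ 2) := by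
  refine le_trans ?_ (exp_mul_exp_neg_sq_le m v)
  refine mul_le_mul_of_nonneg_right ?_ (Real.exp_pos _).le
  rw [Real.exp_nat_mul]
  gcongr
  linarith [Real.add_one_le_exp |v|]

lemma mul_add_mul_add_le {P Q R a x : ℝ} (hP : 0 ≤ P) (hQ : 0 ≤ Q) (hR : 0 ≤ R) (ha : 0 ≤ a)
    (hx : 0 ≤ x) : P * a + Q * x + R ≤ (P + Q + R) * (a + x + 1) := by
  nlinarith [mul_nonneg hP hx, mul_nonneg hQ ha, mul_nonneg hR ha, mul_nonneg hR hx]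

namespace DirichletCharacter

/-- Contour-shift identity expressing `L(s)` through partial sums of the Dirichlet series. -/
lemma two_pi_mul_LFunction_sub_eq {N : ℕ} [NeZero N] {χ : DirichletCharacter ℂ N} (hχ : χ ≠ 1)
    (Y : ℕ) {m : ℕ} (hm : 1 ≤ m) {δ κ X : ℝ} (hδ : 0 < δ) (hδ2 : δ < 1 / 2) (hκ : 0 ≤ κ)
    (hX : 0 < X) {s : ℂ} (hs : s.re = 1 / 2) :
    2 * Real.pi * (χ.LFunction s - dirichletPoly χ Y s -
      feFactor χ κ s * dirichletPoly χ⁻¹ Y (1 - s)) =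
    (∫ v : ℝ, (χ.LFunction (s + ((m : ℝ) + v * I)) - dirichletPoly χ Y (s + ((m : ℝ) + v * I))) *
      smoothKernel X ((m : ℝ) + v * I)) -
    (∫ v : ℝ, (χ.LFunction (s + ((-m : ℝ) + v * I)) - feFactor χ κ (s + ((-m : ℝ) + v * I)) *
      dirichletPoly χ⁻¹ Y (1 - (s + ((-m : ℝ) + v * I)))) * smoothKernel X ((-m : ℝ) + v * I)) +
    (∫ v : ℝ, dirichletPoly χ Y (s + ((-δ : ℝ) + v * I)) * smoothKernel X ((-δ : ℝ) + v * I)) -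
    ∫ v : ℝ, (feFactor χ κ (s + (δ + v * I)) * dirichletPoly χ⁻¹ Y (1 - (s + (δ + v * I)))) *
      smoothKernel X (δ + v * I) := by
  have hm0 : (0 : ℝ) < m := by exact_mod_cast hm
  have hm1 : (1 : ℝ) ≤ m := by exact_mod_cast hm
  have hLd : Differentiable ℂ fun w => χ.LFunction (s + w) :=
    (differentiable_LFunction hχ).comp (by fun_prop)
  have hAd : Differentiable ℂ fun w => dirichletPoly χ Y (s + w) :=
    (differentiable_dirichletPoly χ Y).comp (by fun_prop)
  have hGd : DifferentiableOn ℂ (fun w => feFactor χ κ (s + w) *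
      dirichletPoly χ⁻¹ Y (1 - (s + w))) {w | (-m : ℝ) ≤ w.re ∧ w.re ≤ δ} := by
    refine DifferentiableOn.mul ?_ ((differentiable_dirichletPoly χ⁻¹ Y).comp
      (by fun_prop)).differentiableOn
    refine (differentiableOn_feFactor χ hκ).comp (by fun_prop) fun w hw => ?_
    simp only [Set.mem_ofPred_eq, add_re, hs]
    linarith [hw.2]
  have shift : ∀ {f : ℂ → ℂ} {a b : ℝ}, HasStripGrowth f (1 / 2 + a) (1 / 2 + b) →
      HasStripGrowth (fun w => f (s + w)) a b := by
    intro f a b h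
    refine (h.comp_affine (a' := a) (b' := b) 1 s
      (by intro x h1 h2; rw [hs]; constructor <;> linarith)).congr fun w _ _ => ?_
    congr 1
    push_cast
    ring
  have hLg : HasStripGrowth (fun w => χ.LFunction (s + w)) (-m : ℝ) m :=
    shift (hasStripGrowth_LFunction hχ _ _)
  have hAg : ∀ a b, HasStripGrowth (fun w => dirichletPoly χ Y (s + w)) a b :=
    fun a b => shift (hasStripGrowth_dirichletPoly χ Y _ _)
  have hGg : HasStripGrowth (fun w => feFactor χ κ (s + w) *
      dirichletPoly χ⁻¹ Y (1 - (s + w))) (-m : ℝ) δ := by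
    refine shift (f := fun z => feFactor χ κ z * dirichletPoly χ⁻¹ Y (1 - z)) ?_
    refine (hasStripGrowth_feFactor χ hκ (by linarith)).mul ?_
    refine ((hasStripGrowth_dirichletPoly χ⁻¹ Y (1 / 2 - δ) (1 / 2 + m)).comp_affine
      (-1) (1 : ℝ) (by intro x h1 h2; constructor <;> simp <;> linarith)).congr fun z _ _ => ?_
    congr 1
    push_cast
    ring
  have hnm : (-m : ℝ) < 0 := by linarith
  have hnδ : -δ < 0 := by linarith
  have e1 := two_pi_mul_eq_integral_smoothKernel hX hnm hm0 hLd.differentiableOn hLg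
  have e2 := two_pi_mul_eq_integral_smoothKernel hX hnδ hm0 hAd.differentiableOn (hAg _ _)
  have e3 := two_pi_mul_eq_integral_smoothKernel hX hnm hδ hGd hGg
  have i1 := integrable_mul_smoothKernel hX hm0.ne' (by linarith) le_rfl hLd.continuous.continuousOn hLg
  have i2 := integrable_mul_smoothKernel hX hm0.ne' (by linarith) le_rfl hAd.continuous.continuousOn
    (hAg (-δ) m)
  have i3 := integrable_mul_smoothKernel hX hnm.ne le_rfl (by linarith)
    hLd.continuous.continuousOn hLg
  have i4 := integrable_mul_smoothKernel hX hnm.ne le_rfl (by linarith) hGd.continuousOn hGg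
  simp only [add_zero] at e1 e2 e3
  simp_rw [sub_mul]
  rw [integral_sub i1 i2, integral_sub i3 i4, mul_sub, mul_sub, e1, e2, e3]
  ring

lemma norm_le_of_two_pi_mul_sub_eq {L A B I₁ I₂ I₃ I₄ : ℂ} {b₁ b₂ b₃ b₄ c : ℝ}
    (h : 2 * (Real.pi : ℂ) * (L - A - B) = I₁ - I₂ + I₃ - I₄) (h₁ : ‖I₁‖ ≤ b₁) (h₂ : ‖I₂‖ ≤ b₂)
    (h₃ : ‖I₃‖ ≤ b₃) (h₄ : ‖I₄‖ ≤ b₄) (hB : ‖B‖ ≤ c * ‖A‖) :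
    ‖L‖ ≤ (1 + c) * ‖A‖ + (b₁ + b₂ + b₃ + b₄) := by
  have h5 : ‖L - A - B‖ ≤ ‖2 * (Real.pi : ℂ) * (L - A - B)‖ := by
    rw [norm_mul, norm_mul, Complex.norm_ofNat, Complex.norm_real,
      Real.norm_of_nonneg Real.pi_pos.le]
    exact le_mul_of_one_le_left (norm_nonneg _) (by linarith [Real.pi_gt_three])
  rw [h] at h5
  have h6 : ‖I₁ - I₂ + I₃ - I₄‖ ≤ ‖I₁‖ + ‖I₂‖ + ‖I₃‖ + ‖I₄‖ :=
    (norm_sub_le _ _).trans (add_le_add ((norm_add_le _ _).trans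
      (add_le_add (norm_sub_le _ _) le_rfl)) le_rfl)
  have h7 : ‖L‖ ≤ ‖L - A - B‖ + ‖A‖ + ‖B‖ := by
    calc ‖L‖ = ‖(L - A - B) + A + B‖ := by congr 1; ring
      _ ≤ _ := norm_add₃_le
  linarith

set_option maxHeartbeats 800000 in
/-- A pointwise bound for `L(1/2 + it, χ)` through short partial sums of its Dirichlet series. -/
lemma exists_norm_LFunction_le {m : ℕ} (hm : 1 ≤ m) {δ : ℝ} (hδ : 0 < δ) (hδ2 : δ < 1 / 2) :
    ∃ C, 0 ≤ C ∧ ∀ {N : ℕ} [NeZero N] {χ : DirichletCharacter ℂ N}, χ.IsPrimitive → N ≠ 1 →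
      ∀ (Y : ℕ) (X t : ℝ), 1 ≤ Y → 1 ≤ X → X ^ m ≤ (Y : ℝ) ^ (m - 1) →
      N * (1 + |t|) ≤ 2 * X ^ 2 →
      ‖χ.LFunction (1 / 2 + t * I)‖ ≤ C * (‖dirichletPoly χ Y ((1 / 2 : ℝ) + t * I)‖ +
        X ^ δ * (∫ v : ℝ, Real.exp (-v ^ 2) *
          ‖dirichletPoly χ Y ((1 / 2 - δ : ℝ) + (t + v : ℝ) * I)‖) + 1) := by
  obtain ⟨C₀, hC₀, h₀⟩ := exists_norm_feFactor_left_le 0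
  obtain ⟨C₁, hC₁, h₁⟩ := exists_norm_feFactor_left_le m
  obtain ⟨C₂, hC₂, h₂⟩ := exists_norm_feFactor_right_le hδ hδ2
  set Z : ℝ := ∑' n : ℕ, (n : ℝ) ^ (-(3 / 2) : ℝ)
  have hZ : 0 ≤ Z := tsum_nonneg fun _ => by positivity
  set G : ℝ := ∫ v : ℝ, Real.exp (-(1 / 2) * v ^ 2)
  have hG : 0 ≤ G := integral_nonneg fun _ => (Real.exp_pos _).le
  have hGi : Integrable fun v : ℝ => Real.exp (-(1 / 2) * v ^ 2) :=
    integrable_exp_neg_mul_sq (by norm_num)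
  set E : ℝ := Real.exp ((m : ℝ) ^ 2) * |(m : ℝ)|⁻¹
  set D : ℝ := Real.exp (δ ^ 2) * |δ|⁻¹
  set F : ℝ := Real.exp ((m : ℝ) ^ 2 / 2)
  have hm0 : (0 : ℝ) < m := by exact_mod_cast hm
  refine ⟨1 + C₀ + (1 + C₂) * D + Z * E * G + C₁ * 2 ^ m * Z * E * F * G, by positivity, ?_⟩
  intro N _ χ hχ hN Y X t hY hX hXY hNt
  have hX0 : 0 < X := by linarith
  have hY0 : (0 : ℝ) < Y := by exact_mod_cast hY
  have hχ1 : χ ≠ 1 := by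
    rintro rfl
    exact hN (by rw [← hχ, conductor_one])
  have hN0 : (0 : ℝ) < N := by exact_mod_cast NeZero.pos N
  obtain ⟨κ, hκ, hfe⟩ := hχ.exists_LFunction_eq hN
  have hκ0 : 0 ≤ κ := by rcases hκ with rfl | rfl <;> simp
  set s : ℂ := 1 / 2 + t * I with hsdef
  have hs : s.re = 1 / 2 := by simp [s]
  have hsim : s.im = t := by simp [s]
  have hs' : s = (1 / 2 : ℝ) + t * I := by rw [hsdef]; push_cast; rfl
  have hid := two_pi_mul_LFunction_sub_eq hχ1 Y hm hδ hδ2 hκ0 hX0 hs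
  set J : ℝ := ∫ v : ℝ, Real.exp (-v ^ 2) *
    ‖dirichletPoly χ Y ((1 / 2 - δ : ℝ) + (t + v : ℝ) * I)‖
  have hJi := integrable_gaussian_mul_norm_dirichletPoly χ Y (1 / 2 - δ) t
  have hJ : 0 ≤ J := integral_nonneg fun _ => by positivity
  have hXδ : 1 ≤ X ^ δ := Real.one_le_rpow hX hδ.le
  have hYX : X ^ m * ((Y : ℝ) ^ (m - 1))⁻¹ ≤ 1 := by
    rw [← div_eq_mul_inv, div_le_one (by positivity)]; exact hXY
  have hright : ‖∫ v : ℝ, (χ.LFunction (s + ((m : ℝ) + v * I)) -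
      dirichletPoly χ Y (s + ((m : ℝ) + v * I))) * smoothKernel X ((m : ℝ) + v * I)‖ ≤
      Z * E * G := by
    rw [← integral_const_mul]
    refine norm_integral_le_of_norm_le (hGi.const_mul _) (.of_forall fun v => ?_)
    have h1 := norm_LFunction_sub_dirichletPoly_le χ hY hm
      (s := s + ((m : ℝ) + v * I)) (by simp [hs])
    have h2 := norm_smoothKernel_le hX0 hm0.ne' v
    rw [Real.rpow_natCast] at h2
    rw [norm_mul]
    calc _ ≤ (Z * ((Y : ℝ) ^ (m - 1))⁻¹) *
          (X ^ m * Real.exp ((m : ℝ) ^ 2) * |(m : ℝ)|⁻¹ * Real.exp (-v ^ 2)) := by gcongr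
      _ = Z * E * (X ^ m * ((Y : ℝ) ^ (m - 1))⁻¹) * Real.exp (-v ^ 2) := by simp only [E]; ring
      _ ≤ Z * E * 1 * Real.exp (-(1 / 2) * v ^ 2) := by
          gcongr
          nlinarith [sq_nonneg v]
      _ = _ := by ring
  have hleft : ‖∫ v : ℝ, (χ.LFunction (s + ((-m : ℝ) + v * I)) -
      feFactor χ κ (s + ((-m : ℝ) + v * I)) * dirichletPoly χ⁻¹ Y (1 - (s + ((-m : ℝ) + v * I)))) *
      smoothKernel X ((-m : ℝ) + v * I)‖ ≤ C₁ * 2 ^ m * Z * E * F * G := by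
    rw [← integral_const_mul]
    refine norm_integral_le_of_norm_le (hGi.const_mul _) (.of_forall fun v => ?_)
    set z : ℂ := s + ((-m : ℝ) + v * I)
    have hz : z.re = 1 / 2 - m := by simp [z, hs]; ring
    have hzim : z.im = t + v := by simp [z, hsim]
    have h1 := norm_LFunction_sub_dirichletPoly_le χ⁻¹ hY hm
      (s := 1 - z) (by rw [sub_re, hz, one_re]; ring)
    have h2 := norm_smoothKernel_le hX0 (neg_ne_zero.mpr hm0.ne') v
    rw [Real.rpow_neg hX0.le, Real.rpow_natCast, neg_sq, abs_neg] at h2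
    have h3 := h₁ hχ κ z hκ hz
    have hL : χ.LFunction z = feFactor χ κ z * χ⁻¹.LFunction (1 - z) :=
      hfe z (by rw [hz]; linarith)
    have h4 : (N : ℝ) * (1 + |z.im|) ≤ 2 * X ^ 2 * (1 + |v|) := by
      rw [hzim]
      calc (N : ℝ) * (1 + |t + v|) ≤ N * ((1 + |t|) * (1 + |v|)) := by
            gcongr
            nlinarith [abs_add_le t v, abs_nonneg t, abs_nonneg v, mul_nonneg (abs_nonneg t) (abs_nonneg v)]
        _ = (N * (1 + |t|)) * (1 + |v|) := by ring
        _ ≤ _ := by gcongr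
    rw [norm_mul, hL, ← mul_sub, norm_mul]
    calc _ ≤ (C₁ * (2 * X ^ 2 * (1 + |v|)) ^ m) * (Z * ((Y : ℝ) ^ (m - 1))⁻¹) *
          ((X ^ m)⁻¹ * Real.exp ((m : ℝ) ^ 2) * |(m : ℝ)|⁻¹ * Real.exp (-v ^ 2)) := by
          gcongr
          exact h3.trans (by gcongr)
      _ = C₁ * 2 ^ m * Z * E * (X ^ m * ((Y : ℝ) ^ (m - 1))⁻¹) *
          ((1 + |v|) ^ m * Real.exp (-v ^ 2)) := by
          simp only [E]; rw [mul_pow, mul_pow, ← pow_mul, mul_comm 2 m, pow_mul]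
          field_simp
      _ ≤ C₁ * 2 ^ m * Z * E * 1 * (F * Real.exp (-(1 / 2) * v ^ 2)) := by
          gcongr ?_ * ?_
          · gcongr
          · exact one_add_abs_pow_mul_exp_neg_sq_le m v
      _ = _ := by ring
  have hmid1 : ‖∫ v : ℝ, dirichletPoly χ Y (s + ((-δ : ℝ) + v * I)) *
      smoothKernel X ((-δ : ℝ) + v * I)‖ ≤ D * (X ^ δ * J) := by
    rw [← mul_assoc, ← integral_const_mul]
    refine norm_integral_le_of_norm_le (hJi.const_mul _) (.of_forall fun v => ?_)
    have h2 := norm_smoothKernel_le hX0 (neg_ne_zero.mpr hδ.ne') v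
    rw [neg_sq, abs_neg] at h2
    have h3 : X ^ (-δ) ≤ X ^ δ := Real.rpow_le_rpow_of_exponent_le hX (by linarith)
    have h4 : s + ((-δ : ℝ) + v * I) = (1 / 2 - δ : ℝ) + (t + v : ℝ) * I := by
      rw [hsdef]; push_cast; ring
    rw [norm_mul, h4]
    calc _ ≤ ‖dirichletPoly χ Y ((1 / 2 - δ : ℝ) + (t + v : ℝ) * I)‖ *
          (X ^ δ * Real.exp (δ ^ 2) * |δ|⁻¹ * Real.exp (-v ^ 2)) := by
          gcongr
          exact h2.trans (by gcongr)
      _ = _ := by simp only [D]; ring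
  have hmid2 : ‖∫ v : ℝ, (feFactor χ κ (s + (δ + v * I)) *
      dirichletPoly χ⁻¹ Y (1 - (s + (δ + v * I)))) * smoothKernel X (δ + v * I)‖ ≤
      C₂ * D * (X ^ δ * J) := by
    rw [← mul_assoc, ← integral_const_mul]
    refine norm_integral_le_of_norm_le (hJi.const_mul _) (.of_forall fun v => ?_)
    have h2 := norm_smoothKernel_le hX0 hδ.ne' v
    have h4 : (starRingEnd ℂ) (1 - (s + (δ + v * I))) = (1 / 2 - δ : ℝ) + (t + v : ℝ) * I := by
      rw [hsdef]
      apply Complex.ext <;> simp <;> ring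
    have h3 := h₂ hχ κ (s + (δ + v * I)) hκ (by simp [hs])
    rw [norm_mul, norm_mul, norm_dirichletPoly_inv, h4]
    calc _ ≤ C₂ * ‖dirichletPoly χ Y ((1 / 2 - δ : ℝ) + (t + v : ℝ) * I)‖ *
          (X ^ δ * Real.exp (δ ^ 2) * |δ|⁻¹ * Real.exp (-v ^ 2)) := by
          gcongr
      _ = _ := by simp only [D]; ring
  have hdual : ‖feFactor χ κ s * dirichletPoly χ⁻¹ Y (1 - s)‖ ≤
      C₀ * ‖dirichletPoly χ Y ((1 / 2 : ℝ) + t * I)‖ := by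
    have h4 : (starRingEnd ℂ) (1 - s) = (1 / 2 : ℝ) + t * I := by
      rw [hsdef]
      apply Complex.ext <;> norm_num
    have h3 := h₀ hχ κ s hκ (by simp [hs])
    rw [pow_zero, mul_one] at h3
    rw [norm_mul, norm_dirichletPoly_inv, h4]
    gcongr
  rw [← hs'] at hdual ⊢
  have hXJ : 0 ≤ X ^ δ * J := mul_nonneg (by linarith) hJ
  have hcomb := norm_le_of_two_pi_mul_sub_eq hid hright hleft hmid1 hmid2 hdual
  have p1 : 0 ≤ (1 + C₂) * D := by positivity
  have p2 : 0 ≤ Z * E * G + C₁ * 2 ^ m * Z * E * F * G := by positivity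
  have p3 : 0 ≤ 1 + C₀ := by positivity
  have hsum := mul_add_mul_add_le p3 p1 p2 (norm_nonneg (dirichletPoly χ Y s)) hXJ
  clear_value Z G E D F J
  refine le_trans (hcomb.trans_eq ?_) (hsum.trans_eq ?_)
  · ring
  · ring

end DirichletCharacter

lemma integrable_exp_neg_sq : Integrable fun v : ℝ => Real.exp (-v ^ 2) := by
  simpa using integrable_exp_neg_mul_sq one_pos

lemma integral_exp_neg_sq : ∫ v : ℝ, Real.exp (-v ^ 2) = √Real.pi := by
  simpa using integral_gaussian 1

lemma integrable_mul_bounded_continuous {g f : ℝ → ℝ} (hg : Integrable g) (hf : Continuous f)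
    {M : ℝ} (hM : ∀ x, |f x| ≤ M) : Integrable fun x => g x * f x :=
  hg.mul_bdd (c := M) hf.aestronglyMeasurable (.of_forall hM)

lemma pow_tangent_le {c x : ℝ} (hc : 0 < c) (hx : 0 ≤ x) (n : ℕ) :
    c ^ n + n * c ^ (n - 1) * (x - c) ≤ x ^ n := by
  rcases n with _ | n
  · simp
  have h := one_add_mul_le_pow (a := x / c - 1)
    (by have : 0 ≤ x / c := by positivity
        linarith) (n + 1)
  have h2 := mul_le_mul_of_nonneg_left h (pow_pos hc (n + 1)).le
  rw [← mul_pow, add_sub_cancel, mul_div_cancel₀ _ hc.ne'] at h2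
  refine le_trans (le_of_eq ?_) h2
  rw [Nat.add_sub_cancel]
  push_cast
  field_simp
  ring

/-- Jensen's inequality for powers with respect to the Gaussian weight. -/
lemma pow_integral_exp_neg_sq_mul_le {f : ℝ → ℝ} (hf : Continuous f) (hf0 : ∀ x, 0 ≤ f x) {M : ℝ}
    (hM : ∀ x, |f x| ≤ M) {n : ℕ} (hn : n ≠ 0) :
    (∫ v : ℝ, Real.exp (-v ^ 2) * f v) ^ n ≤
      √Real.pi ^ n * ∫ v : ℝ, Real.exp (-v ^ 2) * f v ^ n := by
  set J := ∫ v : ℝ, Real.exp (-v ^ 2) * f v with hJ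
  have hJ0 : 0 ≤ J := integral_nonneg fun v => mul_nonneg (Real.exp_pos _).le (hf0 v)
  have hK0 : 0 ≤ ∫ v : ℝ, Real.exp (-v ^ 2) * f v ^ n :=
    integral_nonneg fun v => mul_nonneg (Real.exp_pos _).le (pow_nonneg (hf0 v) n)
  have hW : 1 ≤ √Real.pi := by
    rw [Real.one_le_sqrt]; linarith [Real.pi_gt_three]
  rcases hJ0.eq_or_lt with h | h
  · rw [← h, zero_pow hn]; positivity
  have hW0 : 0 < √Real.pi := by linarith
  set c := J / √Real.pi with hc
  have hc0 : 0 < c := by positivity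
  have hfi := integrable_mul_bounded_continuous integrable_exp_neg_sq hf hM
  have hfni : Integrable fun v : ℝ => Real.exp (-v ^ 2) * f v ^ n :=
    integrable_mul_bounded_continuous integrable_exp_neg_sq (hf.pow n) (M := M ^ n) fun x => by
      rw [abs_pow]; exact pow_le_pow_left₀ (abs_nonneg _) (hM x) n
  have key : √Real.pi * c ^ n ≤ ∫ v : ℝ, Real.exp (-v ^ 2) * f v ^ n := by
    have e : (∫ v : ℝ, ((c ^ n - n * c ^ (n - 1) * c) * Real.exp (-v ^ 2) +
        n * c ^ (n - 1) * (Real.exp (-v ^ 2) * f v))) = √Real.pi * c ^ n := by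
      rw [integral_add (integrable_exp_neg_sq.const_mul _) (hfi.const_mul _), integral_const_mul,
        integral_const_mul, integral_exp_neg_sq, ← hJ]
      have : J = c * √Real.pi := by rw [hc]; field_simp
      rw [this]; ring
    rw [← e]
    refine integral_mono ((integrable_exp_neg_sq.const_mul _).add (hfi.const_mul _)) hfni
      fun v => ?_
    have := mul_le_mul_of_nonneg_left (pow_tangent_le hc0 (hf0 v) n) (Real.exp_pos (-v ^ 2)).le
    refine le_trans (le_of_eq ?_) this
    ring
  have hJc : J = √Real.pi * c := by rw [hc]; field_simp
  rw [hJc, mul_pow]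
  gcongr
  refine le_trans ?_ key
  exact le_mul_of_one_le_left (by positivity) hW

lemma intervalIntegral_le_exp_mul_integral_gaussian {g : ℝ → ℝ} (hg : Continuous g)
    (hg0 : ∀ x, 0 ≤ g x) {M : ℝ} (hM : ∀ x, |g x| ≤ M) {S : ℝ} (hS : 1 ≤ S) :
    ∫ t in (0 : ℝ)..S, g t ≤
      Real.exp 1 * ∫ u : ℝ, Real.exp (-((2 * S) ^ 2)⁻¹ * u ^ 2) * g u := by
  have hS0 : 0 < S := by linarith
  have hi : Integrable fun u : ℝ => Real.exp (-((2 * S) ^ 2)⁻¹ * u ^ 2) * g u :=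
    integrable_mul_bounded_continuous (integrable_exp_neg_mul_sq (by positivity)) hg hM
  rw [intervalIntegral.integral_of_le hS0.le, ← integral_const_mul]
  refine le_trans ?_ (setIntegral_le_integral (s := Set.Ioc 0 S) (hi.const_mul _)
    (.of_forall fun u => by have := hg0 u; simp only [Pi.zero_apply]; positivity))
  refine setIntegral_mono_on hg.integrableOn_Ioc (hi.const_mul _).integrableOn
    measurableSet_Ioc fun t ht => ?_
  rw [← mul_assoc, ← Real.exp_add]
  refine le_mul_of_one_le_left (hg0 t) (Real.one_le_exp ?_)
  have h1 : ((2 * S) ^ 2)⁻¹ * t ^ 2 ≤ 1 := by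
    rw [inv_mul_le_iff₀ (by positivity)]
    nlinarith [ht.1, ht.2]
  linarith

lemma intervalIntegral_integral_gaussian_le {g : ℝ → ℝ} (hg : Continuous g)
    (hg0 : ∀ x, 0 ≤ g x) {M : ℝ} (hM : ∀ x, |g x| ≤ M) {S : ℝ} (hS : 1 ≤ S) :
    ∫ t in (0 : ℝ)..S, ∫ v : ℝ, Real.exp (-v ^ 2) * g (t + v) ≤
      Real.exp 1 * √(2 * Real.pi) * ∫ u : ℝ, Real.exp (-((2 * S) ^ 2)⁻¹ * u ^ 2) * g u := by
  have hS0 : 0 < S := by linarith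
  set h : ℝ → ℝ := fun u => Real.exp (-((2 * S) ^ 2)⁻¹ * u ^ 2) * g u with hh
  have hi : Integrable h :=
    integrable_mul_bounded_continuous (integrable_exp_neg_mul_sq (by positivity)) hg hM
  have hc : Continuous h := by fun_prop
  have hh0 : ∀ u, 0 ≤ h u := fun u => mul_nonneg (Real.exp_pos _).le (hg0 u)
  have hhM : ∀ u, |h u| ≤ M := fun u => by
    rw [hh, abs_mul, abs_of_pos (Real.exp_pos _)]
    refine (mul_le_of_le_one_left (abs_nonneg _) (Real.exp_le_one_iff.mpr ?_)).trans (hM u)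
    have : 0 ≤ ((2 * S) ^ 2)⁻¹ * u ^ 2 := by positivity
    linarith
  have hgauss : Integrable fun v : ℝ => Real.exp (-(1 / 2) * v ^ 2) :=
    integrable_exp_neg_mul_sq (by norm_num)
  rw [intervalIntegral.integral_of_le hS0.le]
  set μ := volume.restrict (Set.Ioc 0 S)
  have hone : Integrable (fun _ : ℝ => (1 : ℝ)) μ := integrable_const _
  have hprod : Integrable (fun p : ℝ × ℝ => Real.exp (-(1 / 2) * p.2 ^ 2) * h (p.1 + p.2))
      (μ.prod volume) := by
    have := hone.mul_prod hgauss
    simp only [one_mul] at this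
    exact this.mul_bdd (c := M) (by fun_prop) (.of_forall fun p => hhM _)
  have hpt : ∀ t ∈ Set.Ioc 0 S, ∫ v : ℝ, Real.exp (-v ^ 2) * g (t + v) ≤
      Real.exp 1 * ∫ v : ℝ, Real.exp (-(1 / 2) * v ^ 2) * h (t + v) := by
    intro t ht
    rw [← integral_const_mul]
    refine integral_mono
      (integrable_mul_bounded_continuous integrable_exp_neg_sq (by fun_prop) fun _ => hM _)
      ((integrable_mul_bounded_continuous hgauss (by fun_prop) fun _ => hhM _).const_mul _)
      fun v => ?_
    simp only [hh]
    rw [← mul_assoc, ← mul_assoc, ← Real.exp_add, ← Real.exp_add]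
    refine mul_le_mul_of_nonneg_right (Real.exp_le_exp.mpr ?_) (hg0 _)
    have h1 : ((2 * S) ^ 2)⁻¹ * (t + v) ^ 2 ≤ 1 / 2 + v ^ 2 / 2 := by
      rw [inv_mul_le_iff₀ (by positivity)]
      have : 1 ≤ S ^ 2 := by nlinarith
      have h3 : t ^ 2 ≤ S ^ 2 := by nlinarith [ht.1, ht.2]
      nlinarith [sq_nonneg (t - v), mul_nonneg (sub_nonneg.mpr this) (sq_nonneg v)]
    linarith
  calc _ ≤ ∫ t, (Real.exp 1 * ∫ v : ℝ, Real.exp (-(1 / 2) * v ^ 2) * h (t + v)) ∂μ := by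
        refine integral_mono_of_nonneg (.of_forall fun t => integral_nonneg fun v =>
          mul_nonneg (Real.exp_pos _).le (hg0 _)) (hprod.integral_prod_left.const_mul _) ?_
        exact (ae_restrict_iff' measurableSet_Ioc).mpr (.of_forall hpt)
    _ = Real.exp 1 * ∫ v : ℝ, Real.exp (-(1 / 2) * v ^ 2) * ∫ t, h (t + v) ∂μ := by
        rw [integral_const_mul, integral_integral_swap hprod]
        simp_rw [integral_const_mul]
    _ ≤ Real.exp 1 * ∫ v : ℝ, Real.exp (-(1 / 2) * v ^ 2) * ∫ u, h u := by
        gcongr Real.exp 1 * ?_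
        refine integral_mono_of_nonneg (.of_forall fun v => mul_nonneg (Real.exp_pos _).le
          (integral_nonneg fun t => hh0 _)) (hgauss.mul_const _) (.of_forall fun v => ?_)
        refine mul_le_mul_of_nonneg_left ?_ (Real.exp_pos _).le
        rw [← integral_add_right_eq_self h v]
        exact setIntegral_le_integral (hi.comp_add_right v) (.of_forall fun t => hh0 _)
    _ = _ := by
        rw [integral_mul_const, integral_gaussian]
        have : Real.pi / (1 / 2) = 2 * Real.pi := by ring
        rw [this]; ring

lemma add_add_pow_le {a b c : ℝ} (ha : 0 ≤ a) (hb : 0 ≤ b) (hc : 0 ≤ c) (n : ℕ) :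
    (a + b + c) ^ n ≤ 3 ^ n * (a ^ n + b ^ n + c ^ n) := by
  have hm : a + b + c ≤ 3 * max a (max b c) := by
    linarith [le_max_left a (max b c), le_max_right a (max b c), le_max_left b c, le_max_right b c]
  refine (pow_le_pow_left₀ (by positivity) hm n).trans ?_
  rw [mul_pow]
  gcongr
  have h1 := pow_nonneg ha n
  have h2 := pow_nonneg hb n
  have h3 := pow_nonneg hc n
  rcases max_choice a (max b c) with h | h
  · rw [h]; linarith
  · rw [h]
    rcases max_choice b c with h | h <;> rw [h] <;> linarith

namespace DirichletCharacter

lemma continuous_norm_dirichletPoly_pow {N : ℕ} (χ : DirichletCharacter ℂ N) (Y : ℕ) (σ : ℝ)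
    (n : ℕ) : Continuous fun t : ℝ => ‖dirichletPoly χ Y (σ + t * I)‖ ^ n :=
  (((differentiable_dirichletPoly χ Y).continuous.comp (by fun_prop :
    Continuous fun t : ℝ => (σ : ℂ) + t * I)).norm).pow n

lemma abs_norm_dirichletPoly_pow_le {N : ℕ} (χ : DirichletCharacter ℂ N) (Y : ℕ) (σ : ℝ)
    (n : ℕ) (t : ℝ) : |‖dirichletPoly χ Y (σ + t * I)‖ ^ n| ≤
      (∑ n ∈ Finset.Icc 1 Y, (n : ℝ) ^ (-σ)) ^ n := by
  rw [abs_pow, abs_norm]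
  gcongr
  simpa using norm_dirichletPoly_le χ Y (σ + t * I)

/-- The moment of `L(1/2 + it, χ)` over `[0, S]` for primitive `χ`, bounded by Gaussian-weighted
moments of Dirichlet polynomials. -/
lemma exists_integral_norm_LFunction_pow_le {m : ℕ} (hm : 1 ≤ m) {k : ℕ} (hk : k ≠ 0) {δ : ℝ}
    (hδ : 0 < δ) (hδ2 : δ < 1 / 2) :
    ∃ C, 0 ≤ C ∧ ∀ {N : ℕ} [NeZero N] {χ : DirichletCharacter ℂ N}, χ.IsPrimitive → N ≠ 1 →
      ∀ (Y : ℕ) (X S : ℝ), 1 ≤ Y → 1 ≤ X → 1 ≤ S → X ^ m ≤ (Y : ℝ) ^ (m - 1) → N * S ≤ X ^ 2 →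
      ∫ t in (0 : ℝ)..S, ‖χ.LFunction (1 / 2 + t * I)‖ ^ (2 * k) ≤
        C * ((∫ t : ℝ, Real.exp (-((2 * S) ^ 2)⁻¹ * t ^ 2) *
            ‖dirichletPoly χ Y ((1 / 2 : ℝ) + t * I)‖ ^ (2 * k)) +
          X ^ (2 * k * δ) * (∫ t : ℝ, Real.exp (-((2 * S) ^ 2)⁻¹ * t ^ 2) *
            ‖dirichletPoly χ Y ((1 / 2 - δ : ℝ) + t * I)‖ ^ (2 * k)) + S) := by
  obtain ⟨C, hC, h⟩ := exists_norm_LFunction_le hm hδ hδ2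
  set n := 2 * k with hn
  have hn0 : n ≠ 0 := by omega
  set W : ℝ := √Real.pi ^ n with hW
  set K : ℝ := Real.exp 1 * √(2 * Real.pi) with hK
  have hK1 : Real.exp 1 ≤ K := by
    refine le_mul_of_one_le_right (Real.exp_pos _).le (Real.one_le_sqrt.mpr ?_)
    linarith [Real.pi_gt_three]
  have hW1 : 1 ≤ W := one_le_pow₀ (Real.one_le_sqrt.mpr (by linarith [Real.pi_gt_three]))
  have hK1' : 1 ≤ K := le_trans (Real.one_le_exp zero_le_one) hK1
  refine ⟨C ^ n * 3 ^ n * (W * K), by positivity, ?_⟩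
  intro N _ χ hχ hN Y X S hY hX hS hXY hNS
  have hX0 : 0 < X := by linarith
  have hS0 : 0 < S := by linarith
  have hχ1 : χ ≠ 1 := by
    rintro rfl
    exact hN (by rw [← hχ, conductor_one])
  set a : ℝ → ℝ := fun t => ‖dirichletPoly χ Y ((1 / 2 : ℝ) + t * I)‖ with ha
  set b : ℝ → ℝ := fun t => ‖dirichletPoly χ Y ((1 / 2 - δ : ℝ) + t * I)‖ with hb
  have hac : ∀ j, Continuous fun t => a t ^ j := continuous_norm_dirichletPoly_pow χ Y _
  have hbc : ∀ j, Continuous fun t => b t ^ j := continuous_norm_dirichletPoly_pow χ Y _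
  have hb1 : Continuous b := by simpa using hbc 1
  have hbM := abs_norm_dirichletPoly_pow_le χ Y (1 / 2 - δ)
  have hLc : Continuous fun t : ℝ => ‖χ.LFunction (1 / 2 + t * I)‖ ^ n :=
    (((differentiable_LFunction hχ1).continuous.comp (by fun_prop :
      Continuous fun t : ℝ => (1 / 2 : ℂ) + t * I)).norm).pow n
  have hXn : (X ^ δ) ^ n = X ^ (2 * k * δ) := by
    rw [← Real.rpow_natCast, ← Real.rpow_mul hX0.le, hn]
    congr 1; push_cast; ring
  have hpt : ∀ t ∈ Set.Icc 0 S, ‖χ.LFunction (1 / 2 + t * I)‖ ^ n ≤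
      C ^ n * 3 ^ n * (a t ^ n + X ^ (2 * k * δ) * (W * ∫ v : ℝ, Real.exp (-v ^ 2) *
        b (t + v) ^ n) + 1) := by
    intro t ht
    have h1 := h hχ hN Y X t hY hX hXY (by
      rw [abs_of_nonneg ht.1]
      have : (N : ℝ) * (1 + t) ≤ N * (2 * S) := by
        gcongr; linarith [ht.2]
      linarith)
    have hJ : 0 ≤ ∫ v : ℝ, Real.exp (-v ^ 2) * b (t + v) :=
      integral_nonneg fun v => mul_nonneg (Real.exp_pos _).le (norm_nonneg _)
    refine (pow_le_pow_left₀ (norm_nonneg _) h1 n).trans ?_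
    rw [mul_pow, mul_assoc (C ^ n)]
    refine mul_le_mul_of_nonneg_left ?_ (by positivity)
    refine (add_add_pow_le (norm_nonneg _) (mul_nonneg (by positivity) hJ) zero_le_one n).trans ?_
    rw [mul_pow, one_pow, hXn]
    gcongr
    exact pow_integral_exp_neg_sq_mul_le (f := fun v => b (t + v)) (by fun_prop)
      (fun _ => norm_nonneg _) (fun x => (by simpa only [pow_one] using hbM 1 (t + x))) hn0
  have hIc : Continuous fun t => ∫ v : ℝ, Real.exp (-v ^ 2) * b (t + v) ^ n := by
    refine continuous_of_dominated (bound := fun v => Real.exp (-v ^ 2) *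
      (∑ n ∈ Finset.Icc 1 Y, (n : ℝ) ^ (-(1 / 2 - δ))) ^ n) ?_ ?_ ?_ ?_
    · intro t
      exact (Continuous.mul (by fun_prop) ((hbc n).comp (by fun_prop))).aestronglyMeasurable
    · refine fun t => .of_forall fun v => ?_
      rw [norm_mul, Real.norm_of_nonneg (Real.exp_pos _).le]
      exact mul_le_mul_of_nonneg_left (hbM n _) (Real.exp_pos _).le
    · exact integrable_exp_neg_sq.mul_const _
    · exact .of_forall fun v => Continuous.mul (by fun_prop) ((hbc n).comp (by fun_prop))
  have i1 := (hac n).intervalIntegrable (μ := volume) 0 S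
  have i2 := ((hIc.const_mul W).const_mul (X ^ (2 * k * δ))).intervalIntegrable (μ := volume) 0 S
  have i3 := (continuous_const (y := (1 : ℝ))).intervalIntegrable (μ := volume) 0 S
  have q1 := intervalIntegral_le_exp_mul_integral_gaussian (hac n)
    (fun _ => pow_nonneg (norm_nonneg _) n) (abs_norm_dirichletPoly_pow_le χ Y (1 / 2) n) hS
  have q2 := intervalIntegral_integral_gaussian_le (hbc n)
    (fun _ => pow_nonneg (norm_nonneg _) n) (hbM n) hS
  have p1 : 0 ≤ ∫ u : ℝ, Real.exp (-((2 * S) ^ 2)⁻¹ * u ^ 2) * a u ^ n :=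
    integral_nonneg fun v => mul_nonneg (Real.exp_pos _).le (pow_nonneg (norm_nonneg _) n)
  have p2 : 0 ≤ ∫ u : ℝ, Real.exp (-((2 * S) ^ 2)⁻¹ * u ^ 2) * b u ^ n :=
    integral_nonneg fun v => mul_nonneg (Real.exp_pos _).le (pow_nonneg (norm_nonneg _) n)
  calc _ ≤ ∫ t in (0 : ℝ)..S, C ^ n * 3 ^ n * (a t ^ n + X ^ (2 * k * δ) *
        (W * ∫ v : ℝ, Real.exp (-v ^ 2) * b (t + v) ^ n) + 1) :=
        intervalIntegral.integral_mono_on hS0.le (hLc.intervalIntegrable _ _)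
          (((i1.add i2).add i3).const_mul _) hpt
    _ = C ^ n * 3 ^ n * ((∫ t in (0 : ℝ)..S, a t ^ n) + X ^ (2 * k * δ) *
        (W * ∫ t in (0 : ℝ)..S, ∫ v : ℝ, Real.exp (-v ^ 2) * b (t + v) ^ n) + S) := by
        rw [intervalIntegral.integral_const_mul, intervalIntegral.integral_add (i1.add i2) i3,
          intervalIntegral.integral_add i1 i2, intervalIntegral.integral_const_mul,
          intervalIntegral.integral_const_mul, intervalIntegral.integral_const]
        simp
    _ ≤ C ^ n * 3 ^ n * (W * K * (∫ u : ℝ, Real.exp (-((2 * S) ^ 2)⁻¹ * u ^ 2) * a u ^ n) +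
        X ^ (2 * k * δ) * (W * (K * ∫ u : ℝ, Real.exp (-((2 * S) ^ 2)⁻¹ * u ^ 2) * b u ^ n)) +
        W * K * S) := by
        gcongr
        · refine q1.trans (mul_le_mul_of_nonneg_right ?_ p1)
          exact hK1.trans (le_mul_of_one_le_left (by linarith) hW1)
        · exact le_mul_of_one_le_left hS0.le (one_le_mul_of_one_le_of_one_le hW1 hK1')
    _ = _ := by ring

end DirichletCharacter

/-- `∑_{ψ mod d} ∫₀^S |L(1/2+it,ψ)|^{2k} dt` over nontrivial primitive characters. -/
noncomputable def primitiveMoment (k d : ℕ) (S : ℝ) : ℝ :=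
  if h : d ≠ 0 then
    haveI : NeZero d := ⟨h⟩
    ∑ ψ : DirichletCharacter ℂ d, if ψ.IsPrimitive ∧ ψ ≠ 1 then
      ∫ t in (0 : ℝ)..S, ‖ψ.LFunction (1 / 2 + t * I)‖ ^ (2 * k) else 0
  else 0

lemma primitiveMoment_eq (k d : ℕ) [NeZero d] (S : ℝ) : primitiveMoment k d S =
    ∑ ψ : DirichletCharacter ℂ d, if ψ.IsPrimitive ∧ ψ ≠ 1 then
      ∫ t in (0 : ℝ)..S, ‖ψ.LFunction (1 / 2 + t * I)‖ ^ (2 * k) else 0 := by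
  rw [primitiveMoment, dif_pos (NeZero.ne d)]

/-- A suitable length of Dirichlet polynomial for the conductor size `B`. -/
lemma exists_length {k : ℕ} (hk : 1 ≤ k) {e B : ℝ} (he : 0 < e) (he1 : e ≤ 1) (hB : 1 ≤ B) :
    ∃ Y : ℕ, 1 ≤ Y ∧ (B ^ (1 / 2 : ℝ)) ^ (⌈k / e⌉₊ + 1) ≤ (Y : ℝ) ^ ⌈k / e⌉₊ ∧
      (Y : ℝ) ≤ 2 * B ∧ (Y : ℝ) ^ k ≤ 2 ^ k * (B ^ ((k : ℝ) / 2) * B ^ (e / 2)) := by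
  have hk0 : (0 : ℝ) < k := by exact_mod_cast hk
  have hB0 : 0 < B := by linarith
  set r : ℝ := 1 / 2 * (1 + e / k) with hr
  have hek : e / k ≤ 1 := by
    rw [div_le_one hk0]
    exact he1.trans (by exact_mod_cast hk)
  have hr1 : r ≤ 1 := by linarith
  have hr0 : 0 < r := by positivity
  have hBr : 1 ≤ B ^ r := Real.one_le_rpow hB hr0.le
  have hY1 := Nat.le_ceil (B ^ r)
  have hY2 : (⌈B ^ r⌉₊ : ℝ) ≤ 2 * B ^ r := by
    linarith [Nat.ceil_lt_add_one (by linarith : 0 ≤ B ^ r)]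
  refine ⟨⌈B ^ r⌉₊, ?_, ?_, ?_, ?_⟩
  · exact_mod_cast hBr.trans hY1
  · refine le_trans ?_ (pow_le_pow_left₀ (by positivity) hY1 _)
    rw [← Real.rpow_natCast, ← Real.rpow_natCast, ← Real.rpow_mul hB0.le, ← Real.rpow_mul hB0.le]
    refine Real.rpow_le_rpow_of_exponent_le hB ?_
    push_cast
    have h1 := Nat.le_ceil ((k : ℝ) / e)
    have h2 : 1 ≤ e / k * ⌈k / e⌉₊ := by
      calc 1 = e / k * (k / e) := by field_simp
        _ ≤ _ := by gcongr
    rw [hr]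
    linarith
  · refine hY2.trans ?_
    gcongr
    exact (Real.rpow_le_rpow_of_exponent_le hB hr1).trans_eq (Real.rpow_one B)
  · refine (pow_le_pow_left₀ (by positivity) hY2 k).trans_eq ?_
    rw [mul_pow, ← Real.rpow_natCast (B ^ r), ← Real.rpow_mul hB0.le, ← Real.rpow_add hB0]
    congr 2
    rw [hr]
    field_simp

lemma moment_numerics {k : ℕ} (hk : 1 ≤ k) {e B A Y C₁ : ℝ} (he : 0 < e) (hB : 1 ≤ B)
    (hA : 0 ≤ A) (hY : 0 < Y) (hC₁ : 0 ≤ C₁) (h1 : Y ≤ 2 * B)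
    (h2 : Y ^ k ≤ 2 ^ k * (B ^ ((k : ℝ) / 2) * B ^ (e / 2))) :
    C₁ * (2 * A + Y ^ k) * (Y ^ k) ^ (3 * (e / (8 * k))) +
      (B ^ (1 / 2 : ℝ)) ^ (2 * k * (e / (8 * k))) *
        (C₁ * (2 * A + Y ^ k) * (Y ^ k) ^ (3 * (e / (8 * k)))) + A ≤
    (C₁ * 2 ^ (k + 2) * 2 ^ (3 * e / 8) + 1) * ((A + B ^ ((k : ℝ) / 2)) * B ^ e) := by
  have hB0 : 0 < B := by linarith
  have hk0 : (0 : ℝ) < k := by exact_mod_cast hk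
  have a1 : (Y ^ k) ^ (3 * (e / (8 * k))) ≤ 2 ^ (3 * e / 8) * B ^ (3 * e / 8) := by
    rw [← Real.mul_rpow (by norm_num) hB0.le, ← Real.rpow_natCast, ← Real.rpow_mul hY.le]
    have : (k : ℝ) * (3 * (e / (8 * k))) = 3 * e / 8 := by field_simp
    rw [this]
    exact Real.rpow_le_rpow hY.le h1 (by positivity)
  have a2 : (B ^ (1 / 2 : ℝ)) ^ (2 * k * (e / (8 * k))) = B ^ (e / 8) := by
    rw [← Real.rpow_mul hB0.le]
    congr 1
    field_simp
  have a3 : 1 ≤ B ^ (e / 8) := Real.one_le_rpow hB (by positivity)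
  have a4 : 1 ≤ B ^ (e / 2) := Real.one_le_rpow hB (by positivity)
  have a5 : 1 ≤ B ^ e := Real.one_le_rpow hB he.le
  have a6 : 2 * A + Y ^ k ≤ 2 ^ (k + 1) * ((A + B ^ ((k : ℝ) / 2)) * B ^ (e / 2)) := by
    have b1 : (1 : ℝ) ≤ 2 ^ k := one_le_pow₀ (by norm_num)
    have b2 : 0 ≤ B ^ ((k : ℝ) / 2) * B ^ (e / 2) := by positivity
    have b3 : A ≤ 2 ^ k * (A * B ^ (e / 2)) := by
      calc A = 1 * (A * 1) := by ring
        _ ≤ _ := by gcongr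
    have b4 : 0 ≤ 2 ^ k * (B ^ ((k : ℝ) / 2) * B ^ (e / 2)) := by positivity
    calc 2 * A + Y ^ k ≤ 2 * (2 ^ k * (A * B ^ (e / 2))) +
          2 * (2 ^ k * (B ^ ((k : ℝ) / 2) * B ^ (e / 2))) := by linarith
      _ = _ := by ring
  have a7 : B ^ (e / 8) * (B ^ (e / 2) * B ^ (3 * e / 8)) = B ^ e := by
    rw [← Real.rpow_add hB0, ← Real.rpow_add hB0]
    congr 1
    ring
  have a8 : 0 ≤ A + B ^ ((k : ℝ) / 2) := by positivity
  have hYk : 0 ≤ Y ^ k := by positivity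
  rw [a2]
  set M := C₁ * (2 * A + Y ^ k) * (Y ^ k) ^ (3 * (e / (8 * k)))
  have hM : M ≤ C₁ * (2 ^ (k + 1) * ((A + B ^ ((k : ℝ) / 2)) * B ^ (e / 2))) *
      (2 ^ (3 * e / 8) * B ^ (3 * e / 8)) := by
    simp only [M]
    gcongr
  have hM0 : 0 ≤ M := by positivity
  have c1 : A ≤ (A + B ^ ((k : ℝ) / 2)) * B ^ e := by
    calc A ≤ (A + B ^ ((k : ℝ) / 2)) * 1 := by
          rw [mul_one]; exact le_add_of_nonneg_right (by positivity)
      _ ≤ _ := by gcongr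
  calc M + B ^ (e / 8) * M + A ≤ 2 * (B ^ (e / 8) * M) + A := by
        linarith [le_mul_of_one_le_left hM0 a3]
    _ ≤ 2 * (B ^ (e / 8) * (C₁ * (2 ^ (k + 1) * ((A + B ^ ((k : ℝ) / 2)) * B ^ (e / 2))) *
      (2 ^ (3 * e / 8) * B ^ (3 * e / 8)))) + (A + B ^ ((k : ℝ) / 2)) * B ^ e := by gcongr
    _ = C₁ * 2 ^ (k + 2) * 2 ^ (3 * e / 8) * ((A + B ^ ((k : ℝ) / 2)) *
        (B ^ (e / 8) * (B ^ (e / 2) * B ^ (3 * e / 8)))) +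
        (A + B ^ ((k : ℝ) / 2)) * B ^ e := by ring
    _ = _ := by rw [a7]; ring

lemma sum_card_dirichletCharacter_le (Q : ℕ) :
    ∑ i ∈ Finset.range Q, (Fintype.card (DirichletCharacter ℂ (i + 1)) : ℝ) ≤ (Q : ℝ) ^ 2 := by
  calc _ ≤ ∑ i ∈ Finset.range Q, (Q : ℝ) := by
        refine Finset.sum_le_sum fun i hi => ?_
        rw [← Nat.card_eq_fintype_card,
          DirichletCharacter.card_eq_totient_of_hasEnoughRootsOfUnity ℂ (i + 1)]
        have h1 := Nat.totient_le (i + 1)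
        have h2 := Finset.mem_range.mp hi
        exact_mod_cast h1.trans h2
    _ = _ := by simp [sq]

/-- The large-sieve moment bound restricted to primitive characters. -/
theorem exists_sum_primitiveMoment_le {k : ℕ} (hk : 1 ≤ k) {e : ℝ} (he : 0 < e) (he1 : e ≤ 1) :
    ∃ C, 0 ≤ C ∧ ∀ (Q : ℕ) (S : ℝ), 1 ≤ Q → 1 ≤ S →
      ∑ i ∈ Finset.range Q, primitiveMoment k (i + 1) S ≤
        C * (((Q : ℝ) ^ 2 * S + (Q * S) ^ ((k : ℝ) / 2)) * (Q * S) ^ e) := by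
  have hk0 : (1 : ℝ) ≤ k := by exact_mod_cast hk
  set δ : ℝ := e / (8 * k) with hδdef
  have hδ : 0 < δ := by positivity
  have hδ2 : δ < 1 / 2 := by
    rw [hδdef, div_lt_iff₀ (by positivity)]
    linarith
  obtain ⟨C₀, hC₀, h₀⟩ := DirichletCharacter.exists_integral_norm_LFunction_pow_le
    (m := ⌈k / e⌉₊ + 1) (by omega) (by omega : k ≠ 0) hδ hδ2
  obtain ⟨C₁, hC₁, h₁⟩ := exists_moment_dirichletPoly_le k hδ
  refine ⟨C₀ * (C₁ * 2 ^ (k + 2) * 2 ^ (3 * e / 8) + 1), by positivity, ?_⟩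
  intro Q S hQ hS
  have hQ' : (1 : ℝ) ≤ Q := by exact_mod_cast hQ
  have hB : 1 ≤ (Q : ℝ) * S := one_le_mul_of_one_le_of_one_le hQ' hS
  obtain ⟨Y, hY, hXY, hYB, hYk⟩ := exists_length hk he he1 hB
  set X : ℝ := ((Q : ℝ) * S) ^ (1 / 2 : ℝ) with hX
  have hX1 : 1 ≤ X := Real.one_le_rpow hB (by norm_num)
  have hX2 : X ^ 2 = Q * S := by
    rw [hX, ← Real.rpow_natCast, ← Real.rpow_mul (by positivity)]
    norm_num
  have m1 := h₁ Q Y (1 / 2) (2 * S) hQ hY (by linarith) (by linarith)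
  have m2 := h₁ Q Y (1 / 2 - δ) (2 * S) hQ hY (by linarith) le_rfl
  have num := moment_numerics hk (A := (Q : ℝ) ^ 2 * S) he hB (by positivity)
    (by exact_mod_cast hY) hC₁ hYB hYk
  have e1 : (Q : ℝ) ^ 2 * (2 * S) = 2 * ((Q : ℝ) ^ 2 * S) := by ring
  rw [e1] at m1 m2
  set M : ℝ → ∀ i : ℕ, DirichletCharacter ℂ (i + 1) → ℝ := fun σ i χ =>
    if χ.IsPrimitive then ∫ t : ℝ, Real.exp (-((2 * S) ^ 2)⁻¹ * t ^ 2) *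
        ‖dirichletPoly χ Y (σ + t * I)‖ ^ (2 * k) else 0 with hM
  have hM0 : ∀ σ i χ, 0 ≤ M σ i χ := by
    intro σ i χ
    simp only [hM]
    split_ifs
    · exact integral_nonneg fun _ => by positivity
    · exact le_rfl
  have hXp : 0 ≤ X ^ (2 * k * δ) := by positivity
  have hpt : ∀ i ∈ Finset.range Q, primitiveMoment k (i + 1) S ≤
      C₀ * (∑ χ, M (1 / 2) i χ + X ^ (2 * k * δ) * ∑ χ, M (1 / 2 - δ) i χ +
        Fintype.card (DirichletCharacter ℂ (i + 1)) * S) := by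
    intro i hi
    have hcard : (Fintype.card (DirichletCharacter ℂ (i + 1)) : ℝ) * S =
      ∑ χ : DirichletCharacter ℂ (i + 1), S := by simp
    rw [primitiveMoment_eq, hcard, Finset.mul_sum, ← Finset.sum_add_distrib,
      ← Finset.sum_add_distrib, Finset.mul_sum]
    refine Finset.sum_le_sum fun χ _ => ?_
    split_ifs with h
    · have hi1 : i + 1 ≠ 1 := by
        intro h1
        exact h.2 (DirichletCharacter.level_one' χ h1)
      have hiQ : ((i + 1 : ℕ) : ℝ) * S ≤ X ^ 2 := by
        rw [hX2]
        gcongr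
        exact Finset.mem_range.mp hi
      have := h₀ h.1 hi1 Y X S hY hX1 hS hXY hiQ
      simpa only [hM, if_pos h.1] using this
    · have := hM0 (1 / 2) i χ
      have := mul_nonneg hXp (hM0 (1 / 2 - δ) i χ)
      exact mul_nonneg hC₀ (by linarith)
  refine (Finset.sum_le_sum hpt).trans ?_
  rw [← Finset.mul_sum, Finset.sum_add_distrib, Finset.sum_add_distrib, ← Finset.mul_sum,
    ← Finset.sum_mul, mul_assoc C₀]
  refine mul_le_mul_of_nonneg_left (le_trans ?_ num) hC₀
  have := sum_card_dirichletCharacter_le Q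
  gcongr

lemma two_pow_card_primeFactors_le {q : ℕ} (hq : q ≠ 0) :
    2 ^ q.primeFactors.card ≤ q.divisors.card := by
  rw [Nat.card_divisors hq, ← Finset.prod_const]
  refine Finset.prod_le_prod' fun p hp => ?_
  have := (Nat.prime_of_mem_primeFactors hp).factorization_pos_of_dvd hq
    (Nat.dvd_of_mem_primeFactors hp)
  omega

namespace DirichletCharacter

/-- Passing to an induced character costs at most a divisor-function factor on the critical line. -/
lemma norm_LFunction_changeLevel_le {d q : ℕ} [NeZero d] [NeZero q] (hd : d ∣ q)
    {ψ : DirichletCharacter ℂ d} (hψ : ψ ≠ 1) {s : ℂ} (hs : 0 ≤ s.re) :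
    ‖(changeLevel hd ψ).LFunction s‖ ≤ q.divisors.card * ‖ψ.LFunction s‖ := by
  rw [LFunction_changeLevel hd ψ (.inl hψ), norm_mul, mul_comm, norm_prod]
  gcongr
  calc ∏ p ∈ q.primeFactors, ‖1 - ψ p * (p : ℂ) ^ (-s)‖ ≤ ∏ p ∈ q.primeFactors, (2 : ℝ) := by
        refine Finset.prod_le_prod (fun _ _ => norm_nonneg _) fun p hp => ?_
        have hp0 := (Nat.prime_of_mem_primeFactors hp).pos
        have hp1 : (1 : ℝ) ≤ p := by exact_mod_cast hp0
        have h1 : ‖ψ p * (p : ℂ) ^ (-s)‖ ≤ 1 := by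
          rw [norm_mul, Complex.norm_natCast_cpow_of_pos hp0, neg_re]
          exact mul_le_one₀ (ψ.norm_le_one _) (by positivity)
            (Real.rpow_le_one_of_one_le_of_nonpos hp1 (by linarith))
        refine (norm_sub_le _ _).trans ?_
        rw [norm_one]
        linarith
    _ = ((2 ^ q.primeFactors.card : ℕ) : ℝ) := by simp
    _ ≤ q.divisors.card := by exact_mod_cast two_pow_card_primeFactors_le (NeZero.ne q)

/-- Sums over the characters modulo `q` of conductor `d` are sums over primitive characters. -/
lemma sum_conductor_eq_le {d q : ℕ} [NeZero d] [NeZero q] (hd : d ∣ q)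
    {F : DirichletCharacter ℂ q → ℝ} (hF : ∀ χ, 0 ≤ F χ) :
    ∑ χ with χ.conductor = d, F χ ≤
      ∑ ψ : DirichletCharacter ℂ d with ψ.IsPrimitive, F (changeLevel hd ψ) := by
  rw [← Finset.sum_image (f := F) (g := changeLevel hd) (changeLevel_injective hd).injOn]
  refine Finset.sum_le_sum_of_subset_of_nonneg (fun χ hχ => ?_) fun _ _ _ => hF _
  have h := (Finset.mem_filter.mp hχ).2
  subst h
  exact Finset.mem_image.mpr ⟨χ.primitiveCharacter,
    Finset.mem_filter.mpr ⟨Finset.mem_univ _, χ.primitiveCharacter_isPrimitive⟩,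
    χ.changeLevel_primitiveCharacter⟩

lemma integral_norm_LFunction_changeLevel_le {d q : ℕ} [NeZero d] [NeZero q] (hd : d ∣ q)
    {ψ : DirichletCharacter ℂ d} (hψ : ψ ≠ 1) (n : ℕ) {S : ℝ} (hS : 0 ≤ S) :
    ∫ t in (0 : ℝ)..S, ‖(changeLevel hd ψ).LFunction (1 / 2 + t * I)‖ ^ n ≤
      (q.divisors.card : ℝ) ^ n * ∫ t in (0 : ℝ)..S, ‖ψ.LFunction (1 / 2 + t * I)‖ ^ n := by
  have hc : ∀ {N : ℕ} [NeZero N] {χ : DirichletCharacter ℂ N}, χ ≠ 1 →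
      Continuous fun t : ℝ => ‖χ.LFunction (1 / 2 + t * I)‖ ^ n := fun hχ =>
    (((differentiable_LFunction hχ).continuous.comp (by fun_prop :
      Continuous fun t : ℝ => (1 / 2 : ℂ) + t * I)).norm).pow n
  have hψ' : changeLevel hd ψ ≠ 1 := fun h => hψ ((changeLevel_eq_one_iff hd).mp h)
  rw [← intervalIntegral.integral_const_mul]
  refine intervalIntegral.integral_mono_on hS ((hc hψ').intervalIntegrable _ _)
    (((hc hψ).const_mul _).intervalIntegrable _ _) fun t _ => ?_
  rw [← mul_pow]
  gcongr
  exact norm_LFunction_changeLevel_le hd hψ (by simp)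

end DirichletCharacter

lemma primitiveMoment_nonneg (k d : ℕ) {S : ℝ} (hS : 0 ≤ S) : 0 ≤ primitiveMoment k d S := by
  unfold primitiveMoment
  split_ifs
  · refine Finset.sum_nonneg fun ψ _ => ?_
    split_ifs
    · exact intervalIntegral.integral_nonneg hS fun _ _ => by positivity
    · exact le_rfl
  · exact le_rfl

lemma charMoment_le (k : ℕ) {q : ℕ} (hq : q ≠ 0) {S : ℝ} (hS : 0 ≤ S) :
    charMoment k q S ≤
      (q.divisors.card : ℝ) ^ (2 * k) * ∑ d ∈ q.divisors, primitiveMoment k d S := by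
  have : NeZero q := ⟨hq⟩
  rw [charMoment, dif_pos hq, tsum_fintype]
  set F : DirichletCharacter ℂ q → ℝ := fun χ => if χ ≠ 1 then
      ∫ t in (0 : ℝ)..S, ‖χ.LFunction (1 / 2 + t * I)‖ ^ (2 * k) else 0 with hFdef
  have hF : ∀ χ, 0 ≤ F χ := fun χ => by
    simp only [hFdef]
    split_ifs
    · exact intervalIntegral.integral_nonneg hS fun _ _ => by positivity
    · exact le_rfl
  change ∑ χ, F χ ≤ _
  rw [← Finset.sum_fiberwise_of_maps_to (s := Finset.univ) (t := q.divisors)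
    (g := fun χ : DirichletCharacter ℂ q => χ.conductor)
    (fun χ _ => Nat.mem_divisors.mpr ⟨χ.conductor_dvd_level, hq⟩), Finset.mul_sum]
  refine Finset.sum_le_sum fun d hd => ?_
  have hdq := Nat.dvd_of_mem_divisors hd
  have : NeZero d := ⟨fun h => hq (by simpa [h] using hdq)⟩
  refine (DirichletCharacter.sum_conductor_eq_le hdq hF).trans ?_
  rw [primitiveMoment_eq, Finset.sum_filter, Finset.mul_sum]
  refine Finset.sum_le_sum fun ψ _ => ?_
  by_cases h1 : ψ = 1
  · subst h1
    simp [hFdef]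
  · by_cases h2 : ψ.IsPrimitive
    · have h3 : DirichletCharacter.changeLevel hdq ψ ≠ 1 := fun h =>
        h1 ((DirichletCharacter.changeLevel_eq_one_iff hdq).mp h)
      rw [if_pos h2, if_pos ⟨h2, h1⟩]
      simp only [hFdef, if_pos h3]
      exact DirichletCharacter.integral_norm_LFunction_changeLevel_le hdq h1 _ hS
    · simp [h2]

/-- Dirichlet's rearrangement of a divisor sum. -/
lemma sum_Icc_sum_divisors {M : Type*} [AddCommMonoid M] (P : ℕ → M) (Q : ℕ) :
    ∑ q ∈ Finset.Icc 1 Q, ∑ d ∈ q.divisors, P d =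
      ∑ e ∈ Finset.Icc 1 Q, ∑ i ∈ Finset.range (Q / e), P (i + 1) := by
  have h1 : ∀ q ∈ Finset.Icc 1 Q, ∑ d ∈ q.divisors, P d =
      ∑ e ∈ Finset.Icc 1 Q, if e ∣ q then P (q / e) else 0 := by
    intro q hq
    rw [← Nat.sum_div_divisors, ← Finset.sum_filter]
    refine Finset.sum_congr ?_ fun _ _ => rfl
    ext e
    have hq := Finset.mem_Icc.mp hq
    simp only [Nat.mem_divisors, Finset.mem_filter, Finset.mem_Icc]
    constructor
    · intro h
      have := Nat.le_of_dvd (by omega) h.1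
      have := Nat.pos_of_dvd_of_pos h.1 (by omega)
      exact ⟨by omega, h.1⟩
    · exact fun h => ⟨h.2, by omega⟩
  rw [Finset.sum_congr rfl h1, Finset.sum_comm]
  refine Finset.sum_congr rfl fun e he => ?_
  have he0 : 0 < e := (Finset.mem_Icc.mp he).1
  rw [← Finset.sum_filter]
  symm
  refine Finset.sum_bij (fun i _ => e * (i + 1)) ?_ ?_ ?_ ?_
  · intro i hi
    have hi := Finset.mem_range.mp hi
    have h2 : e * (i + 1) ≤ Q := (Nat.mul_le_mul_left e hi).trans (Nat.mul_div_le Q e)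
    simp only [Finset.mem_filter, Finset.mem_Icc, dvd_mul_right, and_true]
    exact ⟨Nat.mul_pos he0 i.succ_pos, h2⟩
  · intro i _ j _ h
    have := Nat.eq_of_mul_eq_mul_left he0 h
    omega
  · intro q hq
    obtain ⟨h2, h3⟩ := Finset.mem_filter.mp hq
    obtain ⟨c, rfl⟩ := h3
    have h2 := Finset.mem_Icc.mp h2
    have hc : c ≠ 0 := by rintro rfl; simp at h2
    refine ⟨c - 1, Finset.mem_range.mpr ?_, by rw [Nat.sub_add_cancel (by omega)]⟩
    have := (Nat.le_div_iff_mul_le he0).mpr ((mul_comm c e).trans_le h2.2)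
    omega
  · intro i _
    rw [Nat.mul_div_cancel_left _ he0]

lemma sum_inv_Icc_le (Q : ℕ) {e : ℝ} (he : 0 < e) (hQ : 1 ≤ Q) :
    ∑ n ∈ Finset.Icc 1 Q, (n : ℝ)⁻¹ ≤ (1 + 1 / e) * (Q : ℝ) ^ e := by
  have hQ1 : (1 : ℝ) ≤ Q := by exact_mod_cast hQ
  have h1 := harmonic_le_one_add_log Q
  rw [harmonic_eq_sum_Icc] at h1
  push_cast at h1
  have h2 := Real.log_le_rpow_div (Nat.cast_nonneg Q) he
  have h3 := Real.one_le_rpow hQ1 he.le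
  calc _ ≤ 1 + (Q : ℝ) ^ e / e := h1.trans (by linarith)
    _ ≤ (Q : ℝ) ^ e + (Q : ℝ) ^ e / e := by linarith
    _ = _ := by ring

lemma moment_bound_div_le {k : ℕ} (hk : 2 ≤ k) {e S : ℝ} (he : 0 < e) (hS : 1 ≤ S) {Q n : ℕ}
    (hn : 1 ≤ n) :
    (((Q / n : ℕ) : ℝ) ^ 2 * S + (((Q / n : ℕ) : ℝ) * S) ^ ((k : ℝ) / 2)) *
        (((Q / n : ℕ) : ℝ) * S) ^ e ≤
      (n : ℝ)⁻¹ * (((Q : ℝ) ^ 2 * S + (Q * S) ^ ((k : ℝ) / 2)) * (Q * S) ^ e) := by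
  have hn1 : (1 : ℝ) ≤ n := by exact_mod_cast hn
  have hS0 : 0 ≤ S := by linarith
  have hk2 : (1 : ℝ) ≤ (k : ℝ) / 2 := by
    have : (2 : ℝ) ≤ k := by exact_mod_cast hk
    linarith
  have hi1 : (n : ℝ)⁻¹ ≤ 1 := inv_le_one_of_one_le₀ hn1
  have hi0 : (0 : ℝ) ≤ (n : ℝ)⁻¹ := by positivity
  have hN : ((Q / n : ℕ) : ℝ) ≤ (n : ℝ)⁻¹ * Q := Nat.cast_div_le.trans_eq (by ring)
  have hNQ : ((Q / n : ℕ) : ℝ) ≤ Q := hN.trans (mul_le_of_le_one_left (by positivity) hi1)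
  have hN0 : (0 : ℝ) ≤ ((Q / n : ℕ) : ℝ) := by positivity
  have a1 : ((Q / n : ℕ) : ℝ) ^ 2 * S ≤ (n : ℝ)⁻¹ * ((Q : ℝ) ^ 2 * S) := by
    calc ((Q / n : ℕ) : ℝ) ^ 2 * S = ((Q / n : ℕ) : ℝ) * ((Q / n : ℕ) : ℝ) * S := by ring
      _ ≤ ((n : ℝ)⁻¹ * Q) * Q * S := by gcongr
      _ = _ := by ring
  have a2 : (((Q / n : ℕ) : ℝ) * S) ^ ((k : ℝ) / 2) ≤
      (n : ℝ)⁻¹ * (Q * S) ^ ((k : ℝ) / 2) := by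
    calc (((Q / n : ℕ) : ℝ) * S) ^ ((k : ℝ) / 2) ≤ ((n : ℝ)⁻¹ * (Q * S)) ^ ((k : ℝ) / 2) := by
          refine Real.rpow_le_rpow (by positivity) ?_ (by linarith)
          rw [← mul_assoc]
          gcongr
      _ = ((n : ℝ)⁻¹) ^ ((k : ℝ) / 2) * (Q * S) ^ ((k : ℝ) / 2) :=
          Real.mul_rpow hi0 (by positivity)
      _ ≤ _ := by
          gcongr
          exact (Real.rpow_le_rpow_of_exponent_ge (by positivity) hi1 hk2).trans_eq
            (Real.rpow_one _)
  rw [← mul_assoc, mul_add]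
  gcongr

/-- The moment bound with the sum over moduli up to a natural number. -/
lemma exists_sum_charMoment_le {k : ℕ} (hk : 2 ≤ k) {e : ℝ} (he : 0 < e) (he1 : e ≤ 1) :
    ∃ C, 0 ≤ C ∧ ∀ (Q : ℕ) (S : ℝ), 1 ≤ Q → 1 ≤ S →
      ∑ q ∈ Finset.Icc 1 Q, charMoment k q S ≤
        C * (((Q : ℝ) ^ 2 * S + (Q * S) ^ ((k : ℝ) / 2)) * (Q * S) ^ (3 * e)) := by
  have hk0 : (0 : ℝ) < k := by exact_mod_cast (by omega : 0 < k)
  obtain ⟨C₁, hC₁, h₁⟩ := exists_sum_primitiveMoment_le (by omega : 1 ≤ k) he he1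
  obtain ⟨C₂, hC₂, h₂⟩ := exists_card_divisors_le (ε := e / (2 * k)) (by positivity)
  refine ⟨C₂ ^ (2 * k) * (C₁ * (1 + 1 / e)), by positivity, ?_⟩
  intro Q S hQ hS
  have hQ1 : (1 : ℝ) ≤ Q := by exact_mod_cast hQ
  have hS0 : 0 ≤ S := by linarith
  have hB : 1 ≤ (Q : ℝ) * S := one_le_mul_of_one_le_of_one_le hQ1 hS
  have hB0 : 0 < (Q : ℝ) * S := by linarith
  have hQB : (Q : ℝ) ≤ Q * S := le_mul_of_one_le_right (by linarith) hS
  set A := ((Q : ℝ) ^ 2 * S + (Q * S) ^ ((k : ℝ) / 2)) * (Q * S) ^ e with hA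
  have hA0 : 0 ≤ A := by positivity
  have hdiv : ∀ q ∈ Finset.Icc 1 Q, (q.divisors.card : ℝ) ^ (2 * k) ≤
      C₂ ^ (2 * k) * (Q * S) ^ e := by
    intro q hq
    obtain ⟨hq1, hqQ⟩ := Finset.mem_Icc.mp hq
    have hqB : (q : ℝ) ≤ Q * S := le_trans (by exact_mod_cast hqQ) hQB
    have h3 : (q.divisors.card : ℝ) ≤ C₂ * (Q * S) ^ (e / (2 * k)) := by
      refine (h₂ q (by omega)).trans ?_
      gcongr
    refine (pow_le_pow_left₀ (by positivity) h3 _).trans_eq ?_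
    rw [mul_pow, ← Real.rpow_natCast (((Q : ℝ) * S) ^ (e / (2 * k))), ← Real.rpow_mul hB0.le]
    congr 2
    push_cast
    field_simp
  have hP : ∑ q ∈ Finset.Icc 1 Q, ∑ d ∈ q.divisors, primitiveMoment k d S ≤
      C₁ * (1 + 1 / e) * (A * (Q * S) ^ e) := by
    rw [sum_Icc_sum_divisors]
    calc _ ≤ ∑ n ∈ Finset.Icc 1 Q, C₁ * ((n : ℝ)⁻¹ * A) := by
          refine Finset.sum_le_sum fun n hn => ?_
          obtain ⟨hn1, hnQ⟩ := Finset.mem_Icc.mp hn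
          refine (h₁ (Q / n) S (Nat.div_pos hnQ hn1) hS).trans ?_
          exact mul_le_mul_of_nonneg_left (moment_bound_div_le hk he hS hn1) hC₁
      _ = C₁ * ((∑ n ∈ Finset.Icc 1 Q, (n : ℝ)⁻¹) * A) := by
          rw [← Finset.mul_sum, Finset.sum_mul]
      _ ≤ C₁ * (((1 + 1 / e) * (Q * S) ^ e) * A) := by
          gcongr
          exact (sum_inv_Icc_le Q he hQ).trans (by gcongr)
      _ = _ := by ring
  calc _ ≤ ∑ q ∈ Finset.Icc 1 Q, C₂ ^ (2 * k) * (Q * S) ^ e *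
        ∑ d ∈ q.divisors, primitiveMoment k d S := by
        refine Finset.sum_le_sum fun q hq => ?_
        refine (charMoment_le k (by have := (Finset.mem_Icc.mp hq).1; omega) hS0).trans ?_
        exact mul_le_mul_of_nonneg_right (hdiv q hq)
          (Finset.sum_nonneg fun d _ => primitiveMoment_nonneg k d hS0)
    _ ≤ C₂ ^ (2 * k) * (Q * S) ^ e * (C₁ * (1 + 1 / e) * (A * (Q * S) ^ e)) := by
        rw [← Finset.mul_sum]
        gcongr
    _ = C₂ ^ (2 * k) * (C₁ * (1 + 1 / e)) * (((Q : ℝ) ^ 2 * S + (Q * S) ^ ((k : ℝ) / 2)) *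
        ((Q * S) ^ e * ((Q * S) ^ e * (Q * S) ^ e))) := by rw [hA]; ring
    _ = _ := by
        rw [← Real.rpow_add hB0, ← Real.rpow_add hB0]
        congr 4
        ring

/-- unconditional (large-sieve) bound for `2k`-th moments of
Dirichlet L-functions averaged over moduli `q ≤ R` and `t ∈ [0,S]`. -/
theorem moment_bound_unconditional (k : ℕ) (hk : 2 ≤ k) (ε : ℝ) (hε : 0 < ε) :
    ∃ C : ℝ, ∀ R S : ℝ, 1 ≤ R → 1 ≤ S →
      ∑ q ∈ Finset.Icc 1 ⌊R⌋₊, charMoment k q S ≤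
        C * (R^2 * S + (R * S) ^ ((k : ℝ) / 2)) * (R * S) ^ ε := by
  have hk0 : (0 : ℝ) < k := by exact_mod_cast (by omega : 0 < k)
  obtain ⟨C, hC, h⟩ := exists_sum_charMoment_le hk (e := min (ε / 3) 1)
    (lt_min (by positivity) one_pos) (min_le_right _ _)
  refine ⟨C, fun R S hR hS => ?_⟩
  have hQ : ((⌊R⌋₊ : ℕ) : ℝ) ≤ R := Nat.floor_le (by linarith)
  refine (h ⌊R⌋₊ S (Nat.one_le_floor_iff R |>.mpr hR) hS).trans ?_
  have hB : 1 ≤ R * S := one_le_mul_of_one_le_of_one_le hR hS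
  have h1 : (((⌊R⌋₊ : ℕ) : ℝ) * S) ^ (3 * min (ε / 3) 1) ≤ (R * S) ^ ε := by
    calc _ ≤ (R * S) ^ (3 * min (ε / 3) 1) :=
          Real.rpow_le_rpow (by positivity) (by gcongr) (by positivity)
      _ ≤ _ := Real.rpow_le_rpow_of_exponent_le hB
          (by linarith [min_le_left (ε / 3) 1])
  rw [mul_assoc]
  gcongr
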